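/- Let Φ and Ψ be linear flows on X = ℝ^d. Then the following five statements are equivalent: (i) Φ ≃^{0⁺} Ψ; (ii) Φ ~^{0⁺} Ψ; (iii) Φ ≃^{0} Ψ; (iv) Φ ~^{0} Ψ; (v) {d_S^Φ, d_U^Φ} = {d_S^Ψ, d_U^Ψ}, and there exists α ∈ ℝ∖{0} such that A^{Φ_C} and α A^{Ψ_C} are similar. In particular, mere orbit equivalence of linear flows already entails the existence of a some-Hölder homeomorphism h and α ∈ ℝ∖{0} with h(Φ_t x) = Ψ_{αt} h(x) for all t, x. -/

import Mathlib

noncomputable section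
namespace LF

open Filter Topology

/-- `ℝ^d` with the Euclidean norm. -/
abbrev Euc (d : ℕ) := EuclideanSpace ℝ (Fin d)

variable {d : ℕ}

/-- The time-`t` map of the linear flow on `ℝ^d` generated by the matrix `A`,
i.e. `x ↦ exp (t A) x`. -/
def linFlow (A : Matrix (Fin d) (Fin d) ℝ) (t : ℝ) (x : Euc d) : Euc d :=
  Matrix.toEuclideanLin (NormedSpace.exp (t • A)) x

/-- The orbit `{Φ_t x : t ∈ ℝ}` of `x` under the linear flow generated by `A`. -/
def flowOrbit (A : Matrix (Fin d) (Fin d) ℝ) (x : Euc d) : Set (Euc d) :=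
  Set.range fun t : ℝ => linFlow A t x

/-- `Φ` is `h`-related to `Ψ`: the homeomorphism `h` maps every orbit of the flow
generated by `A` onto an orbit of the flow generated by `B`. -/
def IsOrbitEquiv (A B : Matrix (Fin d) (Fin d) ℝ) (h : Euc d ≃ₜ Euc d) : Prop :=
  ∀ x : Euc d, h '' flowOrbit A x = flowOrbit B (h x)

/-- `f` satisfies a `β`-Hölder condition on some ball centred at `0`. -/
def HolderNearZero (β : ℝ) (f : Euc d → Euc d) : Prop :=
  ∃ r > (0 : ℝ), ∃ K : ℝ, ∀ x ∈ Metric.ball (0 : Euc d) r, ∀ y ∈ Metric.ball (0 : Euc d) r,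
    dist (f x) (f y) ≤ K * dist x y ^ β

/-- `h ∈ 𝓗_β`: `h 0 = 0` and `h`, `h⁻¹` both satisfy a `β`-Hölder condition near `0`. -/
def MemHolderClass (β : ℝ) (h : Euc d ≃ₜ Euc d) : Prop :=
  h 0 = 0 ∧ HolderNearZero β ⇑h ∧ HolderNearZero β ⇑h.symm

/-- `h ∈ 𝓗_0`: homeomorphisms fixing `0`. -/
def MemH0 (h : Euc d ≃ₜ Euc d) : Prop := h 0 = 0

/-- `h ∈ 𝓗_{0⁺} = ⋃_{γ>0} 𝓗_γ`. -/
def MemH0plus (h : Euc d ≃ₜ Euc d) : Prop := ∃ γ : ℝ, 0 < γ ∧ MemHolderClass γ h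

/-- `h ∈ 𝓗_{1⁻} = ⋂_{0<γ<1} 𝓗_γ`. -/
def MemH1minus (h : Euc d ≃ₜ Euc d) : Prop := ∀ γ : ℝ, 0 < γ → γ < 1 → MemHolderClass γ h

/-- `h ∈ 𝓗_{β⁻} = ⋂_{0<γ<β} 𝓗_γ`. -/
def MemHBelow (β : ℝ) (h : Euc d ≃ₜ Euc d) : Prop :=
  ∀ γ : ℝ, 0 < γ → γ < β → MemHolderClass γ h

/-- `h ∈ 𝓗_{β⁺} = ⋃_{γ>β} 𝓗_γ`. -/
def MemHAbove (β : ℝ) (h : Euc d ≃ₜ Euc d) : Prop :=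
  ∃ γ : ℝ, β < γ ∧ MemHolderClass γ h

/-- `φ ~^⋆ ψ`: `φ` is `h`-related to `ψ` for some `h` in the class `P`. -/
def RelEquivWith (P : (Euc d ≃ₜ Euc d) → Prop) (A B : Matrix (Fin d) (Fin d) ℝ) : Prop :=
  ∃ h : Euc d ≃ₜ Euc d, P h ∧ IsOrbitEquiv A B h

/-- `φ ≃^⋆ ψ`: there are `h` in the class `P` and `α ≠ 0` with
`h (φ t x) = ψ (α t) (h x)` for all `t`, `x`. -/
def SimEquivWith (P : (Euc d ≃ₜ Euc d) → Prop) (A B : Matrix (Fin d) (Fin d) ℝ) : Prop :=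
  ∃ (h : Euc d ≃ₜ Euc d) (α : ℝ), α ≠ 0 ∧ P h ∧
    ∀ (t : ℝ) (x : Euc d), h (linFlow A t x) = linFlow B (α * t) (h x)

/-- The stable set `X_S^Φ = {x : Φ_t x → 0 as t → ∞}`. -/
def stableSet (A : Matrix (Fin d) (Fin d) ℝ) : Set (Euc d) :=
  {x | Tendsto (fun t : ℝ => linFlow A t x) atTop (𝓝 0)}

/-- The unstable set `X_U^Φ = {x : Φ_t x → 0 as t → -∞}`. -/
def unstableSet (A : Matrix (Fin d) (Fin d) ℝ) : Set (Euc d) :=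
  {x | Tendsto (fun t : ℝ => linFlow A t x) atBot (𝓝 0)}

/-- The central set `X_C^Φ = {x : e^{-ε|t|} Φ_t x → 0 as |t| → ∞, for every ε > 0}`. -/
def centralSet (A : Matrix (Fin d) (Fin d) ℝ) : Set (Euc d) :=
  {x | ∀ ε > (0 : ℝ),
    Tendsto (fun t : ℝ => Real.exp (-(ε * |t|)) • linFlow A t x) (atBot ⊔ atTop) (𝓝 0)}

/-- The stable subspace of the flow generated by `A` (the stable set is a subspace,
so taking its span is innocuous). -/
def XS (A : Matrix (Fin d) (Fin d) ℝ) : Submodule ℝ (Euc d) := Submodule.span ℝ (stableSet A)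

/-- The unstable subspace. -/
def XU (A : Matrix (Fin d) (Fin d) ℝ) : Submodule ℝ (Euc d) := Submodule.span ℝ (unstableSet A)

/-- The central subspace. -/
def XC (A : Matrix (Fin d) (Fin d) ℝ) : Submodule ℝ (Euc d) := Submodule.span ℝ (centralSet A)

/-- The hyperbolic subspace `X_H^Φ = X_S^Φ ⊕ X_U^Φ`. -/
def XH (A : Matrix (Fin d) (Fin d) ℝ) : Submodule ℝ (Euc d) := XS A ⊔ XU A

def dimS (A : Matrix (Fin d) (Fin d) ℝ) : ℕ := Module.finrank ℝ (XS A)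
def dimU (A : Matrix (Fin d) (Fin d) ℝ) : ℕ := Module.finrank ℝ (XU A)
def dimHyp (A : Matrix (Fin d) (Fin d) ℝ) : ℕ := Module.finrank ℝ (XH A)

/-- The central-part generators `A^{Φ_C}` and `α A^{Ψ_C}` are similar, i.e.
`Q A_C = (α B_C) Q` for some linear isomorphism `Q : X_C^Φ → X_C^Ψ`. -/
def IsCentralSimilar (A B : Matrix (Fin d) (Fin d) ℝ) (α : ℝ) : Prop :=
  ∃ (hA : ∀ x ∈ XC A, Matrix.toEuclideanLin A x ∈ XC A)
    (hB : ∀ x ∈ XC B, Matrix.toEuclideanLin B x ∈ XC B)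
    (Q : XC A ≃ₗ[ℝ] XC B),
    ∀ x : XC A, Q ((Matrix.toEuclideanLin A).restrict hA x)
      = α • (Matrix.toEuclideanLin B).restrict hB (Q x)

/-- The forward Lyapunov exponent `λ_+^Φ(x) = lim_{t→∞} log ‖Φ_t x‖ / t`
(the limit exists for `x ≠ 0`, so it equals the `limsup` used here). -/
def lyap (A : Matrix (Fin d) (Fin d) ℝ) (x : Euc d) : ℝ :=
  Filter.limsup (fun t : ℝ => Real.log ‖linFlow A t x‖ / t) atTop

/-- The Lyapunov space `L^Φ(s) = {x : λ_+^Φ(x) ≤ s}` (with `λ_+^Φ(0) = -∞`), as a set. -/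
def lyapSet (A : Matrix (Fin d) (Fin d) ℝ) (s : ℝ) : Set (Euc d) :=
  {x | x = 0 ∨ lyap A x ≤ s}

/-- `ℓ^Φ(s) = dim L^Φ(s)` (the Lyapunov set is a subspace, so taking its span is innocuous). -/
def ell (A : Matrix (Fin d) (Fin d) ℝ) (s : ℝ) : ℕ :=
  Module.finrank ℝ (Submodule.span ℝ (lyapSet A s))

/-- The `(j+1)`-st smallest Lyapunov exponent `λ_{j+1}^Φ`, counted with multiplicity. -/
def lyapExp (A : Matrix (Fin d) (Fin d) ℝ) (j : ℕ) : ℝ :=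
  sInf {s : ℝ | j + 1 ≤ ell A s}

/-- The Lyapunov space at `s` of the restriction of the flow to the invariant set `V`. -/
def lyapSetIn (A : Matrix (Fin d) (Fin d) ℝ) (V : Set (Euc d)) (s : ℝ) : Set (Euc d) :=
  {x | x ∈ V ∧ (x = 0 ∨ lyap A x ≤ s)}

def ellIn (A : Matrix (Fin d) (Fin d) ℝ) (V : Set (Euc d)) (s : ℝ) : ℕ :=
  Module.finrank ℝ (Submodule.span ℝ (lyapSetIn A V s))

/-- The `(j+1)`-st smallest Lyapunov exponent of the flow restricted to `V`. -/
def lyapExpIn (A : Matrix (Fin d) (Fin d) ℝ) (V : Set (Euc d)) (j : ℕ) : ℝ :=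
  sInf {s : ℝ | j + 1 ≤ ellIn A V s}

/-- `λ_{j+1}^{Φ_H}`: the `(j+1)`-st smallest Lyapunov exponent of the restriction
of the flow to the hyperbolic subspace. -/
def lyapExpH (A : Matrix (Fin d) (Fin d) ℝ) (j : ℕ) : ℝ :=
  lyapExpIn A (XH A) j

/-- The flow generated by `A` is stable: every orbit tends to `0` as `t → ∞`. -/
def IsStable (A : Matrix (Fin d) (Fin d) ℝ) : Prop := ∀ x : Euc d, x ∈ stableSet A

/-- The flow generated by `A` is unstable: every orbit tends to `0` as `t → -∞`. -/
def IsUnstable (A : Matrix (Fin d) (Fin d) ℝ) : Prop := ∀ x : Euc d, x ∈ unstableSet A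

/-- The flow generated by `A` is hyperbolic: `X = X_S ⊕ X_U`. -/
def IsHyperbolic (A : Matrix (Fin d) (Fin d) ℝ) : Prop := IsCompl (XS A) (XU A)

/-- `ρ_+(Φ,Ψ) = (min_j λ_j^Φ/λ_j^Ψ) / |max_j λ_j^Φ/λ_j^Ψ|`. -/
def rhoPlus (A B : Matrix (Fin d) (Fin d) ℝ) : ℝ :=
  (⨅ j : Fin d, lyapExp A j / lyapExp B j) / |⨆ j : Fin d, lyapExp A j / lyapExp B j|

/-- The Lyapunov cross ratio `ρ(Φ,Ψ) = max {ρ_+(Φ,Ψ), ρ_+(Φ*,Ψ)}`, where `Φ*` is the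
time-reversal of `Φ`, generated by `-A`. -/
def rho (A B : Matrix (Fin d) (Fin d) ℝ) : ℝ := max (rhoPlus A B) (rhoPlus (-A) B)

/-- The minimal period `T_x^Φ = inf {t > 0 : Φ_t x = x} ∈ [0,∞]` (with `inf ∅ = ∞`). -/
def minPeriod (A : Matrix (Fin d) (Fin d) ℝ) (x : Euc d) : EReal :=
  sInf {T : EReal | ∃ t : ℝ, 0 < t ∧ linFlow A t x = x ∧ T = (t : EReal)}

/-- The set of complex eigenvalues of the real matrix `A`. -/
def cSpec {n : ℕ} (A : Matrix (Fin n) (Fin n) ℝ) : Set ℂ :=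
  spectrum ℂ (A.map Complex.ofReal)

/-- `x` is a fixed point of the flow generated by `A`. -/
def IsFixedPt (A : Matrix (Fin d) (Fin d) ℝ) (x : Euc d) : Prop :=
  ∀ t : ℝ, linFlow A t x = x

/-- The nilpotent `m × m` Jordan block `J_m` (ones on the superdiagonal). -/
def jordanNil (m : ℕ) : Matrix (Fin m) (Fin m) ℝ :=
  Matrix.of fun i j => if (i : ℕ) + 1 = (j : ℕ) then 1 else 0


set_option linter.unusedSectionVars false
set_option linter.deprecated false
set_option linter.unusedVariables false

section M1_part

section Brouwer

lemma det_interp (n : ℕ) (δ : ℝ) (hδ : 0 < δ) : ∃ (t : Fin (n+1) → ℝ) (w : Fin (n+1) → ℝ),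
    (∀ i, 0 ≤ t i ∧ t i < δ) ∧ ∀ p : Polynomial ℝ, p.natDegree ≤ n →
      p.eval 1 = ∑ i, w i * p.eval (t i) := by
  classical
  let t : Fin (n+1) → ℝ := fun i => δ * (i : ℝ) / (n + 1)
  have hinj : Set.InjOn t (Finset.univ : Finset (Fin (n+1))) := by
    intro i _ j _ hij
    simp only [t] at hij
    have h1 : ((n : ℝ) + 1) ≠ 0 := by positivity
    field_simp at hij
    exact Fin.ext (by exact_mod_cast hij)
  refine ⟨t, fun i => (Lagrange.basis Finset.univ t i).eval 1, ?_, ?_⟩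
  · intro i
    refine ⟨by positivity, ?_⟩
    have h1 : ((i : ℕ) : ℝ) < n + 1 := by exact_mod_cast i.2
    simp only [t]
    rw [div_lt_iff₀ (by positivity)]
    exact mul_lt_mul_of_pos_left h1 hδ
  · intro p hp
    have h := Lagrange.eq_interpolate_of_eval_eq (s := Finset.univ) (v := t)
      (fun i => p.eval (t i)) (f := p) hinj ?_ (fun i _ => rfl)
    · conv_lhs => rw [h]
      rw [Lagrange.interpolate_apply, Polynomial.eval_finsetSum]
      refine Finset.sum_congr rfl fun i _ => ?_
      rw [Polynomial.eval_mul, Polynomial.eval_C, mul_comm]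
    · refine lt_of_le_of_lt Polynomial.degree_le_natDegree ?_
      simp only [Finset.card_univ, Fintype.card_fin]
      exact_mod_cast Nat.lt_succ_of_le hp

variable {E : Type*} [NormedAddCommGroup E] [InnerProductSpace ℝ E] [FiniteDimensional ℝ E]

lemma det_poly (M : E →L[ℝ] E) : ∃ p : Polynomial ℝ, p.natDegree ≤ Module.finrank ℝ E ∧
    ∀ t : ℝ, p.eval t = (1 + t • M : E →L[ℝ] E).det := by
  classical
  let b := Module.finBasis ℝ E
  let m := LinearMap.toMatrix b b (M : E →ₗ[ℝ] E)
  refine ⟨(Matrix.det ((Polynomial.X : Polynomial ℝ) • m.map Polynomial.C +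
    (1 : Matrix _ _ ℝ).map Polynomial.C)), ?_, ?_⟩
  · have := Polynomial.natDegree_det_X_add_C_le m 1
    simpa using this
  · intro t
    have h1 := RingHom.map_det (Polynomial.evalRingHom t)
      ((Polynomial.X : Polynomial ℝ) • m.map Polynomial.C + (1 : Matrix _ _ ℝ).map Polynomial.C)
    rw [Polynomial.coe_evalRingHom] at h1
    rw [h1]
    have h2 : (Polynomial.evalRingHom t).mapMatrix ((Polynomial.X : Polynomial ℝ) •
        m.map Polynomial.C + (1 : Matrix _ _ ℝ).map Polynomial.C) = 1 + t • m := by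
      ext i j
      simp [add_comm, Matrix.one_apply]
      split_ifs <;> simp [mul_comm]
    rw [h2, ContinuousLinearMap.det, ← LinearMap.det_toMatrix b]
    congr 1
    simp [m, LinearMap.toMatrix_one]

lemma det_pos_of_small (M : E →L[ℝ] E) (t : ℝ) (ht : 0 ≤ t) (h : t * ‖M‖ < 1) :
    0 < (1 + t • M : E →L[ℝ] E).det := by
  obtain ⟨p, -, hp⟩ := det_poly M
  have hne : ∀ s ∈ Set.Icc 0 t, p.eval s ≠ 0 := by
    intro s hs h0
    rw [hp] at h0
    have h1 : LinearMap.det ((1 + s • M : E →L[ℝ] E) : E →ₗ[ℝ] E) = 0 := h0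
    have h2 := LinearMap.bot_lt_ker_of_det_eq_zero h1
    obtain ⟨v, hv, hv0⟩ := (Submodule.ne_bot_iff _).1 h2.ne'
    have h3 : v + s • M v = 0 := by simpa using hv
    have h4 : ‖v‖ ≤ s * ‖M‖ * ‖v‖ := by
      have : v = -(s • M v) := eq_neg_of_add_eq_zero_left h3
      calc ‖v‖ = ‖s • M v‖ := by conv_lhs => rw [this, norm_neg]
        _ = s * ‖M v‖ := by rw [norm_smul, Real.norm_of_nonneg hs.1]
        _ ≤ s * (‖M‖ * ‖v‖) := mul_le_mul_of_nonneg_left (M.le_opNorm v) hs.1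
        _ = _ := by ring
    have h5 : 0 < ‖v‖ := norm_pos_iff.2 hv0
    have h6 : s * ‖M‖ < 1 := lt_of_le_of_lt (mul_le_mul_of_nonneg_right hs.2 (norm_nonneg _)) h
    nlinarith
  by_contra hneg
  rw [← hp] at hneg
  push Not at hneg
  have h0 : p.eval 0 = 1 := by
    rw [hp]; simp [ContinuousLinearMap.det]
  have := intermediate_value_Icc' ht (p.continuous.continuousOn (s := Set.Icc 0 t))
  obtain ⟨s, hs, hs0⟩ := this ⟨hneg, by simp [h0]⟩
  exact hne s hs hs0

lemma no_smooth_retract (r : E → E) (hr : ContDiff ℝ 1 r) (hn : ∀ x, ‖r x‖ = 1)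
    (hid : ∀ x, ‖x‖ = 1 → r x = x) : False := by
  classical
  let _ : MeasurableSpace E := borel E
  have : BorelSpace E := ⟨rfl⟩
  let μ : MeasureTheory.Measure E := MeasureTheory.volume
  set B : Set E := Metric.closedBall 0 1 with hB
  have hBc : IsCompact B := isCompact_closedBall 0 1
  have hdr : Continuous (fderiv ℝ r) := hr.continuous_fderiv one_ne_zero
  obtain ⟨L, hL⟩ : ∃ L : ℝ, ∀ x ∈ B, ‖fderiv ℝ r x - 1‖ ≤ L := by
    obtain ⟨L, hL⟩ := hBc.exists_bound_of_continuousOn (f := fun x => fderiv ℝ r x - 1)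
      ((hdr.sub continuous_const).continuousOn)
    exact ⟨L, hL⟩
  have hL0 : 0 ≤ L := (norm_nonneg _).trans (hL 0 (by simp [hB]))
  have hdiff : ∀ x, HasFDerivAt (fun y => r y - y) (fderiv ℝ r x - 1) x := fun x =>
    ((hr.differentiable one_ne_zero x).hasFDerivAt).sub (hasFDerivAt_id x)
  have hlipB : ∀ x ∈ B, ∀ y ∈ B, ‖(r y - y) - (r x - x)‖ ≤ L * ‖y - x‖ := by
    intro x hx y hy
    exact (convex_closedBall (0:E) 1).norm_image_sub_le_of_norm_hasFDerivWithin_le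
      (fun z hz => (hdiff z).hasFDerivWithinAt) hL hx hy
  let g : E → E := fun x => if x ∈ B then r x - x else 0
  have hgB : ∀ x ∈ B, g x = r x - x := fun x hx => by simp [g, hx]
  have hgo : ∀ x, x ∉ B → g x = 0 := fun x hx => by simp [g, hx]
  have hcross : ∀ x ∈ B, ∀ y, y ∉ B → ‖g x‖ ≤ L * ‖y - x‖ := by
    intro x hx y hy
    have hc : ContinuousOn (fun s : ℝ => ‖x + s • (y - x)‖) (Set.Icc 0 1) := by fun_prop
    have hx' : ‖x‖ ≤ 1 := by simpa [hB] using hx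
    have hy' : 1 < ‖y‖ := by simpa [hB] using hy
    obtain ⟨s, hs, hs1⟩ := intermediate_value_Icc zero_le_one hc (show (1:ℝ) ∈ _ by
      constructor
      · simpa using hx'
      · simpa using hy'.le)
    simp only at hs1
    have hw : (x + s • (y - x)) ∈ B := by simp [hB, hs1]
    have h1 := hlipB _ hw x hx
    rw [hid _ hs1, sub_self, sub_zero] at h1
    rw [hgB x hx]
    refine h1.trans (mul_le_mul_of_nonneg_left ?_ hL0)
    rw [sub_add_cancel_left, norm_neg, norm_smul, Real.norm_of_nonneg hs.1]
    exact mul_le_of_le_one_left (norm_nonneg _) hs.2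
  have hglip : ∀ x y, ‖g y - g x‖ ≤ L * ‖y - x‖ := by
    intro x y
    by_cases hx : x ∈ B <;> by_cases hy : y ∈ B
    · rw [hgB x hx, hgB y hy]; exact hlipB x hx y hy
    · rw [hgo y hy, zero_sub, norm_neg]; exact hcross x hx y hy
    · rw [hgo x hx, sub_zero, norm_sub_rev y x]; exact hcross y hy x hx
    · rw [hgo x hx, hgo y hy, sub_zero, norm_zero]; positivity
  set δ : ℝ := 1 / (L + 1) with hδ
  have hδ0 : 0 < δ := by positivity
  have hvol : ∀ t : ℝ, 0 ≤ t → t < δ →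
      ∫ x in B, (1 + t • (fderiv ℝ r x - 1) : E →L[ℝ] E).det ∂μ = μ.real B := by
    intro t ht htδ
    have htL : t * L < 1 := by
      rw [hδ, lt_div_iff₀ (by positivity)] at htδ
      nlinarith
    let F : E → E := fun x => x + t • g x
    have hFB : ∀ x ∈ B, F x = x + t • (r x - x) := fun x hx => by simp [F, hgB x hx]
    have hFo : ∀ x, x ∉ B → F x = x := fun x hx => by simp [F, hgo x hx]
    have hinj : Function.Injective F := by
      intro x y hxy
      have h1 : y - x = - (t • (g y - g x)) := by
        simp only [F] at hxy
        rw [smul_sub]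
        have : y = x + t • g x - t • g y := by rw [hxy]; abel
        rw [sub_eq_iff_eq_add]
        conv_lhs => rw [this]
        abel
      have h2 : ‖y - x‖ ≤ t * (L * ‖y - x‖) := by
        calc ‖y - x‖ = t * ‖g y - g x‖ := by
              conv_lhs => rw [h1, norm_neg, norm_smul, Real.norm_of_nonneg ht]
          _ ≤ _ := mul_le_mul_of_nonneg_left (hglip x y) ht
      by_contra hne
      have : 0 < ‖y - x‖ := norm_pos_iff.2 (sub_ne_zero.2 (Ne.symm hne))
      nlinarith
    have hsurj : Function.Surjective F := by
      intro y
      have hK : ContractingWith (Real.toNNReal (t * L)) (fun x => y - t • g x) := by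
        refine ⟨?_, ?_⟩
        · rw [← NNReal.coe_lt_coe, Real.coe_toNNReal _ (by positivity)]; simpa using htL
        · refine LipschitzWith.of_dist_le_mul fun a b => ?_
          rw [Real.coe_toNNReal _ (by positivity), dist_eq_norm, dist_eq_norm]
          have : y - t • g a - (y - t • g b) = t • (g b - g a) := by rw [smul_sub]; abel
          rw [this, norm_smul, Real.norm_of_nonneg ht, norm_sub_rev a b, mul_assoc]
          exact mul_le_mul_of_nonneg_left (hglip a b) ht
      refine ⟨hK.fixedPoint, ?_⟩
      have h := hK.fixedPoint_isFixedPt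
      have h' : y - t • g hK.fixedPoint = hK.fixedPoint := h
      simp only [F]
      nth_rewrite 1 [← h']
      abel
    have himg : F '' B = B := by
      ext y
      constructor
      · rintro ⟨x, hx, rfl⟩
        by_contra hn
        have := hinj (hFo _ hn)
        exact hn (by rw [this]; exact hx)
      · intro hy
        obtain ⟨x, rfl⟩ := hsurj y
        refine ⟨x, ?_, rfl⟩
        by_contra hx
        exact hx (hFo x hx ▸ hy)
    have hcv := MeasureTheory.integral_image_eq_integral_abs_det_fderiv_smul μ (s := B) (f := F)
      (f' := fun x => 1 + t • (fderiv ℝ r x - 1)) Metric.isClosed_closedBall.measurableSet ?_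
      hinj.injOn (fun _ => (1:ℝ))
    · rw [himg] at hcv
      have h1 : ∫ x in B, (1:ℝ) ∂μ = μ.real B := by simp
      rw [← h1, hcv]
      refine MeasureTheory.setIntegral_congr_fun Metric.isClosed_closedBall.measurableSet
        fun x hx => ?_
      simp only [smul_eq_mul, mul_one]
      rw [abs_of_pos]
      exact det_pos_of_small _ t ht
        (lt_of_le_of_lt (mul_le_mul_of_nonneg_left (hL x hx) ht) htL)
    · intro x hx
      have h1 : HasFDerivAt (fun y => y + t • (r y - y)) (1 + t • (fderiv ℝ r x - 1)) x :=
        (hasFDerivAt_id x).add ((hdiff x).const_smul t)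
      exact h1.hasFDerivWithinAt.congr hFB (hFB x hx)
  obtain ⟨t, w, ht, hw⟩ := det_interp (Module.finrank ℝ E) δ hδ0
  have hdet0 : ∀ x, (fderiv ℝ r x).det = 0 := by
    intro x
    by_contra hne
    have h1 : IsUnit (LinearMap.det (fderiv ℝ r x : E →ₗ[ℝ] E)) := isUnit_iff_ne_zero.2 hne
    have h2 : Function.Surjective (fderiv ℝ r x) := by
      have := LinearMap.isUnit_iff_isUnit_det _ |>.2 h1
      exact ((Module.End.isUnit_iff _).1 this).2
    have h3 : HasFDerivAt (fun y => ‖r y‖ ^ 2) (0 : E →L[ℝ] ℝ) x := by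
      have : (fun y => ‖r y‖ ^ 2) = fun _ => (1:ℝ) := by funext y; simp [hn]
      rw [this]; exact hasFDerivAt_const _ _
    have h4 := ((hr.differentiable one_ne_zero x).hasFDerivAt).norm_sq
    obtain ⟨v, hv⟩ := h2 (r x)
    have h5 := congrArg (fun (l : E →L[ℝ] ℝ) => l v) (h3.unique h4)
    simp [hv, hn] at h5
  have key : ∀ x, (0:ℝ) = ∑ i, w i * (1 + t i • (fderiv ℝ r x - 1) : E →L[ℝ] E).det := by
    intro x
    obtain ⟨p, hp1, hp2⟩ := det_poly (fderiv ℝ r x - 1)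
    have := hw p hp1
    rw [hp2] at this
    simp only [one_smul, add_sub_cancel, hdet0, hp2] at this
    exact this
  have hsum : ∑ i, w i = 1 := by
    have := hw 1 (by simp)
    simpa using this.symm
  have hcont : ∀ s : ℝ, Continuous fun x => (1 + s • (fderiv ℝ r x - 1) : E →L[ℝ] E).det := by
    intro s
    exact ContinuousLinearMap.continuous_det.comp (by fun_prop)
  have h1 : ∫ x in B, (∑ i, w i * (1 + t i • (fderiv ℝ r x - 1) : E →L[ℝ] E).det) ∂μ
      = μ.real B := by
    rw [MeasureTheory.integral_finsetSum]
    · simp_rw [MeasureTheory.integral_const_mul]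
      rw [Finset.sum_congr rfl (fun i _ => by rw [hvol (t i) (ht i).1 (ht i).2])]
      rw [← Finset.sum_mul, hsum, one_mul]
    · intro i _
      exact ((continuous_const.mul (hcont (t i))).continuousOn.integrableOn_compact hBc)
  simp_rw [← key] at h1
  simp only [MeasureTheory.integral_zero] at h1
  have h2 : 0 < μ.real B := by
    rw [MeasureTheory.measureReal_def, ENNReal.toReal_pos_iff]
    exact ⟨Metric.measure_closedBall_pos μ 0 one_pos, hBc.measure_lt_top⟩
  linarith

lemma exists_zero_of_near_id (G : E → E) (hG : Continuous G) (M : ℝ) (hM : ∀ x, ‖G x - x‖ ≤ M) :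
    ∃ x, G x = 0 := by
  by_contra! hne
  have hM0 : 0 ≤ M := (norm_nonneg _).trans (hM 0)
  obtain ⟨g, hg, hgd, -⟩ := hG.exists_contDiff_approx (n := 1) (ε := fun x => min (‖G x‖ / 2) 1)
    (by fun_prop) (fun x => lt_min (by have := norm_pos_iff.2 (hne x); positivity) one_pos)
  have hg0 : ∀ x, g x ≠ 0 := by
    intro x h0
    have h1 := (hgd x).trans_le (min_le_left _ _)
    rw [h0, dist_zero_left] at h1
    have := norm_pos_iff.2 (hne x)
    linarith
  have hgM : ∀ x, ‖g x - x‖ ≤ M + 1 := by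
    intro x
    have h1 := (hgd x).trans_le (min_le_right _ _)
    rw [dist_eq_norm] at h1
    calc ‖g x - x‖ = ‖(G x - x) + (g x - G x)‖ := by congr 1; abel
      _ ≤ _ := (norm_add_le _ _).trans (add_le_add (hM x) h1.le)
  let χ : ContDiffBump (0 : E) := ⟨M + 2, M + 3, by linarith, by linarith⟩
  let F : E → E := fun x => x + χ x • (g x - x)
  have hFs : ContDiff ℝ 1 F := contDiff_id.add (χ.contDiff.smul (hg.sub contDiff_id))
  have hF0 : ∀ x, F x ≠ 0 := by
    intro x h0
    by_cases hx : ‖x‖ ≤ M + 2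
    · have h1 : χ x = 1 := χ.one_of_mem_closedBall (by simpa using hx)
      simp only [F, h1, one_smul, add_sub_cancel] at h0
      exact hg0 x h0
    · have h1 : x = - (χ x • (g x - x)) := eq_neg_of_add_eq_zero_left h0
      have h2 : ‖x‖ ≤ M + 1 := by
        conv_lhs => rw [h1]
        rw [norm_neg, norm_smul, Real.norm_of_nonneg χ.nonneg]
        exact (mul_le_of_le_one_left (norm_nonneg _) χ.le_one).trans (hgM x)
      linarith
  have hFo : ∀ x, M + 3 ≤ ‖x‖ → F x = x := by
    intro x hx
    have : χ x = 0 := χ.zero_of_le_dist (by simpa using hx)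
    simp [F, this]
  have hR : 0 < M + 3 := by linarith
  have hFs2 : ContDiff ℝ 1 (fun x : E => F ((M + 3) • x)) := hFs.comp (contDiff_id.const_smul _)
  refine no_smooth_retract (fun x => ‖F ((M + 3) • x)‖⁻¹ • F ((M + 3) • x)) ?_ ?_ ?_
  · exact ((hFs2.norm ℝ (fun x => hF0 _)).inv (fun x => norm_ne_zero_iff.2 (hF0 _))).smul hFs2
  · intro x
    rw [norm_smul, norm_inv, norm_norm, inv_mul_cancel₀ (norm_ne_zero_iff.2 (hF0 _))]
  · intro x hx
    have h1 : ‖(M + 3) • x‖ = M + 3 := by rw [norm_smul, hx, Real.norm_of_nonneg hR.le, mul_one]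
    rw [hFo _ h1.ge, h1, smul_smul, inv_mul_cancel₀ hR.ne', one_smul]

lemma not_finrank_lt_of_homeo {F : Type*} [NormedAddCommGroup F] [NormedSpace ℝ F]
    [FiniteDimensional ℝ F] (f : E ≃ₜ F) : ¬ Module.finrank ℝ F < Module.finrank ℝ E := by
  intro hlt
  obtain ⟨P, hP, hPd, -⟩ := f.symm.continuous.exists_contDiff_approx (n := 1) (ε := fun _ => 1)
    continuous_const (fun _ => one_pos)
  obtain ⟨c, hc⟩ := (hP.dense_compl_range_of_finrank_lt_finrank hlt).nonempty
  obtain ⟨x, hx⟩ := exists_zero_of_near_id (fun x => P (f x) - c)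
    ((hP.continuous.comp f.continuous).sub continuous_const) (1 + ‖c‖) (fun x => by
      have h1 := hPd (f x)
      rw [f.symm_apply_apply, dist_eq_norm] at h1
      calc ‖P (f x) - c - x‖ = ‖(P (f x) - x) - c‖ := by congr 1; abel
        _ ≤ _ := (norm_sub_le _ _).trans (add_le_add h1.le le_rfl))
  exact hc ⟨f x, sub_eq_zero.1 hx⟩

theorem finrank_eq_of_homeo {E F : Type*} [NormedAddCommGroup E] [NormedSpace ℝ E]
    [FiniteDimensional ℝ E] [NormedAddCommGroup F] [NormedSpace ℝ F]
    [FiniteDimensional ℝ F] (f : E ≃ₜ F) : Module.finrank ℝ E = Module.finrank ℝ F := by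
  let e := (toEuclidean (E := E)).toHomeomorph
  let e' := (toEuclidean (E := F)).toHomeomorph
  apply le_antisymm
  · have := not_finrank_lt_of_homeo (e.symm.trans f)
    simpa using this
  · have := not_finrank_lt_of_homeo (e'.symm.trans f.symm)
    simpa using this

end Brouwer

end M1_part

section M2_part

section Flow
variable {E : Type*} [NormedAddCommGroup E] [NormedSpace ℝ E] [CompleteSpace E]

/-- flow of a bounded operator -/
def fl (A : E →L[ℝ] E) (t : ℝ) : E →L[ℝ] E := NormedSpace.exp (t • A)

lemma fl_zero (A : E →L[ℝ] E) : fl A 0 = 1 := by simp [fl]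

lemma fl_zero_apply (A : E →L[ℝ] E) (x : E) : fl A 0 x = x := by simp [fl_zero]

lemma fl_add (A : E →L[ℝ] E) (s t : ℝ) : fl A (s + t) = fl A s * fl A t := by
  let _ : NormedAlgebra ℚ (E →L[ℝ] E) := NormedAlgebra.restrictScalars ℚ ℝ _
  rw [fl, add_smul]
  exact NormedSpace.exp_add_of_commute (((Commute.refl A).smul_left s).smul_right t)

lemma fl_add_apply (A : E →L[ℝ] E) (s t : ℝ) (x : E) : fl A (s + t) x = fl A s (fl A t x) := by
  rw [fl_add]; rfl

lemma fl_neg_apply (A : E →L[ℝ] E) (t : ℝ) (x : E) : fl A (-t) (fl A t x) = x := by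
  rw [← fl_add_apply, neg_add_cancel, fl_zero_apply]

lemma fl_apply_neg (A : E →L[ℝ] E) (t : ℝ) (x : E) : fl A t (fl A (-t) x) = x := by
  rw [← fl_add_apply, add_neg_cancel, fl_zero_apply]

lemma fl_analytic (A : E →L[ℝ] E) : AnalyticOnNhd ℝ (fl A) Set.univ := by
  intro t _
  have h1 : AnalyticAt ℝ (fun t : ℝ => t • A) t := by fun_prop
  exact AnalyticAt.comp (g := NormedSpace.exp) (f := fun t : ℝ => t • A) (NormedSpace.exp_analytic (𝕂 := ℝ) (t • A)) h1

lemma fl_hasDerivAt (A : E →L[ℝ] E) (x : E) (t : ℝ) :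
    HasDerivAt (fun t => fl A t x) (A (fl A t x)) t := by
  have h := hasDerivAt_exp_smul_const' A t
  have h2 := h.clm_apply (hasDerivAt_const t x)
  simpa [fl] using h2

lemma fl_comm (A : E →L[ℝ] E) (x : E) (t : ℝ) : A (fl A t x) = fl A t (A x) := by
  have h := hasDerivAt_exp_smul_const A t
  have h2 := h.clm_apply (hasDerivAt_const t x)
  have h3 : HasDerivAt (fun t => fl A t x) (fl A t (A x)) t := by simpa [fl] using h2
  exact (fl_hasDerivAt A x t).unique h3

lemma fl_contDiff (A : E →L[ℝ] E) : ContDiff ℝ 1 (fun p : E × ℝ => fl A p.2 p.1) := by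
  have h1 : ContDiff ℝ 1 (fl A) := by
    have := (fl_analytic A).contDiffOn (n := 1) uniqueDiffOn_univ
    exact contDiffOn_univ.1 this
  exact (h1.comp contDiff_snd).clm_apply contDiff_fst

lemma fl_cont (A : E →L[ℝ] E) : Continuous (fun p : ℝ × E => fl A p.1 p.2) :=
  (fl_contDiff A).continuous.comp (continuous_snd.prodMk continuous_fst)

lemma fl_cont_comp {Y : Type*} [TopologicalSpace Y] (A : E →L[ℝ] E) {f : Y → ℝ} {g : Y → E}
    (hf : Continuous f) (hg : Continuous g) : Continuous fun y => fl A (f y) (g y) :=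
  (fl_cont A).comp (hf.prodMk hg)

lemma fl_cont_t (A : E →L[ℝ] E) (x : E) : Continuous (fun t => fl A t x) :=
  fl_cont_comp A continuous_id continuous_const

lemma fl_fixed (A : E →L[ℝ] E) (x : E) (h : A x = 0) (t : ℝ) : fl A t x = x := by
  have hd : ∀ t, HasDerivAt (fun t => fl A t x) 0 t := by
    intro t
    have := fl_hasDerivAt A x t
    rwa [fl_comm, h, map_zero] at this
  have := is_const_of_deriv_eq_zero (fun t => (hd t).differentiableAt) (fun t => (hd t).deriv) t 0
  simpa [fl_zero_apply] using this

lemma fl_fixed_iff (A : E →L[ℝ] E) (x : E) : A x = 0 ↔ ∀ t, fl A t x = x := by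
  refine ⟨fl_fixed A x, fun h => ?_⟩
  have h1 := fl_hasDerivAt A x 0
  have h2 : (fun t => fl A t x) = fun _ => x := funext h
  rw [h2, fl_zero_apply] at h1
  exact h1.unique (hasDerivAt_const _ _)

lemma countable_zeros (f : ℝ → ℝ) (hf : AnalyticOnNhd ℝ f Set.univ) (x : ℝ) (hx : f x ≠ 0) :
    {t | f t = 0}.Countable := by
  have h := hf.preimage_zero_mem_codiscrete hx
  have h2 := isDiscrete_of_codiscreteWithin (U := Set.univ) (s := {t | f t = 0}) (by
    exact h)
  have h3 : IsDiscrete {t | f t = 0} := by simpa using h2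
  have : DiscreteTopology {t | f t = 0} := h3.to_subtype
  have : Countable {t | f t = 0} := countable_of_Lindelof_of_discrete
  exact this

lemma countable_level (A : E →L[ℝ] E) (ℓ : E →L[ℝ] ℝ) (x : E) (θ₀ : ℝ)
    (h : ℓ (A (fl A θ₀ x)) ≠ 0) (c : ℝ) : {θ | ℓ (fl A θ x) = c}.Countable := by
  have ha : AnalyticOnNhd ℝ (fun θ => ℓ (fl A θ x) - c) Set.univ := by
    intro t _
    have h1 := fl_analytic A t trivial
    have h2 : AnalyticAt ℝ (fun θ => fl A θ x) t :=
      (ContinuousLinearMap.apply ℝ E x).analyticAt _ |>.comp' h1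
    exact ((ℓ.analyticAt _).comp' h2).sub analyticAt_const
  have hex : ∃ x', ℓ (fl A x' x) - c ≠ 0 := by
    by_contra! hz
    have h1 : HasDerivAt (fun θ => ℓ (fl A θ x) - c) (ℓ (A (fl A θ₀ x))) θ₀ :=
      (ℓ.hasFDerivAt.comp_hasDerivAt θ₀ (fl_hasDerivAt A x θ₀)).sub_const c
    rw [show (fun θ => ℓ (fl A θ x) - c) = fun _ => 0 from funext hz] at h1
    exact h (h1.unique (hasDerivAt_const _ _))
  obtain ⟨x', hx'⟩ := hex
  have := countable_zeros _ ha x' hx'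
  simpa [sub_eq_zero] using this

lemma exists_functional {v : E} (hv : v ≠ 0) : ∃ ℓ : E →L[ℝ] ℝ, ℓ v = 1 :=
  SeparatingDual.exists_eq_one hv

lemma periods_countable (A : E →L[ℝ] E) (x : E) (hx : A x ≠ 0) (y : E) :
    {t | fl A t x = y}.Countable := by
  obtain ⟨ℓ, hℓ⟩ := exists_functional hx
  refine (countable_level A ℓ x 0 (by simp [fl_zero_apply, hℓ]) (ℓ y)).mono ?_
  intro t ht
  simp only [Set.mem_setOf_eq] at ht ⊢
  rw [ht]

lemma const_of_countable {X : Type*} [MetricSpace X] {I : Set ℝ} (hI : IsPreconnected I)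
    {f : ℝ → X} (hf : ContinuousOn f I) {S : Set X} (hS : S.Countable)
    (hfS : ∀ t ∈ I, f t ∈ S) {a b : ℝ} (ha : a ∈ I) (hb : b ∈ I) : f a = f b := by
  have h1 := hS.isTotallyDisconnected
  exact h1 (f '' I) (by rintro _ ⟨t, ht, rfl⟩; exact hfS t ht) (hI.image f hf) ⟨a, ha, rfl⟩ ⟨b, hb, rfl⟩

lemma flow_box (B : E →L[ℝ] E) (p : E) (hp : B p ≠ 0) : ∃ (W : Set E) (s : E → ℝ), IsOpen W ∧
    p ∈ W ∧ ContinuousOn s W ∧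
    (∀ (I : Set ℝ) (γ : ℝ → E) (q : E), IsPreconnected I → ContinuousOn γ I → (∀ t ∈ I, γ t ∈ W) →
      (∀ t ∈ I, ∃ θ, γ t = fl B θ q) → ∀ a ∈ I, ∀ b ∈ I, γ b = fl B (s (γ a) - s (γ b)) (γ a)) := by
  obtain ⟨ℓ, hℓ⟩ := exists_functional hp
  let f : E × ℝ → ℝ := fun u => ℓ (fl B u.2 u.1)
  have hf : ContDiff ℝ 1 f := ℓ.contDiff.comp (fl_contDiff B)
  have hs := hf.contDiffAt.hasStrictFDerivAt (x := (p, 0)) one_ne_zero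
  have hinv : ((fderiv ℝ f (p, 0)) ∘L .inr ℝ E ℝ).IsInvertible := by
    have h1 : (fderiv ℝ f (p, 0)) ∘L .inr ℝ E ℝ = ContinuousLinearMap.id ℝ ℝ := by
      ext
      have h2 : HasDerivAt (fun t : ℝ => f (p, t)) (fderiv ℝ f (p, 0) (0, 1)) 0 := by
        have h3 : HasDerivAt (fun t : ℝ => ((p, t) : E × ℝ)) (0, 1) 0 :=
          (hasDerivAt_const _ _).prodMk (hasDerivAt_id _)
        exact hs.hasFDerivAt.comp_hasDerivAt (0:ℝ) h3
      have h4 : HasDerivAt (fun t : ℝ => f (p, t)) 1 0 := by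
        have := ℓ.hasFDerivAt.comp_hasDerivAt 0 (fl_hasDerivAt B p 0)
        rw [fl_zero_apply, hℓ] at this
        exact this
      simpa using h2.unique h4
    rw [h1]
    exact ⟨ContinuousLinearEquiv.refl ℝ ℝ, rfl⟩
  set s := hs.implicitFunctionOfProdDomain hinv with hsdef
  have e1 := hs.eventually_apply_implicitFunctionOfProdDomain hinv
  obtain ⟨K, W1, hW1, hlip⟩ :=
    (hs.hasStrictFDerivAt_implicitFunctionOfProdDomain hinv).exists_lipschitzOnWith
  have e2 : ∀ᶠ z in 𝓝 p, ℓ (B z) ≠ 0 := by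
    have : ContinuousAt (fun z => ℓ (B z)) p := (ℓ.continuous.comp B.continuous).continuousAt
    exact this.eventually_ne (by rw [hℓ]; exact one_ne_zero)
  obtain ⟨W, hW, hWo, hpW⟩ := mem_nhds_iff.1 (inter_mem (inter_mem hW1 e1) e2)
  have hsW : ContinuousOn s W := hlip.continuousOn.mono (fun z hz => (hW hz).1.1)
  refine ⟨W, s, hWo, hpW, hsW, ?_⟩
  intro I γ q hI hγ hγW hq a ha b hb
  obtain ⟨θ₀, hθ₀⟩ := hq a ha
  have hcount := countable_level B ℓ q θ₀ (by rw [← hθ₀]; exact (hW (hγW a ha)).2) (f (p, 0))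
  have hcs : ContinuousOn (fun t => s (γ t)) I := hsW.comp hγ hγW
  have h1 := const_of_countable hI (f := fun t => fl B (s (γ t)) (γ t))
    (S := (fun θ => fl B θ q) '' {θ | ℓ (fl B θ q) = f (p, 0)})
    ((fl_cont B).comp_continuousOn (hcs.prodMk hγ)) (hcount.image _) ?_ ha hb
  · rw [sub_eq_add_neg, add_comm, fl_add_apply, h1, fl_neg_apply]
  · intro t ht
    obtain ⟨θ, hθ⟩ := hq t ht
    refine ⟨s (γ t) + θ, ?_, ?_⟩
    · have := (hW (hγW t ht)).1.2
      simp only [Set.mem_setOf_eq] at this ⊢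
      rw [fl_add_apply, ← hθ]
      exact this
    · simp only [fl_add_apply, ← hθ]

end Flow

end M2_part

section M2b_part

section Lift
variable {E : Type*} [NormedAddCommGroup E] [NormedSpace ℝ E] [CompleteSpace E]

lemma fl_ne_zero (B : E →L[ℝ] E) {p : E} (hp : B p ≠ 0) (t : ℝ) : B (fl B t p) ≠ 0 := by
  intro h
  rw [fl_comm] at h
  apply hp
  have := congrArg (fl B (-t)) h
  rwa [fl_neg_apply, map_zero] at this

lemma lift_unique (B : E →L[ℝ] E) {p : E} (hp : B p ≠ 0) {I : Set ℝ} (hI : IsPreconnected I)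
    {f g : ℝ → ℝ} (hf : ContinuousOn f I) (hg : ContinuousOn g I)
    (hfg : ∀ t ∈ I, fl B (f t) p = fl B (g t) p) {a b : ℝ} (ha : a ∈ I) (hb : b ∈ I) :
    f a - g a = f b - g b := by
  refine const_of_countable hI (f := fun t => f t - g t) (hf.sub hg)
    (periods_countable B p hp p) ?_ ha hb
  intro t ht
  change fl B (f t - g t) p = p
  rw [sub_eq_neg_add, fl_add_apply, hfg t ht, fl_neg_apply]

lemma lift_Icc (B : E →L[ℝ] E) (γ : ℝ → E) (hγ : Continuous γ) (p : E) (hp : B p ≠ 0)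
    (horb : ∀ t, ∃ θ, γ t = fl B θ p) (a b : ℝ) (hab : a ≤ b) :
    ∃ τ : ℝ → ℝ, Continuous τ ∧ ∀ t ∈ Set.Icc a b, γ t = fl B (τ t) (γ a) := by
  have hne : ∀ t, B (γ t) ≠ 0 := by
    intro t
    obtain ⟨θ, hθ⟩ := horb t
    rw [hθ]; exact fl_ne_zero B hp θ
  choose W s hWo hpW hsW hbox using fun t => flow_box B (γ t) (hne t)
  obtain ⟨t, ht0, htm, ⟨m, hm⟩, hsub⟩ := exists_monotone_Icc_subset_open_cover_Icc hab
    (c := fun i : ℝ => {t : Set.Icc a b | γ t ∈ W i})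
    (fun i => (hWo i).preimage (hγ.comp continuous_subtype_val))
    (fun t _ => Set.mem_iUnion.2 ⟨t, hpW t⟩)
  have key : ∀ n, ∃ τ : ℝ → ℝ, Continuous τ ∧ ∀ u ∈ Set.Icc a (t n : ℝ), γ u = fl B (τ u) (γ a) := by
    intro n
    induction n with
    | zero =>
      refine ⟨fun _ => 0, continuous_const, ?_⟩
      intro u hu
      rw [ht0, Set.Icc_self] at hu
      rw [Set.mem_singleton_iff.1 hu, fl_zero_apply]
    | succ n ih =>
      obtain ⟨τ, hτ, hτ2⟩ := ih
      obtain ⟨i, hi⟩ := hsub n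
      have hle : (t n : ℝ) ≤ t (n+1) := htm (Nat.le_succ n)
      have hW : ∀ u ∈ Set.Icc (t n : ℝ) (t (n+1)), γ u ∈ W i := by
        intro u hu
        have hu' : u ∈ Set.Icc a b := ⟨(t n).2.1.trans hu.1, hu.2.trans (t (n+1)).2.2⟩
        exact hi (show (⟨u, hu'⟩ : Set.Icc a b) ∈ Set.Icc (t n) (t (n+1)) from ⟨hu.1, hu.2⟩)
      let cl : ℝ → ℝ := fun u => max (t n : ℝ) (min (t (n+1) : ℝ) u)
      have hcl : Continuous cl := by fun_prop
      have hclm : ∀ u, cl u ∈ Set.Icc (t n : ℝ) (t (n+1)) := fun u =>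
        ⟨le_max_left _ _, max_le hle (min_le_left _ _)⟩
      have hcc : Continuous fun u => s i (γ (cl u)) :=
        (hsW i).comp_continuous (hγ.comp hcl) (fun u => hW _ (hclm u))
      refine ⟨fun u => if u ≤ t n then τ u else τ (t n) + (s i (γ (t n)) - s i (γ (cl u))), ?_, ?_⟩
      · refine Continuous.if_le hτ (continuous_const.add (continuous_const.sub hcc)) continuous_id
          continuous_const ?_
        intro u hu
        simp [hu, cl, hle]
      · intro u hu
        by_cases h : u ≤ t n
        · simp only [h, if_true]; exact hτ2 u ⟨hu.1, h⟩
        · simp only [h, if_false]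
          push Not at h
          have hcu : cl u = u := by simp [cl, h.le, hu.2]
          rw [hcu, add_comm, fl_add_apply, ← hτ2 (t n) ⟨(t n).2.1, le_rfl⟩]
          exact hbox i (Set.Icc (t n : ℝ) (t (n+1))) γ p isPreconnected_Icc hγ.continuousOn hW
            (fun t _ => horb t) _ ⟨le_rfl, hle⟩ _ ⟨h.le, hu.2⟩
  obtain ⟨τ, h1, h2⟩ := key m
  rw [hm m le_rfl] at h2
  exact ⟨τ, h1, h2⟩

lemma exists_lift (B : E →L[ℝ] E) (γ : ℝ → E) (hγ : Continuous γ) (hp : B (γ 0) ≠ 0)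
    (horb : ∀ t, ∃ θ, γ t = fl B θ (γ 0)) :
    ∃ τ : ℝ → ℝ, Continuous τ ∧ τ 0 = 0 ∧ ∀ t, γ t = fl B (τ t) (γ 0) := by
  have h1 : ∀ n : ℕ, ∃ τ : ℝ → ℝ, Continuous τ ∧ τ 0 = 0 ∧
      ∀ t ∈ Set.Icc (-n : ℝ) n, γ t = fl B (τ t) (γ 0) := by
    intro n
    obtain ⟨τ, h1, h2⟩ := lift_Icc B γ hγ _ hp horb (-n : ℝ) n (by simp)
    refine ⟨fun t => τ t - τ 0, by fun_prop, by simp, ?_⟩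
    intro t ht
    rw [h2 0 (by simp), ← fl_add_apply, sub_add_cancel]
    exact h2 t ht
  choose τ hc h0 hl using h1
  have huniq : ∀ n m : ℕ, n ≤ m → ∀ t ∈ Set.Icc (-n : ℝ) n, τ n t = τ m t := by
    intro n m hnm t ht
    have hnm' : (n : ℝ) ≤ m := by exact_mod_cast hnm
    have := lift_unique B hp (I := Set.Icc (-n : ℝ) n) isPreconnected_Icc (hc n).continuousOn
      (hc m).continuousOn (fun u hu => by
        rw [← hl n u hu, ← hl m u ⟨by linarith [hu.1], hu.2.trans hnm'⟩]) ht
        (show (0:ℝ) ∈ _ by simp)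
    rw [h0, h0, sub_zero, sub_eq_zero] at this
    exact this
  have hmem : ∀ t : ℝ, t ∈ Set.Icc (-(⌈|t|⌉₊ : ℝ)) (⌈|t|⌉₊ : ℝ) := fun t =>
    abs_le.1 (Nat.le_ceil |t|)
  refine ⟨fun t => τ ⌈|t|⌉₊ t, ?_, ?_, fun t => hl _ t (hmem t)⟩
  · rw [continuous_iff_continuousAt]
    intro t
    refine (hc (⌈|t|⌉₊ + 1)).continuousAt.congr ?_
    filter_upwards [Metric.ball_mem_nhds t one_pos] with u hu
    symm
    refine huniq _ _ ?_ u (hmem u)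
    rw [Nat.ceil_le]
    have h2 : |u - t| < 1 := hu
    have h3 := abs_sub_abs_le_abs_sub u t
    have h4 := Nat.le_ceil |t|
    push_cast
    linarith
  · exact h0 _

/-- orbit equivalence -/
def OrbEq (A B : E →L[ℝ] E) (h : E ≃ₜ E) : Prop :=
  ∀ x y, (∃ t, y = fl A t x) ↔ ∃ s, h y = fl B s (h x)

lemma OrbEq.symm {A B : E →L[ℝ] E} {h : E ≃ₜ E} (H : OrbEq A B h) : OrbEq B A h.symm := by
  intro x y
  have := H (h.symm x) (h.symm y)
  simpa using this.symm

lemma OrbEq.fixed {A B : E →L[ℝ] E} {h : E ≃ₜ E} (H : OrbEq A B h) {x : E} (hx : A x = 0) :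
    B (h x) = 0 := by
  rw [fl_fixed_iff]
  intro t
  obtain ⟨s, hs⟩ := (H x (h.symm (fl B t (h x)))).2 ⟨t, by simp⟩
  rw [fl_fixed A x hx, h.symm_apply_eq] at hs
  exact hs

lemma OrbEq.fixed_iff {A B : E →L[ℝ] E} {h : E ≃ₜ E} (H : OrbEq A B h) {x : E} :
    B (h x) = 0 ↔ A x = 0 := by
  refine ⟨fun hx => ?_, H.fixed⟩
  simpa using H.symm.fixed hx

lemma OrbEq.exists_lift {A B : E →L[ℝ] E} {h : E ≃ₜ E} (H : OrbEq A B h) {x : E} (hx : A x ≠ 0) :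
    ∃ τ : ℝ → ℝ, Continuous τ ∧ τ 0 = 0 ∧ ∀ t, h (fl A t x) = fl B (τ t) (h x) := by
  have := LF.exists_lift B (fun t => h (fl A t x)) (h.continuous.comp (fl_cont_t A x))
    (by rw [fl_zero_apply]; exact fun h0 => hx (H.fixed_iff.1 h0))
    (fun t => by rw [fl_zero_apply]; exact (H x _).1 ⟨t, rfl⟩)
  simpa [fl_zero_apply] using this

/-- the lift of the time change -/
def lft (A B : E →L[ℝ] E) (h : E ≃ₜ E) (x : E) : ℝ → ℝ := by
  classical
  exact if H : ∃ τ : ℝ → ℝ, Continuous τ ∧ τ 0 = 0 ∧ ∀ t, h (fl A t x) = fl B (τ t) (h x)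
    then H.choose else fun _ => 0

variable {A B : E →L[ℝ] E} {h : E ≃ₜ E}

lemma OrbEq.lft_spec (H : OrbEq A B h) {x : E} (hx : A x ≠ 0) :
    Continuous (lft A B h x) ∧ lft A B h x 0 = 0 ∧
      ∀ t, h (fl A t x) = fl B (lft A B h x t) (h x) := by
  have := H.exists_lift hx
  rw [lft, dif_pos this]
  exact this.choose_spec

lemma OrbEq.lft_cont (H : OrbEq A B h) {x : E} (hx : A x ≠ 0) : Continuous (lft A B h x) :=
  (H.lft_spec hx).1

lemma OrbEq.lft_zero (H : OrbEq A B h) {x : E} (hx : A x ≠ 0) : lft A B h x 0 = 0 :=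
  (H.lft_spec hx).2.1

lemma OrbEq.lft_eq (H : OrbEq A B h) {x : E} (hx : A x ≠ 0) (t : ℝ) :
    h (fl A t x) = fl B (lft A B h x t) (h x) :=
  (H.lft_spec hx).2.2 t

lemma OrbEq.lft_inv (H : OrbEq A B h) {x : E} (hx : A x ≠ 0) (t : ℝ) :
    lft B A h.symm (h x) (lft A B h x t) = t := by
  have hx' : B (h x) ≠ 0 := fun h0 => hx (H.fixed_iff.1 h0)
  have := lift_unique A hx (I := Set.univ) isPreconnected_univ
    (f := fun t => lft B A h.symm (h x) (lft A B h x t)) (g := id)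
    ((H.symm.lft_cont hx').comp (H.lft_cont hx)).continuousOn continuous_id.continuousOn
    (fun t _ => by
      have h1 := H.symm.lft_eq hx' (lft A B h x t)
      rw [← H.lft_eq hx, h.symm_apply_apply, h.symm_apply_apply] at h1
      exact h1.symm) (Set.mem_univ t) (Set.mem_univ 0)
  simp only [H.lft_zero hx, H.symm.lft_zero hx', id, sub_zero, sub_eq_zero] at this
  exact this

lemma OrbEq.lft_inv_right (H : OrbEq A B h) {x : E} (hx : A x ≠ 0) (s : ℝ) :
    lft A B h x (lft B A h.symm (h x) s) = s := by
  have hx' : B (h x) ≠ 0 := fun h0 => hx (H.fixed_iff.1 h0)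
  have := H.symm.lft_inv hx' s
  simpa using this

lemma OrbEq.lft_inj (H : OrbEq A B h) {x : E} (hx : A x ≠ 0) :
    Function.Injective (lft A B h x) := Function.LeftInverse.injective (H.lft_inv hx)

lemma OrbEq.lft_surj (H : OrbEq A B h) {x : E} (hx : A x ≠ 0) :
    Function.Surjective (lft A B h x) := fun s => ⟨_, H.lft_inv_right hx s⟩

lemma OrbEq.lft_mono (H : OrbEq A B h) {x : E} (hx : A x ≠ 0) :
    StrictMono (lft A B h x) ∨ StrictAnti (lft A B h x) :=
  (H.lft_cont hx).strictMono_of_inj (H.lft_inj hx)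

lemma OrbEq.lft_unique (H : OrbEq A B h) {x : E} (hx : A x ≠ 0) {σ : ℝ → ℝ} (hσ : Continuous σ)
    (h0 : σ 0 = 0) (hs : ∀ t, h (fl A t x) = fl B (σ t) (h x)) : σ = lft A B h x := by
  have hx' : B (h x) ≠ 0 := fun h0 => hx (H.fixed_iff.1 h0)
  funext t
  have := lift_unique B hx' (I := Set.univ) isPreconnected_univ hσ.continuousOn
    (H.lft_cont hx).continuousOn (fun t _ => by rw [← hs, ← H.lft_eq hx]) (Set.mem_univ t)
    (Set.mem_univ 0)
  rw [h0, H.lft_zero hx, sub_zero, sub_eq_zero] at this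
  exact this

lemma OrbEq.lft_add (H : OrbEq A B h) {x : E} (hx : A x ≠ 0) (s t : ℝ) :
    lft A B h x (t + s) = lft A B h x s + lft A B h (fl A s x) t := by
  have hx2 := fl_ne_zero A hx s
  have := H.lft_unique hx2 (σ := fun t => lft A B h x (t + s) - lft A B h x s)
    (((H.lft_cont hx).comp (by fun_prop : Continuous fun t : ℝ => t + s)).sub continuous_const)
    (by simp) (fun t => by
      rw [← fl_add_apply, H.lft_eq hx s, ← fl_add_apply, sub_add_cancel, H.lft_eq hx])
  rw [← this]; ring

lemma OrbEq.lft_stable_sub (H : OrbEq A B h) {x : E} (hx : A x ≠ 0) (a b : ℝ) (hab : a ≤ b) :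
    ContinuousAt (fun x' => lft A B h x' b - lft A B h x' a) x := by
  have hne : ∀ t, B (h (fl A t x)) ≠ 0 := fun t h0 => fl_ne_zero A hx t (H.fixed_iff.1 h0)
  choose W s hWo hpW hsW hbox using fun t => flow_box B (h (fl A t x)) (hne t)
  obtain ⟨t, ht0, htm, ⟨m, hm⟩, hsub⟩ := exists_monotone_Icc_subset_open_cover_Icc hab
    (c := fun i : ℝ => {t : Set.Icc a b | h (fl A t x) ∈ W i})
    (fun i => (hWo i).preimage (h.continuous.comp ((fl_cont_t A x).comp continuous_subtype_val)))
    (fun t _ => Set.mem_iUnion.2 ⟨t, hpW t⟩)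
  have hjc : Continuous fun q : ℝ × E => h (fl A q.1 q.2) := h.continuous.comp (fl_cont A)
  have hxe : ∀ᶠ x' in 𝓝 x, A x' ≠ 0 := A.continuous.continuousAt.eventually_ne hx
  have key : ∀ n, ContinuousAt (fun x' => lft A B h x' (t n) - lft A B h x' a) x := by
    intro n
    induction n with
    | zero => rw [ht0]; simp only [sub_self]; exact continuousAt_const
    | succ n ih =>
      obtain ⟨i, hi⟩ := hsub n
      have hle : (t n : ℝ) ≤ t (n+1) := htm (Nat.le_succ n)
      have hW : ∀ u ∈ Set.Icc (t n : ℝ) (t (n+1)), h (fl A u x) ∈ W i := by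
        intro u hu
        have hu' : u ∈ Set.Icc a b := ⟨(t n).2.1.trans hu.1, hu.2.trans (t (n+1)).2.2⟩
        exact hi (show (⟨u, hu'⟩ : Set.Icc a b) ∈ Set.Icc (t n) (t (n+1)) from ⟨hu.1, hu.2⟩)
      have htube : ∀ᶠ x' in 𝓝 x, ∀ u ∈ Set.Icc (t n : ℝ) (t (n+1)), h (fl A u x') ∈ W i := by
        refine IsCompact.eventually_forall_of_forall_eventually isCompact_Icc ?_
        intro u hu
        have : ContinuousAt (fun q : E × ℝ => h (fl A q.2 q.1)) (x, u) :=
          (hjc.comp continuous_swap).continuousAt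
        exact this.eventually ((hWo i).mem_nhds (hW u hu))
      have hca : ∀ u ∈ Set.Icc (t n : ℝ) (t (n+1)),
          ContinuousAt (fun x' => s i (h (fl A u x'))) x := by
        intro u hu
        have h1 : ContinuousAt (s i) (h (fl A u x)) :=
          (hsW i).continuousAt ((hWo i).mem_nhds (hW u hu))
        have h2 : ContinuousAt (fun x' => h (fl A u x')) x :=
          (h.continuous.comp (fl A u).continuous).continuousAt
        exact ContinuousAt.comp (g := s i) (f := fun x' => h (fl A u x')) h1 h2
      have hl := (Set.left_mem_Icc.2 hle)
      have hr := (Set.right_mem_Icc.2 hle)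
      refine (ih.add ((hca _ hl).sub (hca _ hr))).congr ?_
      filter_upwards [htube, hxe] with x' h1 hx'
      have hx2 : B (h x') ≠ 0 := fun h0 => hx' (H.fixed_iff.1 h0)
      have hγc : Continuous fun u => h (fl A u x') := h.continuous.comp (fl_cont_t A x')
      have h3 := lift_unique B hx2 (I := Set.Icc (t n : ℝ) (t (n+1))) isPreconnected_Icc
        (f := lft A B h x') (g := fun u => (s i (h (fl A (t n) x')) - s i (h (fl A u x')))
          + lft A B h x' (t n)) (H.lft_cont hx').continuousOn
        ((continuousOn_const.sub ((hsW i).comp hγc.continuousOn h1)).add continuousOn_const)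
        (fun u hu => by
          rw [← H.lft_eq hx', fl_add_apply, ← H.lft_eq hx']
          exact hbox i _ (fun u => h (fl A u x')) (h x') isPreconnected_Icc hγc.continuousOn h1
            (fun v _ => ⟨_, H.lft_eq hx' v⟩) _ hl _ hu) hl hr
      simp only [sub_self, zero_add] at h3
      simp only [Pi.add_apply, Pi.sub_apply]
      linarith
  have := key m
  rwa [hm m le_rfl] at this

lemma OrbEq.lft_stable (H : OrbEq A B h) {x : E} (hx : A x ≠ 0) (b : ℝ) :
    ContinuousAt (fun x' => lft A B h x' b) x := by
  have hxe : ∀ᶠ x' in 𝓝 x, A x' ≠ 0 := A.continuous.continuousAt.eventually_ne hx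
  rcases le_total 0 b with hb | hb
  · refine (H.lft_stable_sub hx 0 b hb).congr ?_
    filter_upwards [hxe] with x' hx'
    rw [H.lft_zero hx', sub_zero]
  · refine (H.lft_stable_sub hx b 0 hb).neg.congr ?_
    filter_upwards [hxe] with x' hx'
    simp [H.lft_zero hx']

end Lift

end M2b_part

section M3_part

section Spec
open Polynomial
variable {E : Type*} [AddCommGroup E] [Module ℝ E]

lemma ker_le_of_squarefree (D : Module.End ℝ E) (V : Submodule ℝ E)
    (hV : ∀ q : ℝ[X], Irreducible q → LinearMap.ker (aeval D q) ≤ V) (p : ℝ[X]) :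
    Squarefree p → LinearMap.ker (aeval D p) ≤ V := by
  induction p using UniqueFactorizationMonoid.induction_on_coprime with
  | h0 => intro h; exact absurd h not_squarefree_zero
  | @h1 u hu =>
    intro _
    have h1 : IsUnit (aeval D u) := hu.map (aeval D)
    have h2 : LinearMap.ker (aeval D u) = ⊥ := LinearMap.ker_eq_bot.2 ((Module.End.isUnit_iff _).1 h1).1
    rw [h2]; exact bot_le
  | @hpr p i hp =>
    intro hs
    have hi : i ≤ 1 := by
      by_contra hi
      push Not at hi
      have : p * p ∣ p ^ i := by rw [← sq]; exact pow_dvd_pow p hi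
      exact hp.not_unit (hs p this)
    interval_cases i
    · intro x hx
      have : x = 0 := by simpa using hx
      rw [this]; exact V.zero_mem
    · rw [pow_one]; exact hV p hp.irreducible
  | @hcp x y hxy hx hy =>
    intro hs
    have hc : IsCoprime x y := hxy.isCoprime
    rw [← sup_ker_aeval_eq_ker_aeval_mul_of_coprime D hc]
    exact sup_le (hx (hs.of_mul_left)) (hy (hs.of_mul_right))

lemma ker_irreducible (D : Module.End ℝ E) (V : Submodule ℝ E)
    (h1 : ∀ (a : ℝ) (x : E), D x = a • x → x ∈ V)
    (h2 : ∀ (a w : ℝ) (x : E), 0 < w →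
      D (D x - a • x) - a • (D x - a • x) = - (w ^ 2) • x → x ∈ V)
    (q : ℝ[X]) (hq : Irreducible q) : LinearMap.ker (aeval D q) ≤ V := by
  intro x hx
  rw [LinearMap.mem_ker] at hx
  have hd := hq.natDegree_le_two
  have hd0 := hq.natDegree_pos
  have hlc : q.leadingCoeff ≠ 0 := leadingCoeff_ne_zero.2 hq.ne_zero
  obtain h | h : q.natDegree = 1 ∨ q.natDegree = 2 := by omega
  · have hq2 : q = C (q.coeff 1) * X + C (q.coeff 0) := q.eq_X_add_C_of_natDegree_le_one h.le
    have hne : q.coeff 1 ≠ 0 := by rw [← h]; exact hlc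
    set b := q.coeff 1
    set c := q.coeff 0
    rw [hq2] at hx
    simp only [map_add, map_mul, aeval_C, aeval_X, LinearMap.add_apply,
      Module.End.mul_apply, Module.algebraMap_end_apply] at hx
    refine h1 (-c / b) x ?_
    have : b • D x = (-c) • x := by rw [neg_smul]; exact eq_neg_of_add_eq_zero_left hx
    rw [div_eq_inv_mul, mul_smul, ← this, smul_smul, inv_mul_cancel₀ hne, one_smul]
  · have hne : q.coeff 2 ≠ 0 := by rw [← h]; exact hlc
    have hq2 : q = C (q.coeff 2) * X ^ 2 + C (q.coeff 1) * X + C (q.coeff 0) :=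
      q.eq_quadratic_of_degree_le_two (degree_le_of_natDegree_le h.le)
    set a := q.coeff 2
    set b := q.coeff 1
    set c := q.coeff 0
    have hdisc : discrim a b c < 0 := by
      by_contra hge
      push Not at hge
      have hroot : q.IsRoot ((-b + √(discrim a b c)) / (2 * a)) := by
        have := (quadratic_eq_zero_iff hne (Real.mul_self_sqrt hge).symm
          ((-b + √(discrim a b c)) / (2 * a))).2 (Or.inl rfl)
        rw [IsRoot, hq2]
        simp only [eval_add, eval_mul, eval_C, eval_X, eval_pow]
        rw [← this]; ring
      have := degree_eq_one_of_irreducible_of_root hq hroot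
      rw [degree_eq_natDegree hq.ne_zero, h] at this
      norm_num at this
    have hw : 0 < -discrim a b c / (4 * a ^ 2) := by
      apply div_pos (by linarith); positivity
    refine h2 (-b / (2 * a)) (√(-discrim a b c / (4 * a ^ 2))) x (Real.sqrt_pos.2 hw) ?_
    rw [Real.sq_sqrt hw.le, discrim]
    rw [hq2] at hx
    simp only [map_add, map_mul, aeval_C, aeval_X, LinearMap.add_apply, map_pow, sq,
      Module.End.mul_apply, Module.algebraMap_end_apply] at hx
    have hx2 : D (D x) = (-b / a) • D x + (-c / a) • x := by
      have : a • D (D x) = (-b) • D x + (-c) • x := by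
        rw [neg_smul, neg_smul]
        rw [add_assoc] at hx
        rw [eq_neg_of_add_eq_zero_left hx]; abel
      have h3 := congrArg (fun v => a⁻¹ • v) this
      simp only [smul_smul, smul_add, inv_mul_cancel₀ hne, one_smul] at h3
      rw [h3]
      congr 2 <;> field_simp
    rw [map_sub, map_smul, hx2]
    match_scalars <;> (field_simp; ring)

lemma semisimple_top [FiniteDimensional ℝ E] (D : Module.End ℝ E) (hD : D.IsSemisimple)
    (V : Submodule ℝ E)
    (h1 : ∀ (a : ℝ) (x : E), D x = a • x → x ∈ V)
    (h2 : ∀ (a w : ℝ) (x : E), 0 < w →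
      D (D x - a • x) - a • (D x - a • x) = - (w ^ 2) • x → x ∈ V) : V = ⊤ := by
  have := ker_le_of_squarefree D V (ker_irreducible D V h1 h2) (minpoly ℝ D) hD.minpoly_squarefree
  rw [minpoly.aeval] at this
  simpa using this

end Spec

end M3_part

section M3b_part

section Flow2
variable {E : Type*} [NormedAddCommGroup E] [NormedSpace ℝ E] [CompleteSpace E]

lemma fl_neg (A : E →L[ℝ] E) (t : ℝ) : fl (-A) t = fl A (-t) := by
  rw [fl, fl]; simp

lemma fl_smul (A : E →L[ℝ] E) (a t : ℝ) : fl (a • A) t = fl A (a * t) := by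
  rw [fl, fl, smul_smul, mul_comm]

lemma fl_unique (A : E →L[ℝ] E) (f : ℝ → E) (hf : ∀ t, HasDerivAt f (A (f t)) t) (t : ℝ) :
    f t = fl A t (f 0) := by
  have h : ∀ t, HasDerivAt (fun t => fl (-A) t (f t)) 0 t := by
    intro t
    have h := hasDerivAt_exp_smul_const (-A) t
    have h2 := h.clm_apply (hf t)
    have h3 : (NormedSpace.exp (t • (-A)) * (-A)) (f t) + NormedSpace.exp (t • (-A)) (A (f t)) = 0 := by
      simp
    rw [h3] at h2
    exact h2
  have h4 := is_const_of_deriv_eq_zero (fun t => (h t).differentiableAt) (fun t => (h t).deriv) t 0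
  simp only [fl_neg] at h4
  rw [neg_zero, fl_zero_apply] at h4
  rw [← h4, fl_apply_neg]

lemma fl_comm_of (A L : E →L[ℝ] E) (h : ∀ x, L (A x) = A (L x)) (t : ℝ) (x : E) :
    L (fl A t x) = fl A t (L x) := by
  have := fl_unique A (fun t => L (fl A t x)) (fun t => by
    have h1 := L.hasFDerivAt.comp_hasDerivAt t (fl_hasDerivAt A x t)
    rw [← h]
    exact h1) t
  simpa [fl_zero_apply] using this

lemma fl_comm_fl (A L : E →L[ℝ] E) (h : ∀ x, L (A x) = A (L x)) (t s : ℝ) (x : E) :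
    fl L s (fl A t x) = fl A t (fl L s x) :=
  fl_comm_of A (fl L s) (fun x => (fl_comm_of L A (fun y => (h y).symm) s x).symm) t x

lemma fl_add_op (D N : E →L[ℝ] E) (h : ∀ x, N (D x) = D (N x)) (t : ℝ) (x : E) :
    fl (D + N) t x = fl D t (fl N t x) := by
  symm
  have := fl_unique (D + N) (fun t => fl D t (fl N t x)) (fun t => by
    have h1 := hasDerivAt_exp_smul_const' D t
    have h2 := h1.clm_apply (fl_hasDerivAt N x t)
    have h3 : (D * NormedSpace.exp (t • D)) (fl N t x) + NormedSpace.exp (t • D) (N (fl N t x))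
      = (D + N) (fl D t (fl N t x)) := by
      change D (fl D t (fl N t x)) + fl D t (N (fl N t x)) = _
      rw [ContinuousLinearMap.add_apply, fl_comm_of D N h]
    rw [h3] at h2
    exact h2) t
  simpa [fl_zero_apply] using this

lemma fl_nilp (N : E →L[ℝ] E) (m : ℕ) (h : N ^ m = 0) (t : ℝ) (x : E) :
    fl N t x = ∑ k ∈ Finset.range m, ((k.factorial : ℝ)⁻¹ * t ^ k) • (N ^ k) x := by
  rw [fl, NormedSpace.exp_eq_tsum ℝ]
  beta_reduce
  rw [tsum_eq_sum (s := Finset.range m)]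
  · rw [ContinuousLinearMap.sum_apply]
    refine Finset.sum_congr rfl fun k _ => ?_
    rw [smul_pow, smul_smul]; rfl
  · intro k hk
    have : m ≤ k := by simpa using hk
    rw [smul_pow, pow_eq_zero_of_le this h]; simp

lemma fl_mem [FiniteDimensional ℝ E] (A : E →L[ℝ] E) (V : Submodule ℝ E) (hV : ∀ x ∈ V, A x ∈ V) (t : ℝ) (x : E)
    (hx : x ∈ V) : fl A t x ∈ V := by
  have hcl : IsClosed (V : Set E) := V.closed_of_finiteDimensional
  have hp : ∀ n : ℕ, (A ^ n) x ∈ V := by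
    intro n
    induction n with
    | zero => simpa using hx
    | succ n ih => rw [pow_succ']; exact hV _ ih
  have hs := NormedSpace.expSeries_hasSum_exp (𝕂 := ℝ) (t • A)
  have hs2 := hs.mapL (ContinuousLinearMap.apply ℝ E x)
  refine hcl.mem_of_tendsto hs2 (Eventually.of_forall fun s => ?_)
  refine V.sum_mem fun k _ => ?_
  simp only [NormedSpace.expSeries_apply_eq, ContinuousLinearMap.apply_apply, ContinuousLinearMap.smul_apply, smul_pow]
  exact V.smul_mem _ (V.smul_mem _ (hp k))

lemma fl_eig (D : E →L[ℝ] E) (a : ℝ) (x : E) (h : D x = a • x) (t : ℝ) :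
    fl D t x = Real.exp (a * t) • x := by
  have := fl_unique D (fun t => Real.exp (a * t) • x) (fun t => by
    have h1 : HasDerivAt (fun t => Real.exp (a * t)) (Real.exp (a * t) * a) t := by
      simpa using ((hasDerivAt_id t).const_mul a).exp
    have h2 := h1.smul_const x
    rw [map_smul, h, smul_smul]
    exact h2) t
  simpa using this.symm

lemma fl_eig2 (D : E →L[ℝ] E) (a w : ℝ) (hw : w ≠ 0) (x : E)
    (h : D (D x - a • x) - a • (D x - a • x) = - (w ^ 2) • x) (t : ℝ) :
    fl D t x = Real.exp (a * t) • (Real.cos (w * t) • x + (Real.sin (w * t) / w) • (D x - a • x)) := by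
  set y := D x - a • x with hy
  have hDx : D x = a • x + y := by rw [hy]; abel
  have hDy : D y = a • y - (w ^ 2) • x := by
    rw [neg_smul] at h
    rw [sub_eq_add_neg, ← h]; abel
  have := fl_unique D (fun t => Real.exp (a * t) • (Real.cos (w * t) • x + (Real.sin (w * t) / w) • y)) (fun t => by
    have h1 : HasDerivAt (fun t => Real.exp (a * t)) (Real.exp (a * t) * a) t := by
      simpa using ((hasDerivAt_id t).const_mul a).exp
    have h2 : HasDerivAt (fun t => Real.cos (w * t)) (-Real.sin (w * t) * w) t := by
      simpa using ((hasDerivAt_id t).const_mul w).cos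
    have h3 : HasDerivAt (fun t => Real.sin (w * t) / w) (Real.cos (w * t) * w / w) t := by
      simpa using (((hasDerivAt_id t).const_mul w).sin).div_const w
    have h4 := h1.smul ((h2.smul_const x).add (h3.smul_const y))
    convert h4 using 1
    · rfl
    rw [map_smul, map_add, map_smul, map_smul, hDx, hDy]
    simp only [Pi.add_apply]
    match_scalars <;> (field_simp; try ring)) t
  simpa using this.symm

end Flow2

end M3b_part

section M3c_part

section SUC
variable {E : Type*} [NormedAddCommGroup E] [NormedSpace ℝ E] [FiniteDimensional ℝ E] [CompleteSpace E]

structure JC (A D N : E →L[ℝ] E) : Prop where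
  sum : A = D + N
  comm : ∀ x, N (D x) = D (N x)
  ss : Module.End.IsSemisimple (D : E →ₗ[ℝ] E)
  nil : ∃ m, N ^ m = 0

lemma exists_JC (A : E →L[ℝ] E) : ∃ D N : E →L[ℝ] E, JC A D N := by
  obtain ⟨n, hn, s, hs, h1, h2, h3⟩ := Module.End.exists_isNilpotent_isSemisimple (K := ℝ) (f := (A : E →ₗ[ℝ] E))
  have hc : Commute n s := by
    rw [Algebra.adjoin_singleton_eq_range_aeval] at hn hs
    obtain ⟨p, rfl⟩ := hn
    obtain ⟨q, rfl⟩ := hs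
    exact (Commute.all p q).map (Polynomial.aeval (A : E →ₗ[ℝ] E))
  refine ⟨LinearMap.toContinuousLinearMap s, LinearMap.toContinuousLinearMap n, ⟨?_, ?_, ?_, ?_⟩⟩
  · ext x
    have := congrArg (fun f : Module.End ℝ E => f x) h3
    simp only [LinearMap.add_apply] at this
    simp only [ContinuousLinearMap.add_apply, LinearMap.coe_toContinuousLinearMap']
    rw [add_comm]; exact this
  · intro x
    exact congrArg (fun f : Module.End ℝ E => f x) hc
  · exact h2
  · obtain ⟨m, hm⟩ := h1
    refine ⟨m, ?_⟩
    ext x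
    have : ∀ k : ℕ, ∀ x, ((LinearMap.toContinuousLinearMap n) ^ k) x = (n ^ k) x := by
      intro k
      induction k with
      | zero => intro x; rfl
      | succ k ih => intro x; rw [pow_succ', pow_succ']; exact congrArg n (ih x)
    rw [this, hm]; rfl

lemma JC.neg {A D N : E →L[ℝ] E} (h : JC A D N) : JC (-A) (-D) (-N) := by
  refine ⟨by rw [h.sum]; abel, by intro x; simp [h.comm], ?_, ?_⟩
  · exact Module.End.isSemisimple_neg.2 h.ss
  · obtain ⟨m, hm⟩ := h.nil
    exact ⟨m, by rw [neg_pow, hm, mul_zero]⟩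

/-- exponentially stable at rate `a` -/
def SSa (D : E →L[ℝ] E) (a : ℝ) : Submodule ℝ E where
  carrier := {x | ∃ K, ∀ t : ℝ, 0 ≤ t → ‖fl D t x‖ ≤ K * Real.exp (-(a * t))}
  zero_mem' := ⟨0, fun t _ => by simp⟩
  add_mem' := by
    rintro x y ⟨K, hK⟩ ⟨K', hK'⟩
    refine ⟨K + K', fun t ht => ?_⟩
    rw [map_add, add_mul]
    exact (norm_add_le _ _).trans (add_le_add (hK t ht) (hK' t ht))
  smul_mem' := by
    rintro c x ⟨K, hK⟩
    refine ⟨|c| * K, fun t ht => ?_⟩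
    rw [map_smul, norm_smul, mul_assoc, Real.norm_eq_abs]
    exact mul_le_mul_of_nonneg_left (hK t ht) (abs_nonneg _)

lemma SSa_anti (D : E →L[ℝ] E) {a b : ℝ} (h : a ≤ b) : SSa D b ≤ SSa D a := by
  rintro x ⟨K, hK⟩
  have hK0 : 0 ≤ K := by
    have := hK 0 le_rfl
    simp only [fl_zero_apply, mul_zero, neg_zero, Real.exp_zero, mul_one] at this
    exact (norm_nonneg _).trans this
  refine ⟨K, fun t ht => (hK t ht).trans (mul_le_mul_of_nonneg_left (Real.exp_le_exp.2 ?_) hK0)⟩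
  nlinarith

/-- stable space -/
def SS (D : E →L[ℝ] E) : Submodule ℝ E where
  carrier := {x | ∃ a, 0 < a ∧ x ∈ SSa D a}
  zero_mem' := ⟨1, one_pos, Submodule.zero_mem _⟩
  add_mem' := by
    rintro x y ⟨a, ha, hx⟩ ⟨b, hb, hy⟩
    exact ⟨min a b, lt_min ha hb, Submodule.add_mem _ (SSa_anti D (min_le_left _ _) hx)
      (SSa_anti D (min_le_right _ _) hy)⟩
  smul_mem' := by
    rintro c x ⟨a, ha, hx⟩
    exact ⟨a, ha, Submodule.smul_mem _ _ hx⟩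

def UU (D : E →L[ℝ] E) : Submodule ℝ E := SS (-D)

/-- central space of semisimple D -/
def CC (D : E →L[ℝ] E) : Submodule ℝ E where
  carrier := {x | ∃ K, ∀ t : ℝ, ‖fl D t x‖ ≤ K}
  zero_mem' := ⟨0, fun t => by simp⟩
  add_mem' := by
    rintro x y ⟨K, hK⟩ ⟨K', hK'⟩
    refine ⟨K + K', fun t => ?_⟩
    rw [map_add]
    exact (norm_add_le _ _).trans (add_le_add (hK t) (hK' t))
  smul_mem' := by
    rintro c x ⟨K, hK⟩
    refine ⟨|c| * K, fun t => ?_⟩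
    rw [map_smul, norm_smul, Real.norm_eq_abs]
    exact mul_le_mul_of_nonneg_left (hK t) (abs_nonneg _)

lemma CC_neg (D : E →L[ℝ] E) : CC (-D) = CC D := by
  ext x
  constructor
  · rintro ⟨K, hK⟩
    exact ⟨K, fun t => by have := hK (-t); rwa [fl_neg, neg_neg] at this⟩
  · rintro ⟨K, hK⟩
    exact ⟨K, fun t => by rw [fl_neg]; exact hK _⟩

lemma SS_inv (D L : E →L[ℝ] E) (h : ∀ x, L (D x) = D (L x)) {x : E} (hx : x ∈ SS D) : L x ∈ SS D := by
  obtain ⟨a, ha, K, hK⟩ := hx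
  refine ⟨a, ha, ‖L‖ * K, fun t ht => ?_⟩
  rw [← fl_comm_of D L h, mul_assoc]
  exact (L.le_opNorm _).trans (mul_le_mul_of_nonneg_left (hK t ht) (norm_nonneg _))

lemma UU_inv (D L : E →L[ℝ] E) (h : ∀ x, L (D x) = D (L x)) {x : E} (hx : x ∈ UU D) : L x ∈ UU D :=
  SS_inv (-D) L (fun x => by simp [h]) hx

lemma CC_inv (D L : E →L[ℝ] E) (h : ∀ x, L (D x) = D (L x)) {x : E} (hx : x ∈ CC D) : L x ∈ CC D := by
  obtain ⟨K, hK⟩ := hx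
  refine ⟨‖L‖ * K, fun t => ?_⟩
  rw [← fl_comm_of D L h]
  exact (L.le_opNorm _).trans (mul_le_mul_of_nonneg_left (hK t) (norm_nonneg _))

lemma SS_bound (D : E →L[ℝ] E) : ∃ a K : ℝ, 0 < a ∧ 0 < K ∧ ∀ x ∈ SS D, ∀ t : ℝ, 0 ≤ t →
    ‖fl D t x‖ ≤ K * Real.exp (-(a * t)) * ‖x‖ := by
  obtain ⟨a, ha, hS⟩ : ∃ a, 0 < a ∧ SS D ≤ SSa D a := by
    let b := Module.finBasis ℝ (SS D)
    have h1 : ∀ᶠ a in 𝓝[>] (0:ℝ), ∀ i, (b i : E) ∈ SSa D a := by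
      rw [eventually_all]
      intro i
      obtain ⟨a, ha, hx⟩ := (b i).2
      filter_upwards [Ioo_mem_nhdsGT ha] with c hc
      exact SSa_anti D hc.2.le hx
    obtain ⟨a, h2, h3⟩ := (h1.and self_mem_nhdsWithin).exists
    refine ⟨a, h3, ?_⟩
    have : (⊤ : Submodule ℝ (SS D)) ≤ (SSa D a).comap (SS D).subtype := by
      rw [← b.span_eq, Submodule.span_le]
      rintro _ ⟨i, rfl⟩
      exact h2 i
    intro x hx
    exact this (x := ⟨x, hx⟩) trivial
  obtain ⟨K, hK⟩ := banach_steinhaus (ι := {t : ℝ // 0 ≤ t})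
    (g := fun t => (Real.exp (a * t.1)) • ((fl D t.1).comp (SS D).subtypeL)) (by
      intro x
      obtain ⟨K, hK⟩ := hS x.2
      refine ⟨K, fun t => ?_⟩
      simp only [ContinuousLinearMap.smul_apply, ContinuousLinearMap.comp_apply, norm_smul, Real.norm_eq_abs, Real.abs_exp]
      have := mul_le_mul_of_nonneg_left (hK t.1 t.2) (Real.exp_pos (a * t.1)).le
      refine this.trans (le_of_eq ?_)
      rw [mul_left_comm, ← Real.exp_add]; simp)
  refine ⟨a, max K 1, ha, by positivity, fun x hx t ht => ?_⟩
  have h1 := (ContinuousLinearMap.le_opNorm _ (⟨x, hx⟩ : SS D)).trans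
    (mul_le_mul_of_nonneg_right (hK ⟨t, ht⟩) (norm_nonneg _))
  simp only [ContinuousLinearMap.smul_apply, ContinuousLinearMap.comp_apply, norm_smul, Real.norm_eq_abs, Real.abs_exp] at h1
  have h2 : Real.exp (a * t) * ‖fl D t x‖ ≤ K * ‖x‖ := h1
  have h3 : ‖fl D t x‖ = Real.exp (-(a * t)) * (Real.exp (a * t) * ‖fl D t x‖) := by
    rw [← mul_assoc, ← Real.exp_add]; simp
  rw [h3]
  calc _ ≤ Real.exp (-(a * t)) * (K * ‖x‖) := mul_le_mul_of_nonneg_left h2 (Real.exp_pos _).le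
    _ ≤ Real.exp (-(a * t)) * (max K 1 * ‖x‖) := by gcongr; exact le_max_left _ _
    _ = _ := by ring

lemma CC_bound (D : E →L[ℝ] E) : ∃ K : ℝ, 0 < K ∧ ∀ x ∈ CC D, ∀ t : ℝ, ‖fl D t x‖ ≤ K * ‖x‖ := by
  obtain ⟨K, hK⟩ := banach_steinhaus (ι := ℝ)
    (g := fun t => ((fl D t).comp (CC D).subtypeL)) (by
      intro x
      obtain ⟨K, hK⟩ := x.2
      exact ⟨K, fun t => hK t⟩)
  refine ⟨max K 1, by positivity, fun x hx t => ?_⟩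
  have h1 := (ContinuousLinearMap.le_opNorm _ (⟨x, hx⟩ : CC D)).trans
    (mul_le_mul_of_nonneg_right (hK t) (norm_nonneg _))
  refine (show ‖fl D t x‖ ≤ K * ‖x‖ from h1).trans ?_
  gcongr; exact le_max_left _ _

lemma CC_const_of (D : E →L[ℝ] E) (a : ℝ) (x : E) (K : ℝ) (h : ∀ t, ‖fl D t x‖ ≤ K * Real.exp (a * t)) :
    x ∈ SS D ⊔ UU D ⊔ CC D := by
  rcases lt_trichotomy a 0 with ha | ha | ha
  · refine (le_sup_left.trans le_sup_left : SS D ≤ _) ⟨-a, by linarith, K, fun t _ => ?_⟩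
    simpa using h t
  · refine (le_sup_right : CC D ≤ _) ⟨K, fun t => ?_⟩
    simpa [ha] using h t
  · refine (le_sup_right.trans le_sup_left : UU D ≤ _) ⟨a, by linarith, K, fun t _ => ?_⟩
    simpa [fl_neg] using h (-t)

lemma SUC_top (D : E →L[ℝ] E) (hD : Module.End.IsSemisimple (D : E →ₗ[ℝ] E)) :
    SS D ⊔ UU D ⊔ CC D = ⊤ := by
  refine semisimple_top (D : E →ₗ[ℝ] E) hD _ ?_ ?_
  · intro a x hx
    refine CC_const_of D a x ‖x‖ fun t => ?_
    rw [fl_eig D a x hx, norm_smul, Real.norm_eq_abs, Real.abs_exp, mul_comm]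
  · intro a w x hw hx
    refine CC_const_of D a x (‖x‖ + w⁻¹ * ‖D x - a • x‖) fun t => ?_
    rw [fl_eig2 D a w hw.ne' x hx, norm_smul, Real.norm_eq_abs, Real.abs_exp, mul_comm]
    refine mul_le_mul_of_nonneg_right ?_ (Real.exp_pos _).le
    refine (norm_add_le _ _).trans (add_le_add ?_ ?_)
    · rw [norm_smul]
      exact mul_le_of_le_one_left (norm_nonneg _) (Real.abs_cos_le_one _)
    · rw [norm_smul]
      refine mul_le_mul_of_nonneg_right ?_ (norm_nonneg _)
      rw [norm_div, Real.norm_eq_abs, Real.norm_eq_abs, abs_of_pos hw, div_eq_mul_inv]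
      exact mul_le_of_le_one_left (by positivity) (Real.abs_sin_le_one _)

lemma exp_neg_tendsto {a : ℝ} (ha : 0 < a) (c : ℝ) : Tendsto (fun t : ℝ => c * Real.exp (-(a * t))) atTop (𝓝 0) := by
  have h1 : Tendsto (fun t : ℝ => a * t) atTop atTop := tendsto_id.const_mul_atTop ha
  have := (Real.tendsto_exp_neg_atTop_nhds_zero.comp h1).const_mul c
  simpa using this

/-- An element of `SS D` whose backward orbit is bounded is zero. -/
lemma SS_zero (D : E →L[ℝ] E) (x : E) (hx : x ∈ SS D) (K : ℝ) (h : ∀ t ≥ 0, ‖fl D (-t) x‖ ≤ K) : x = 0 := by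
  obtain ⟨a, K', ha, hK', hb⟩ := SS_bound D
  have h1 : ∀ t ≥ 0, ‖x‖ ≤ (K' * K) * Real.exp (-(a * t)) := by
    intro t ht
    have h2 := hb (fl D (-t) x) (SS_inv D _ (fun y => (fl_comm D y _).symm) hx) t ht
    rw [fl_apply_neg] at h2
    refine h2.trans ?_
    have := mul_le_mul_of_nonneg_left (h t ht) (by positivity : 0 ≤ K' * Real.exp (-(a * t)))
    linarith
  have h2 : ‖x‖ ≤ 0 := ge_of_tendsto (exp_neg_tendsto ha (K' * K)) (by
    filter_upwards [eventually_ge_atTop 0] with t ht using h1 t ht)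
  exact norm_le_zero_iff.1 h2

lemma SUC_indep (D : E →L[ℝ] E) {s u c : E} (hs : s ∈ SS D) (hu : u ∈ UU D) (hc : c ∈ CC D)
    (h : s + u + c = 0) : s = 0 ∧ u = 0 ∧ c = 0 := by
  have key : ∀ (D : E →L[ℝ] E) {s u c : E} (_ : s ∈ SS D) (_ : u ∈ UU D) (_ : c ∈ CC D)
    (_ : s + u + c = 0), u = 0 := by
    intro D s u c hs hu hc h
    obtain ⟨a, ha, K, hK⟩ := hs
    obtain ⟨K', hK'⟩ := hc
    have hK0 : 0 ≤ K := by
      have := hK 0 le_rfl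
      simp only [fl_zero_apply, mul_zero, neg_zero, Real.exp_zero, mul_one] at this
      exact (norm_nonneg _).trans this
    refine SS_zero (-D) u hu (K + K') fun t ht => ?_
    rw [fl_neg, neg_neg]
    have : u = -(s + c) := by
      rw [eq_neg_iff_add_eq_zero, ← h]; abel
    rw [this, map_neg, norm_neg, map_add]
    refine (norm_add_le _ _).trans (add_le_add ((hK t ht).trans ?_) (hK' t))
    refine mul_le_of_le_one_right hK0 (Real.exp_le_one_iff.2 ?_)
    nlinarith
  have hu0 := key D hs hu hc h
  have hs0 := key (-D) (s := u) (u := s) (c := c) hu (by rw [UU, neg_neg]; exact hs) (by rw [CC_neg]; exact hc)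
    (by rw [← h]; abel)
  refine ⟨hs0, hu0, ?_⟩
  rw [hs0, hu0] at h; simpa using h

/-- spectral projections -/
lemma exists_proj (D : E →L[ℝ] E) (hD : Module.End.IsSemisimple (D : E →ₗ[ℝ] E)) :
    ∃ PS PU PC : E →L[ℝ] E, (∀ x, PS x ∈ SS D) ∧ (∀ x, PU x ∈ UU D) ∧ (∀ x, PC x ∈ CC D) ∧
      (∀ x, PS x + PU x + PC x = x) := by
  have h : ∀ x : E, ∃ s u c : E, s ∈ SS D ∧ u ∈ UU D ∧ c ∈ CC D ∧ s + u + c = x := by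
    intro x
    have hx : x ∈ SS D ⊔ UU D ⊔ CC D := by rw [SUC_top D hD]; trivial
    obtain ⟨y, hy, c, hc, rfl⟩ := Submodule.mem_sup.1 hx
    obtain ⟨s, hs, u, hu, rfl⟩ := Submodule.mem_sup.1 hy
    exact ⟨s, u, c, hs, hu, hc, rfl⟩
  choose s u c hs hu hc hx using h
  have huniq : ∀ x s' u' c', s' ∈ SS D → u' ∈ UU D → c' ∈ CC D → s' + u' + c' = x →
      s x = s' ∧ u x = u' ∧ c x = c' := by
    intro x s' u' c' h1 h2 h3 h4
    have := SUC_indep D (Submodule.sub_mem _ (hs x) h1) (Submodule.sub_mem _ (hu x) h2)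
      (Submodule.sub_mem _ (hc x) h3) (by
        have := (hx x).trans h4.symm
        have h5 : (s x + u x + c x) - (s' + u' + c') = 0 := sub_eq_zero.2 this
        rw [← h5]; abel)
    exact ⟨sub_eq_zero.1 this.1, sub_eq_zero.1 this.2.1, sub_eq_zero.1 this.2.2⟩
  have hadd : ∀ x y, s (x + y) = s x + s y ∧ u (x + y) = u x + u y ∧ c (x + y) = c x + c y := fun x y =>
    huniq _ _ _ _ (Submodule.add_mem _ (hs x) (hs y)) (Submodule.add_mem _ (hu x) (hu y))
      (Submodule.add_mem _ (hc x) (hc y)) (by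
        conv_rhs => rw [← hx x, ← hx y]
        abel)
  have hsm : ∀ (a : ℝ) x, s (a • x) = a • s x ∧ u (a • x) = a • u x ∧ c (a • x) = a • c x := fun a x =>
    huniq _ _ _ _ (Submodule.smul_mem _ a (hs x)) (Submodule.smul_mem _ a (hu x))
      (Submodule.smul_mem _ a (hc x)) (by
        conv_rhs => rw [← hx x]
        simp [smul_add])
  exact ⟨LinearMap.toContinuousLinearMap ⟨⟨s, fun x y => (hadd x y).1⟩, fun a x => (hsm a x).1⟩,
    LinearMap.toContinuousLinearMap ⟨⟨u, fun x y => (hadd x y).2.1⟩, fun a x => (hsm a x).2.1⟩,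
    LinearMap.toContinuousLinearMap ⟨⟨c, fun x y => (hadd x y).2.2⟩, fun a x => (hsm a x).2.2⟩,
    hs, hu, hc, hx⟩

end SUC

end M3c_part

section M3d_part

section SUC2
variable {E : Type*} [NormedAddCommGroup E] [NormedSpace ℝ E] [FiniteDimensional ℝ E] [CompleteSpace E]

structure SProj (D PS PU PC : E →L[ℝ] E) : Prop where
  memS : ∀ x, PS x ∈ SS D
  memU : ∀ x, PU x ∈ UU D
  memC : ∀ x, PC x ∈ CC D
  sum : ∀ x, PS x + PU x + PC x = x

lemma SProj.uniq {D PS PU PC : E →L[ℝ] E} (h : SProj D PS PU PC) {s u c : E} (hs : s ∈ SS D) (hu : u ∈ UU D)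
    (hc : c ∈ CC D) : PS (s + u + c) = s ∧ PU (s + u + c) = u ∧ PC (s + u + c) = c := by
  set x := s + u + c with hx
  have := SUC_indep D (Submodule.sub_mem _ (h.memS x) hs) (Submodule.sub_mem _ (h.memU x) hu)
      (Submodule.sub_mem _ (h.memC x) hc) (by
        have h5 : (PS x + PU x + PC x) - (s + u + c) = 0 := sub_eq_zero.2 (h.sum x)
        rw [← h5]; abel)
  exact ⟨sub_eq_zero.1 this.1, sub_eq_zero.1 this.2.1, sub_eq_zero.1 this.2.2⟩

lemma SProj.comm {D PS PU PC : E →L[ℝ] E} (h : SProj D PS PU PC) (L : E →L[ℝ] E)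
    (hL : ∀ x, L (D x) = D (L x)) (x : E) :
    PS (L x) = L (PS x) ∧ PU (L x) = L (PU x) ∧ PC (L x) = L (PC x) := by
  have := h.uniq (SS_inv D L hL (h.memS x)) (UU_inv D L hL (h.memU x)) (CC_inv D L hL (h.memC x))
  rwa [← map_add, ← map_add, h.sum] at this

lemma SProj.onS {D PS PU PC : E →L[ℝ] E} (h : SProj D PS PU PC) {x : E} (hx : x ∈ SS D) :
    PS x = x ∧ PU x = 0 ∧ PC x = 0 := by
  have := h.uniq hx (Submodule.zero_mem _) (Submodule.zero_mem _)
  simpa using this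

lemma SProj.onU {D PS PU PC : E →L[ℝ] E} (h : SProj D PS PU PC) {x : E} (hx : x ∈ UU D) :
    PS x = 0 ∧ PU x = x ∧ PC x = 0 := by
  have := h.uniq (Submodule.zero_mem _) hx (Submodule.zero_mem _)
  simpa using this

lemma SProj.onC {D PS PU PC : E →L[ℝ] E} (h : SProj D PS PU PC) {x : E} (hx : x ∈ CC D) :
    PS x = 0 ∧ PU x = 0 ∧ PC x = x := by
  have := h.uniq (Submodule.zero_mem _) (Submodule.zero_mem _) hx
  simpa using this

lemma JC.commA {A D N : E →L[ℝ] E} (h : JC A D N) (x : E) : A (D x) = D (A x) := by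
  rw [h.sum]; simp [h.comm]

lemma JC.commAN {A D N : E →L[ℝ] E} (h : JC A D N) (x : E) : A (N x) = N (A x) := by
  rw [h.sum]; simp [h.comm]

lemma JC.fl {A D N : E →L[ℝ] E} (h : JC A D N) (t : ℝ) (x : E) : fl A t x = LF.fl D t (LF.fl N t x) := by
  rw [h.sum, fl_add_op D N h.comm]

lemma JC.fl_commD {A D N : E →L[ℝ] E} (h : JC A D N) (t : ℝ) (x : E) : LF.fl A t (D x) = D (LF.fl A t x) :=
  (fl_comm_of A D (fun x => (h.commA x).symm) t x).symm

lemma nilp_growth (N : E →L[ℝ] E) (hN : ∃ m, N ^ m = 0) {ε : ℝ} (hε : 0 < ε) :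
    ∃ K : ℝ, 0 < K ∧ ∀ t x, ‖fl N t x‖ ≤ K * Real.exp (ε * |t|) * ‖x‖ := by
  obtain ⟨m, hm⟩ := hN
  refine ⟨(∑ k ∈ Finset.range m, (ε ^ k)⁻¹ * ‖N ^ k‖) + 1, by positivity, fun t x => ?_⟩
  rw [fl_nilp N m hm]
  have h1 : ‖∑ k ∈ Finset.range m, ((k.factorial : ℝ)⁻¹ * t ^ k) • (N ^ k) x‖ ≤
      ∑ k ∈ Finset.range m, ((ε ^ k)⁻¹ * ‖N ^ k‖) * Real.exp (ε * |t|) * ‖x‖ := by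
    refine (norm_sum_le _ _).trans (Finset.sum_le_sum fun k _ => ?_)
    rw [norm_smul]
    have h2 : ‖(k.factorial : ℝ)⁻¹ * t ^ k‖ ≤ (ε ^ k)⁻¹ * Real.exp (ε * |t|) := by
      have := Real.pow_div_factorial_le_exp (ε * |t|) (by positivity) k
      rw [norm_mul, norm_pow, norm_inv, Real.norm_eq_abs, Real.norm_eq_abs, Nat.abs_cast]
      rw [mul_pow] at this
      calc (k.factorial : ℝ)⁻¹ * |t| ^ k = (ε ^ k)⁻¹ * (ε ^ k * |t| ^ k / k.factorial) := by
            field_simp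
        _ ≤ _ := by gcongr
    calc _ ≤ ((ε ^ k)⁻¹ * Real.exp (ε * |t|)) * (‖N ^ k‖ * ‖x‖) :=
          mul_le_mul h2 ((N ^ k).le_opNorm x) (norm_nonneg _) (by positivity)
      _ = _ := by ring
  refine h1.trans ?_
  rw [← Finset.sum_mul, ← Finset.sum_mul]
  gcongr
  linarith

lemma JC.boundS {A D N : E →L[ℝ] E} (h : JC A D N) : ∃ a K : ℝ, 0 < a ∧ 0 < K ∧ ∀ x ∈ SS D, ∀ t : ℝ, 0 ≤ t →
    ‖LF.fl A t x‖ ≤ K * Real.exp (-(a * t)) * ‖x‖ := by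
  obtain ⟨a, K, ha, hK, hb⟩ := SS_bound D
  obtain ⟨K', hK', hb'⟩ := nilp_growth N h.nil (half_pos ha)
  refine ⟨a / 2, K * K', half_pos ha, by positivity, fun x hx t ht => ?_⟩
  rw [h.fl]
  have h1 := hb (LF.fl N t x) (SS_inv D _ (fun y => (fl_comm_of N D (fun z => (h.comm z).symm) t y).symm) hx) t ht
  refine h1.trans ?_
  have h2 := hb' t x
  rw [abs_of_nonneg ht] at h2
  calc _ ≤ K * Real.exp (-(a * t)) * (K' * Real.exp (a / 2 * t) * ‖x‖) := by gcongr
    _ = K * K' * (Real.exp (-(a * t)) * Real.exp (a / 2 * t)) * ‖x‖ := by ring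
    _ = _ := by rw [← Real.exp_add]; congr 3; ring

lemma JC.boundU {A D N : E →L[ℝ] E} (h : JC A D N) : ∃ a K : ℝ, 0 < a ∧ 0 < K ∧ ∀ x ∈ UU D, ∀ t : ℝ, 0 ≤ t →
    ‖LF.fl A (-t) x‖ ≤ K * Real.exp (-(a * t)) * ‖x‖ := by
  obtain ⟨a, K, ha, hK, hb⟩ := h.neg.boundS
  refine ⟨a, K, ha, hK, fun x hx t ht => ?_⟩
  have := hb x hx t ht
  rwa [fl_neg] at this

lemma JC.boundC {A D N : E →L[ℝ] E} (h : JC A D N) {ε : ℝ} (hε : 0 < ε) : ∃ K : ℝ, 0 < K ∧ ∀ x ∈ CC D, ∀ t : ℝ,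
    ‖LF.fl A t x‖ ≤ K * Real.exp (ε * |t|) * ‖x‖ := by
  obtain ⟨K, hK, hb⟩ := CC_bound D
  obtain ⟨K', hK', hb'⟩ := nilp_growth N h.nil hε
  refine ⟨K * K', by positivity, fun x hx t => ?_⟩
  rw [h.fl]
  have h1 := hb (LF.fl N t x) (CC_inv D _ (fun y => (fl_comm_of N D (fun z => (h.comm z).symm) t y).symm) hx) t
  refine h1.trans ?_
  calc _ ≤ K * (K' * Real.exp (ε * |t|) * ‖x‖) := by gcongr; exact hb' t x
    _ = _ := by ring

lemma nilp_fixed (N : E →L[ℝ] E) (hN : ∃ m, N ^ m = 0) (c : E) {l : Filter ℝ} [l.NeBot]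
    (h : Tendsto (fun t => fl N t c) l (𝓝 0)) : c = 0 := by
  obtain ⟨m, hm⟩ := hN
  by_contra hc
  classical
  have hex : ∃ k, (N ^ k) c = 0 := ⟨m, by rw [hm]; rfl⟩
  have hk := Nat.find_spec hex
  have hk0 : Nat.find hex ≠ 0 := by
    intro h0
    rw [h0] at hk
    exact hc (by simpa using hk)
  obtain ⟨k, hk1⟩ := Nat.exists_eq_succ_of_ne_zero hk0
  rw [hk1] at hk
  have hmin := Nat.find_min hex (m := k) (by omega)
  have h1 : Tendsto (fun t => (N ^ k) (fl N t c)) l (𝓝 ((N ^ k) 0)) :=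
    ((N ^ k).continuous.tendsto 0).comp h
  have h2 : ∀ t, (N ^ k) (fl N t c) = (N ^ k) c := by
    intro t
    rw [fl_comm_of N (N ^ k) (fun x => by
      have : N ^ k * N = N * N ^ k := (Commute.pow_self N k).eq
      exact congrArg (fun f : E →L[ℝ] E => f x) this)]
    apply fl_fixed
    rw [← ContinuousLinearMap.mul_apply, ← pow_succ']; exact hk
  simp only [h2, map_zero] at h1
  exact hmin (tendsto_nhds_unique tendsto_const_nhds h1)

lemma JC.zeroC {A D N : E →L[ℝ] E} (h : JC A D N) {c : E} (hc : c ∈ CC D) {l : Filter ℝ} [l.NeBot]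
    (ht : Tendsto (fun t => LF.fl A t c) l (𝓝 0)) : c = 0 := by
  obtain ⟨K, hK, hb⟩ := CC_bound D
  refine nilp_fixed N h.nil c (l := l) ?_
  rw [tendsto_zero_iff_norm_tendsto_zero] at ht ⊢
  refine squeeze_zero (fun t => norm_nonneg _) (fun t => ?_) (by simpa using ht.const_mul K)
  have h1 := hb (LF.fl A t c) (CC_inv D _ (h.fl_commD t) hc) (-t)
  rwa [h.fl, fl_neg_apply, ← h.fl] at h1

lemma JC.zeroU {A D N : E →L[ℝ] E} (h : JC A D N) {a K : ℝ}
    (hb : ∀ x ∈ UU D, ∀ t : ℝ, 0 ≤ t → ‖LF.fl A (-t) x‖ ≤ K * Real.exp (-(a * t)) * ‖x‖) {u : E} (hu : u ∈ UU D)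
    (ht : Tendsto (fun t => Real.exp (-(a * |t|)) • LF.fl A t u) atTop (𝓝 0)) : u = 0 := by
  rw [tendsto_zero_iff_norm_tendsto_zero] at ht
  have h0 := ht.const_mul K
  rw [mul_zero] at h0
  refine norm_le_zero_iff.1 (ge_of_tendsto h0 ?_)
  filter_upwards [eventually_ge_atTop 0] with t ht
  have h1 := hb (LF.fl A t u) (UU_inv D _ (h.fl_commD t) hu) t ht
  rw [fl_neg_apply] at h1
  rw [norm_smul, Real.norm_eq_abs, Real.abs_exp, abs_of_nonneg ht]
  linarith

lemma JC.memS_iff {A D N : E →L[ℝ] E} (h : JC A D N) (x : E) :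
    x ∈ SS D ↔ Tendsto (fun t => LF.fl A t x) atTop (𝓝 0) := by
  constructor
  · intro hx
    obtain ⟨a, K, ha, hK, hb⟩ := h.boundS
    refine squeeze_zero_norm' ?_ (exp_neg_tendsto ha (K * ‖x‖))
    filter_upwards [eventually_ge_atTop 0] with t ht
    have := hb x hx t ht
    linarith
  · intro hx
    obtain ⟨PS, PU, PC, h1, h2, h3, h4⟩ := exists_proj D h.ss
    have hP : SProj D PS PU PC := ⟨h1, h2, h3, h4⟩
    obtain ⟨a, K, ha, hK, hb⟩ := h.boundU
    have hu : PU x = 0 := by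
      refine h.zeroU hb (h2 x) ?_
      have h5 : Tendsto (fun t => LF.fl A t (PU x)) atTop (𝓝 0) := by
        have := (PU.continuous.tendsto 0).comp hx
        simp only [map_zero] at this
        refine this.congr fun t => (hP.comm _ (h.fl_commD t) x).2.1
      refine squeeze_zero_norm (fun t => ?_) (tendsto_zero_iff_norm_tendsto_zero.1 h5)
      rw [norm_smul, Real.norm_eq_abs, Real.abs_exp]
      refine mul_le_of_le_one_left (norm_nonneg _) (Real.exp_le_one_iff.2 ?_)
      have := abs_nonneg t
      nlinarith
    have hc : PC x = 0 := by
      refine h.zeroC (h3 x) (l := atTop) ?_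
      have := (PC.continuous.tendsto 0).comp hx
      simp only [map_zero] at this
      refine this.congr fun t => (hP.comm _ (h.fl_commD t) x).2.2
    have := h4 x
    rw [hu, hc, add_zero, add_zero] at this
    rw [← this]; exact h1 x

lemma JC.memU_iff {A D N : E →L[ℝ] E} (h : JC A D N) (x : E) :
    x ∈ UU D ↔ Tendsto (fun t => LF.fl A t x) atBot (𝓝 0) := by
  rw [UU, h.neg.memS_iff]
  simp only [fl_neg]
  constructor
  · intro h1
    have := h1.comp tendsto_neg_atBot_atTop
    simpa [Function.comp_def] using this
  · intro h1
    exact h1.comp tendsto_neg_atTop_atBot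

lemma JC.memC_iff {A D N : E →L[ℝ] E} (h : JC A D N) (x : E) :
    x ∈ CC D ↔ ∀ ε > (0:ℝ), Tendsto (fun t : ℝ => Real.exp (-(ε * |t|)) • LF.fl A t x) (atBot ⊔ atTop) (𝓝 0) := by
  constructor
  · intro hx ε hε
    obtain ⟨K, hK, hb⟩ := h.boundC (half_pos hε)
    have h1 : Tendsto (fun t : ℝ => |t|) (atBot ⊔ atTop) atTop :=
      tendsto_abs_atBot_atTop.sup tendsto_abs_atTop_atTop
    refine squeeze_zero_norm (fun t => ?_) ((exp_neg_tendsto (half_pos hε) (K * ‖x‖)).comp h1)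
    rw [norm_smul, Real.norm_eq_abs, Real.abs_exp]
    have := mul_le_mul_of_nonneg_left (hb x hx t) (Real.exp_pos (-(ε * |t|))).le
    refine this.trans (le_of_eq ?_)
    have h2 : Real.exp (-(ε * |t|)) * Real.exp (ε / 2 * |t|) = Real.exp (-(ε / 2 * |t|)) := by
      rw [← Real.exp_add]; congr 1; ring
    simp only [Function.comp]
    rw [← h2]; ring
  · intro hx
    obtain ⟨PS, PU, PC, h1, h2, h3, h4⟩ := exists_proj D h.ss
    have hP : SProj D PS PU PC := ⟨h1, h2, h3, h4⟩
    obtain ⟨a, K, ha, hK, hb⟩ := h.boundU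
    obtain ⟨a', K', ha', hK', hb'⟩ := h.neg.boundU
    have hu : PU x = 0 := by
      refine h.zeroU hb (h2 x) ?_
      have := (PU.continuous.tendsto 0).comp ((hx a ha).mono_left le_sup_right)
      simp only [map_zero] at this
      refine this.congr fun t => ?_
      simp only [Function.comp, map_smul]
      rw [(hP.comm _ (h.fl_commD t) x).2.1]
    have hs : PS x = 0 := by
      refine h.neg.zeroU hb' (by rw [UU, neg_neg]; exact h1 x) ?_
      have := ((PS.continuous.tendsto 0).comp ((hx a' ha').mono_left le_sup_left)).comp tendsto_neg_atTop_atBot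
      simp only [map_zero] at this
      refine this.congr fun t => ?_
      simp only [Function.comp, map_smul, abs_neg]
      rw [(hP.comm _ (h.fl_commD (-t)) x).1, fl_neg]
    have := h4 x
    rw [hu, hs, add_zero, zero_add] at this
    rw [← this]; exact h3 x

end SUC2

end M3d_part

section M4a_part

section Pade
open Polynomial

lemma psd_exp : PowerSeries.derivative ℝ (PowerSeries.exp ℝ) = PowerSeries.exp ℝ := by
  ext n
  simp [PowerSeries.coeff_derivative, PowerSeries.coeff_exp, Nat.factorial_succ]
  field_simp

def oneD (Q : ℝ[X]) : ℝ[X] := Q + derivative Q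

lemma oneD_inj (Q : ℝ[X]) (h : oneD Q = 0) : Q = 0 := by
  by_contra hQ
  have h1 : derivative Q = -Q := by rw [eq_neg_iff_add_eq_zero, add_comm]; exact h
  have h2 := degree_derivative_lt hQ
  rw [h1, degree_neg] at h2
  exact lt_irrefl _ h2

lemma oneD_deg (Q : ℝ[X]) (q : ℕ) (h : Q.degree < q) : (oneD Q).degree < q :=
  (degree_add_le _ _).trans_lt (max_lt h ((degree_derivative_le).trans_lt h))

lemma psd_iter (Q : ℝ[X]) (n : ℕ) : (PowerSeries.derivative ℝ)^[n] ((Q : PowerSeries ℝ) * PowerSeries.exp ℝ) =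
    ((oneD^[n] Q : ℝ[X]) : PowerSeries ℝ) * PowerSeries.exp ℝ := by
  induction n generalizing Q with
  | zero => rfl
  | succ n ih =>
    rw [Function.iterate_succ, Function.iterate_succ, Function.comp, Function.comp, ← ih]
    congr 1
    rw [Derivation.leibniz, psd_exp, oneD]
    simp only [smul_eq_mul, PowerSeries.derivative_coe, Polynomial.coe_add]
    ring

lemma psd_coeff_zero (f : PowerSeries ℝ) (n q : ℕ) (h : ∀ i < n + q, PowerSeries.coeff i f = 0) :
    ∀ i < q, PowerSeries.coeff i ((PowerSeries.derivative ℝ)^[n] f) = 0 := by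
  induction n generalizing f with
  | zero => intro i hi; exact h i (by omega)
  | succ n ih =>
    rw [Function.iterate_succ, Function.comp]
    refine ih _ fun i hi => ?_
    rw [PowerSeries.coeff_derivative, h (i + 1) (by omega), zero_mul]

lemma psd_poly (P : ℝ[X]) (p : ℕ) (h : P.degree < p) :
    (PowerSeries.derivative ℝ)^[p] (P : PowerSeries ℝ) = 0 := by
  have : ∀ n, (PowerSeries.derivative ℝ)^[n] (P : PowerSeries ℝ) = ((derivative^[n] P : ℝ[X]) : PowerSeries ℝ) := by
    intro n
    induction n with
    | zero => rfl
    | succ n ih => rw [Function.iterate_succ', Function.comp, ih, Function.iterate_succ', Function.comp, PowerSeries.derivative_coe]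
  rw [this, iterate_derivative_eq_zero_of_degree_lt h]
  simp

lemma pade_inj (p q : ℕ) (P Q : ℝ[X]) (hP : P.degree < p) (hQ : Q.degree < q)
    (h : ∀ i < p + q, PowerSeries.coeff i ((P : PowerSeries ℝ) - (Q : PowerSeries ℝ) * PowerSeries.exp ℝ) = 0) : P = 0 ∧ Q = 0 := by
  have hQ0 : Q = 0 := by
    have h1 := psd_coeff_zero _ p q h
    have h2 : (PowerSeries.derivative ℝ)^[p] ((P : PowerSeries ℝ) - (Q : PowerSeries ℝ) * PowerSeries.exp ℝ) =
        - (((oneD^[p] Q : ℝ[X]) : PowerSeries ℝ) * PowerSeries.exp ℝ) := by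
      rw [← psd_iter]
      have : ∀ (f g : PowerSeries ℝ) n, (PowerSeries.derivative ℝ)^[n] (f - g) =
          (PowerSeries.derivative ℝ)^[n] f - (PowerSeries.derivative ℝ)^[n] g := by
        intro f g n
        induction n generalizing f g with
        | zero => rfl
        | succ n ih => simp only [Function.iterate_succ, Function.comp, map_sub, ih]
      rw [this, psd_poly P p hP, zero_sub]
    rw [h2] at h1
    have hdeg : ∀ n, (oneD^[n] Q).degree < q := by
      intro n
      induction n with
      | zero => exact hQ
      | succ n ih => rw [Function.iterate_succ', Function.comp]; exact oneD_deg _ _ ih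
    have h4 : oneD^[p] Q = 0 := by
      have h5 : (PowerSeries.X ^ q : PowerSeries ℝ) ∣ ((oneD^[p] Q : ℝ[X]) : PowerSeries ℝ) * PowerSeries.exp ℝ := by
        rw [PowerSeries.X_pow_dvd_iff]
        intro i hi
        have := h1 i hi
        simpa using this
      have hu : IsUnit (PowerSeries.exp ℝ) := by
        rw [PowerSeries.isUnit_iff_constantCoeff]
        simp
      rw [hu.dvd_mul_right] at h5
      rw [PowerSeries.X_pow_dvd_iff] at h5
      ext i
      by_cases hi : i < q
      · have := h5 i hi
        simpa using this
      · rw [coeff_eq_zero_of_degree_lt ((hdeg p).trans_le (by exact_mod_cast not_lt.1 hi))]; simp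
    have h6 : ∀ n, oneD^[n] Q = 0 → Q = 0 := by
      intro n
      induction n with
      | zero => exact id
      | succ n ih => intro h; rw [Function.iterate_succ', Function.comp] at h; exact ih (oneD_inj _ h)
    exact h6 p h4
  refine ⟨?_, hQ0⟩
  subst hQ0
  ext i
  by_cases hi : i < p
  · have := h i (by omega)
    simpa using this
  · rw [coeff_eq_zero_of_degree_lt (hP.trans_le (by exact_mod_cast not_lt.1 hi))]; simp

lemma pade_exists (p q : ℕ) (g : PowerSeries ℝ) : ∃ P Q : ℝ[X], P.degree < p ∧ Q.degree < q ∧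
    ∀ i < p + q, PowerSeries.coeff i ((P : PowerSeries ℝ) - (Q : PowerSeries ℝ) * PowerSeries.exp ℝ) = PowerSeries.coeff i g := by
  let T : (degreeLT ℝ p × degreeLT ℝ q) →ₗ[ℝ] (Fin (p + q) → ℝ) :=
    { toFun := fun x i => PowerSeries.coeff i (((x.1 : ℝ[X]) : PowerSeries ℝ) - ((x.2 : ℝ[X]) : PowerSeries ℝ) * PowerSeries.exp ℝ)
      map_add' := by
        intro x y
        ext i
        simp only [Prod.fst_add, Prod.snd_add, Submodule.coe_add, Polynomial.coe_add, add_mul, map_sub, map_add, Pi.add_apply]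
        ring
      map_smul' := by
        intro c x
        ext i
        simp only [Prod.smul_fst, Prod.smul_snd, Submodule.coe_smul, Polynomial.coe_smul, smul_mul_assoc, map_sub,
          PowerSeries.coeff_smul, Pi.smul_apply, RingHom.id_apply, smul_eq_mul]
        ring }
  have hinj : Function.Injective T := by
    rw [← LinearMap.ker_eq_bot, LinearMap.ker_eq_bot']
    intro x hx
    have := pade_inj p q x.1 x.2 (mem_degreeLT.1 x.1.2) (mem_degreeLT.1 x.2.2) (fun i hi => congrFun hx ⟨i, hi⟩)
    exact Prod.ext (Subtype.ext this.1) (Subtype.ext this.2)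
  have e1 := degreeLTEquiv ℝ p
  have e2 := degreeLTEquiv ℝ q
  have : FiniteDimensional ℝ (degreeLT ℝ p) := Module.Finite.equiv e1.symm
  have : FiniteDimensional ℝ (degreeLT ℝ q) := Module.Finite.equiv e2.symm
  have hfin : Module.finrank ℝ (degreeLT ℝ p × degreeLT ℝ q) = Module.finrank ℝ (Fin (p + q) → ℝ) := by
    rw [Module.finrank_prod, e1.finrank_eq, e2.finrank_eq]; simp
  obtain ⟨x, hx⟩ := (LinearMap.injective_iff_surjective_of_finrank_eq_finrank hfin).1 hinj
    (fun i => PowerSeries.coeff i g)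
  exact ⟨x.1, x.2, mem_degreeLT.1 x.1.2, mem_degreeLT.1 x.2.2, fun i hi => congrFun hx ⟨i, hi⟩⟩

def eT (m : ℕ) : ℝ[X] := PowerSeries.trunc m (PowerSeries.exp ℝ)

lemma eT_coeff (m : ℕ) (Q : ℝ[X]) (i : ℕ) (hi : i < m) :
    (Q * eT m).coeff i = PowerSeries.coeff i ((Q : PowerSeries ℝ) * PowerSeries.exp ℝ) := by
  rw [Polynomial.coeff_mul, PowerSeries.coeff_mul]
  refine Finset.sum_congr rfl fun x hx => ?_
  have : x.2 < m := by
    have := Finset.HasAntidiagonal.mem_antidiagonal.1 hx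
    omega
  rw [eT, PowerSeries.coeff_trunc, if_pos this, Polynomial.coeff_coe]

lemma padeB (k m : ℕ) (hm : 2 * k ≤ m) : ∃ P Q : ℝ[X], P.degree < k ∧ Q.degree < k ∧
    X ^ (2 * k) ∣ P - Q * eT m - X ^ k := by
  obtain ⟨P, Q, hP, hQ, h⟩ := pade_exists k k (PowerSeries.X ^ k)
  refine ⟨P, Q, hP, hQ, ?_⟩
  rw [X_pow_dvd_iff]
  intro i hi
  have := h i (by omega)
  rw [coeff_sub, coeff_sub, eT_coeff m Q i (by omega), coeff_X_pow]
  rw [PowerSeries.coeff_X_pow, map_sub, Polynomial.coeff_coe] at this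
  rw [this, sub_self]

lemma padeA (k m : ℕ) (hm : 2 * k + 1 ≤ m) : ∃ P Q : ℝ[X], P.degree < (k + 1 : ℕ) ∧ Q.degree < k ∧
    X ^ (2 * k + 1) ∣ P - (X ^ k + Q) * eT m := by
  obtain ⟨P, Q, hP, hQ, h⟩ := pade_exists (k + 1) k (PowerSeries.X ^ k * PowerSeries.exp ℝ)
  refine ⟨P, Q, hP, hQ, ?_⟩
  rw [X_pow_dvd_iff]
  intro i hi
  have := h i (by omega)
  rw [coeff_sub, eT_coeff m _ i (by omega)]
  rw [map_sub, Polynomial.coeff_coe] at this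
  simp only [Polynomial.coe_add, Polynomial.coe_pow, Polynomial.coe_X, add_mul, map_add]
  linarith

end Pade

end M4a_part

section M4b_part

section Cores
variable {E : Type*} [NormedAddCommGroup E] [NormedSpace ℝ E] [FiniteDimensional ℝ E] [CompleteSpace E]

def Kr (N : E →L[ℝ] E) (k : ℕ) : Submodule ℝ E := LinearMap.ker ((N ^ k : E →L[ℝ] E) : E →ₗ[ℝ] E)
def Im (N : E →L[ℝ] E) (V : Submodule ℝ E) (k : ℕ) : Submodule ℝ E :=
  V.map ((N ^ k : E →L[ℝ] E) : E →ₗ[ℝ] E)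

lemma mem_Kr {N : E →L[ℝ] E} {k : ℕ} {x : E} : x ∈ Kr N k ↔ (N ^ k) x = 0 := Iff.rfl
lemma mem_Im {N : E →L[ℝ] E} {V : Submodule ℝ E} {k : ℕ} {x : E} : x ∈ Im N V k ↔ ∃ z ∈ V, (N ^ k) z = x := Iff.rfl

lemma pow_add_apply (N : E →L[ℝ] E) (i j : ℕ) (x : E) : (N ^ (i + j)) x = (N ^ i) ((N ^ j) x) := by
  rw [pow_add]; rfl

lemma pow_mem {N : E →L[ℝ] E} {V : Submodule ℝ E} (hV : ∀ x ∈ V, N x ∈ V) (k : ℕ) {x : E} (hx : x ∈ V) :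
    (N ^ k) x ∈ V := by
  induction k with
  | zero => simpa using hx
  | succ n ih => rw [pow_succ']; exact hV _ ih

lemma Kr_mono (N : E →L[ℝ] E) : Monotone (Kr N) := by
  intro i j hij x hx
  obtain ⟨k, rfl⟩ := Nat.exists_eq_add_of_le hij
  rw [mem_Kr, add_comm, pow_add_apply, mem_Kr.1 hx, map_zero]

lemma Im_anti (N : E →L[ℝ] E) {V : Submodule ℝ E} (hV : ∀ x ∈ V, N x ∈ V) : Antitone (Im N V) := by
  rintro i j hij x ⟨z, hz, rfl⟩
  obtain ⟨k, rfl⟩ := Nat.exists_eq_add_of_le hij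
  exact ⟨(N ^ k) z, pow_mem hV k hz, (pow_add_apply N i k z).symm⟩

def Core1 (N : E →L[ℝ] E) (V : Submodule ℝ E) : Submodule ℝ E := ⨆ k, Kr N (k + 1) ⊓ Im N V k
def Core0 (N : E →L[ℝ] E) (V : Submodule ℝ E) : Submodule ℝ E := ⨆ k, Kr N k ⊓ Im N V k
def FF (N : E →L[ℝ] E) (V : Submodule ℝ E) (j : ℕ) : Submodule ℝ E := Kr N 1 ⊓ Im N V j

lemma modular_chain (K I : ℕ → Submodule ℝ E) (hK : Monotone K) (hI : Antitone I) (hK0 : K 0 = ⊥) (m : ℕ)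
    (hIm : I m = ⊥) (x : E) (hx : ∀ k, x ∈ K k ⊔ I k) : x ∈ ⨆ k, K (k + 1) ⊓ I k := by
  have key : ∀ n, ∃ c i, c ∈ (⨆ k, K (k + 1) ⊓ I k) ∧ c ∈ K n ∧ i ∈ I n ∧ x = c + i := by
    intro n
    induction n with
    | zero =>
      refine ⟨0, x, Submodule.zero_mem _, Submodule.zero_mem _, ?_, by simp⟩
      simpa [hK0] using hx 0
    | succ n ih =>
      obtain ⟨c, i, hc, hcK, hi, rfl⟩ := ih
      obtain ⟨κ, hκ, j, hj, h⟩ := Submodule.mem_sup.1 (hx (n + 1))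
      have hjn : j ∈ I n := hI (Nat.le_succ n) hj
      have hcK' : c ∈ K (n + 1) := hK (Nat.le_succ n) hcK
      have e : κ - c = i - j := by
        have : κ = c + i - j := by rw [← h]; abel
        rw [this]; abel
      have h1 : κ - c ∈ K (n + 1) ⊓ I n :=
        ⟨Submodule.sub_mem _ hκ hcK', by rw [e]; exact Submodule.sub_mem _ hi hjn⟩
      refine ⟨κ, j, ?_, hκ, hj, h.symm⟩
      have : κ = c + (κ - c) := by abel
      rw [this]
      exact Submodule.add_mem _ hc ((le_iSup (fun k => K (k + 1) ⊓ I k) n) h1)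
  obtain ⟨c, i, hc, _, hi, rfl⟩ := key m
  rw [hIm, Submodule.mem_bot] at hi
  rw [hi, add_zero]; exact hc

variable {N : E →L[ℝ] E} {V : Submodule ℝ E}

lemma Kr_zero : Kr N 0 = ⊥ := by
  ext x; rw [mem_Kr]; simp

lemma Im_zero : Im N V 0 = V := by
  ext x; rw [mem_Im]; simp

lemma Im_le (hV : ∀ x ∈ V, N x ∈ V) (k : ℕ) : Im N V k ≤ V := by
  have := Im_anti N hV (Nat.zero_le k)
  rwa [Im_zero] at this

lemma Core1_le (hV : ∀ x ∈ V, N x ∈ V) : Core1 N V ≤ V := iSup_le fun k => inf_le_right.trans (Im_le hV k)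
lemma Core0_le (hV : ∀ x ∈ V, N x ∈ V) : Core0 N V ≤ V := iSup_le fun k => inf_le_right.trans (Im_le hV k)
lemma FF_le (hV : ∀ x ∈ V, N x ∈ V) (j : ℕ) : FF N V j ≤ V := inf_le_right.trans (Im_le hV j)

lemma Core0_le_Core1 : Core0 N V ≤ Core1 N V :=
  iSup_mono fun k => inf_le_inf_right _ (Kr_mono N (Nat.le_succ k))

lemma Core1_of (hV : ∀ x ∈ V, N x ∈ V) (hN : ∃ m, N ^ m = 0) {x : E} (hx : x ∈ V)
    (h : ∀ k, (N ^ k) x ∈ Im N V (2 * k)) : x ∈ Core1 N V := by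
  obtain ⟨m, hm⟩ := hN
  refine modular_chain (Kr N) (Im N V) (Kr_mono N) (Im_anti N hV) Kr_zero m ?_ x fun k => ?_
  · rw [eq_bot_iff]
    rintro y ⟨z, _, rfl⟩
    rw [hm]; simp
  · obtain ⟨z, hz, h1⟩ := h k
    refine Submodule.mem_sup.2 ⟨x - (N ^ k) z, ?_, (N ^ k) z, ⟨z, hz, rfl⟩, by abel⟩
    rw [mem_Kr, map_sub, ← h1, two_mul]
    exact sub_eq_zero.2 (pow_add_apply N k k z)

lemma Core0_of (hV : ∀ x ∈ V, N x ∈ V) (hN : ∃ m, N ^ m = 0) {x : E} (hx : x ∈ V)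
    (h : ∀ k, (N ^ k) x ∈ Im N V (2 * k + 1)) : x ∈ Core0 N V := by
  obtain ⟨m, hm⟩ := hN
  have h1 := modular_chain (Kr N) (fun k => Im N V (k + 1)) (Kr_mono N)
    (fun i j hij => Im_anti N hV (by omega)) Kr_zero m ?_ x fun k => ?_
  · exact (iSup_le fun k => le_iSup (fun k => Kr N k ⊓ Im N V k) (k + 1) : (⨆ k, Kr N (k + 1) ⊓ Im N V (k + 1)) ≤ Core0 N V) h1
  · rw [eq_bot_iff]
    rintro y ⟨z, _, rfl⟩
    rw [pow_succ', hm]; simp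
  · obtain ⟨z, hz, h1⟩ := h k
    refine Submodule.mem_sup.2 ⟨x - (N ^ (k + 1)) z, ?_, (N ^ (k + 1)) z, ⟨z, hz, rfl⟩, by abel⟩
    rw [mem_Kr, map_sub, ← h1, ← pow_add_apply]
    rw [show 2 * k + 1 = k + (k + 1) by ring]
    exact sub_self _

lemma Core1_up (hV : ∀ x ∈ V, N x ∈ V) (i : ℕ) : Core1 N V ≤ Kr N i ⊔ Im N V i := by
  refine iSup_le fun k => ?_
  by_cases h : k + 1 ≤ i
  · exact inf_le_left.trans ((Kr_mono N h).trans le_sup_left)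
  · exact inf_le_right.trans ((Im_anti N hV (by omega)).trans le_sup_right)

lemma Core0_up (hV : ∀ x ∈ V, N x ∈ V) (i : ℕ) : Core0 N V ≤ Kr N i ⊔ Im N V (i + 1) := by
  refine iSup_le fun k => ?_
  by_cases h : k ≤ i
  · exact inf_le_left.trans ((Kr_mono N h).trans le_sup_left)
  · exact inf_le_right.trans ((Im_anti N hV (by omega)).trans le_sup_right)

lemma FF_core1 (hV : ∀ x ∈ V, N x ∈ V) (i : ℕ) : FF N (Core1 N V) i = FF N V (2 * i) := by
  apply le_antisymm
  · rintro x ⟨hx, y, hy, rfl⟩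
    refine ⟨hx, ?_⟩
    obtain ⟨κ, hκ, _, ⟨z, hz, rfl⟩, rfl⟩ := Submodule.mem_sup.1 (Core1_up hV i hy)
    refine ⟨z, hz, ?_⟩
    change (N ^ (2 * i)) z = (N ^ i) (κ + (N ^ i) z)
    rw [map_add, mem_Kr.1 hκ, zero_add, two_mul, pow_add_apply]
  · rintro x ⟨hx, z, hz, rfl⟩
    refine ⟨hx, (N ^ i) z, ?_, ?_⟩
    · refine le_iSup (fun k => Kr N (k + 1) ⊓ Im N V k) i ⟨?_, z, hz, rfl⟩
      rw [SetLike.mem_coe, mem_Kr, ← pow_add_apply]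
      have h1 : (N ^ 1) ((N ^ (2 * i)) z) = 0 := hx
      rw [← pow_add_apply] at h1
      rw [← h1]; congr 2; ring
    · change (N ^ i) ((N ^ i) z) = (N ^ (2 * i)) z
      rw [two_mul, pow_add_apply]

lemma FF_core0 (hV : ∀ x ∈ V, N x ∈ V) (i : ℕ) : FF N (Core0 N V) i = FF N V (2 * i + 1) := by
  apply le_antisymm
  · rintro x ⟨hx, y, hy, rfl⟩
    refine ⟨hx, ?_⟩
    obtain ⟨κ, hκ, _, ⟨z, hz, rfl⟩, rfl⟩ := Submodule.mem_sup.1 (Core0_up hV i hy)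
    refine ⟨z, hz, ?_⟩
    change (N ^ (2 * i + 1)) z = (N ^ i) (κ + (N ^ (i + 1)) z)
    rw [map_add, mem_Kr.1 hκ, zero_add, ← pow_add_apply]
    congr 2; ring
  · rintro x ⟨hx, z, hz, rfl⟩
    refine ⟨hx, (N ^ (i + 1)) z, ?_, ?_⟩
    · refine le_iSup (fun k => Kr N k ⊓ Im N V k) (i + 1) ⟨?_, z, hz, rfl⟩
      rw [SetLike.mem_coe, mem_Kr, ← pow_add_apply]
      have h1 : (N ^ 1) ((N ^ (2 * i + 1)) z) = 0 := hx
      rw [← pow_add_apply] at h1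
      rw [← h1]; congr 2; ring
    · change (N ^ i) ((N ^ (i + 1)) z) = (N ^ (2 * i + 1)) z
      rw [← pow_add_apply]; congr 2; ring

/-- if `Core1 V = V` then `N` vanishes on `V` -/
lemma Core1_eq (hV : ∀ x ∈ V, N x ∈ V) (hN : ∃ m, N ^ m = 0) (h : V ≤ Core1 N V) (x : E) (hx : x ∈ V) : N x = 0 := by
  have key : ∀ m, (∀ x ∈ V, (N ^ (m + 1)) x = 0) → ∀ x ∈ V, N x = 0 := by
    intro m
    induction m with
    | zero => intro h x hx; simpa using h x hx
    | succ m ih =>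
      intro hm
      refine ih fun x hx => ?_
      obtain ⟨κ, hκ, _, ⟨z, hz, rfl⟩, rfl⟩ := Submodule.mem_sup.1 (Core1_up hV (m + 1) (h hx))
      rw [map_add, mem_Kr.1 hκ, zero_add]
      change (N ^ (m + 1)) ((N ^ (m + 1)) z) = 0
      rw [← pow_add_apply, show m + 1 + (m + 1) = m + (m + 1 + 1) by ring, pow_add_apply, hm z hz, map_zero]
  obtain ⟨m, hm⟩ := hN
  exact key m (fun x _ => by rw [pow_succ', hm]; simp) x hx

lemma Core_inv (L : E →L[ℝ] E) (hL : ∀ x, L (N x) = N (L x)) (hVL : ∀ x ∈ V, L x ∈ V) :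
    (∀ x ∈ Core1 N V, L x ∈ Core1 N V) ∧ (∀ x ∈ Core0 N V, L x ∈ Core0 N V) ∧
    ∀ j, ∀ x ∈ FF N V j, L x ∈ FF N V j := by
  have hp : ∀ k x, L ((N ^ k) x) = (N ^ k) (L x) := by
    intro k
    induction k with
    | zero => intro x; rfl
    | succ k ih => intro x; rw [pow_succ', ContinuousLinearMap.mul_apply, hL, ih]; rfl
  have h1 : ∀ k j, ∀ x ∈ Kr N k ⊓ Im N V j, L x ∈ Kr N k ⊓ Im N V j := by
    rintro k j x ⟨hx, z, hz, rfl⟩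
    refine ⟨?_, L z, hVL z hz, ?_⟩
    · rw [SetLike.mem_coe, mem_Kr, ← hp, mem_Kr.1 hx, map_zero]
    · exact (hp j z).symm
  refine ⟨?_, ?_, h1 1⟩
  · have : Core1 N V ≤ (Core1 N V).comap (L : E →ₗ[ℝ] E) := iSup_le fun k x hx =>
      (le_iSup (fun k => Kr N (k + 1) ⊓ Im N V k) k) (h1 _ _ x hx)
    exact this
  · have : Core0 N V ≤ (Core0 N V).comap (L : E →ₗ[ℝ] E) := iSup_le fun k x hx =>
      (le_iSup (fun k => Kr N k ⊓ Im N V k) k) (h1 _ _ x hx)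
    exact this

end Cores

end M4b_part

section M4c_part

section CoreDyn
open Polynomial
variable {E : Type*} [NormedAddCommGroup E] [NormedSpace ℝ E] [FiniteDimensional ℝ E] [CompleteSpace E]

lemma aeval_mem {L : E →L[ℝ] E} {V : Submodule ℝ E} (hV : ∀ x ∈ V, L x ∈ V) (P : ℝ[X]) {x : E} (hx : x ∈ V) :
    (aeval L P) x ∈ V := by
  rw [aeval_eq_sum_range, ContinuousLinearMap.sum_apply]
  exact V.sum_mem fun i _ => V.smul_mem _ (pow_mem hV i hx)

lemma aeval_dvd_mem {N : E →L[ℝ] E} {V : Submodule ℝ E} (hV : ∀ x ∈ V, N x ∈ V) (t : ℝ) (Z : ℝ[X]) (r : ℕ)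
    (hZ : X ^ r ∣ Z) {x : E} (hx : x ∈ V) : (aeval (t • N) Z) x ∈ Im N V r := by
  obtain ⟨W, rfl⟩ := hZ
  rw [map_mul, map_pow, aeval_X, _root_.smul_pow, smul_mul_assoc]
  refine Submodule.smul_mem _ _ ⟨(aeval (t • N) W) x, ?_, rfl⟩
  exact aeval_mem (fun x hx => V.smul_mem _ (hV x hx)) W hx

lemma aeval_eT {N : E →L[ℝ] E} (m : ℕ) (hm : N ^ m = 0) (t : ℝ) (x : E) :
    (aeval (t • N) (eT m)) x = fl N t x := by
  have h1 : (eT m).natDegree < m + 1 := Nat.lt_succ_of_le (by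
    rw [natDegree_le_iff_degree_le]
    exact (PowerSeries.degree_trunc_lt _ _).le)
  rw [fl_nilp N (m + 1) (by rw [pow_succ, hm, zero_mul]), aeval_eq_sum_range' h1, ContinuousLinearMap.sum_apply]
  refine Finset.sum_congr rfl fun k hk => ?_
  rw [_root_.smul_pow, smul_smul]
  by_cases hk' : k < m
  · rw [eT, PowerSeries.coeff_trunc, if_pos hk', PowerSeries.coeff_exp]
    simp
  · rw [ContinuousLinearMap.smul_apply]
    rw [pow_eq_zero_of_le (not_lt.1 hk') hm]; simp

lemma aeval_growth (N : E →L[ℝ] E) (P : ℝ[X]) (k : ℕ) (hP : P.degree < k) :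
    ∃ C : ℝ, 0 ≤ C ∧ ∀ t : ℝ, 1 ≤ |t| → ∀ x, ‖(aeval (t • N) P) x‖ * |t| ≤ C * |t| ^ k * ‖x‖ := by
  by_cases hP0 : P = 0
  · exact ⟨0, le_rfl, fun t _ x => by simp [hP0]⟩
  have hd : P.natDegree < k := (natDegree_lt_iff_degree_lt hP0).2 hP
  refine ⟨∑ i ∈ Finset.range k, |P.coeff i| * ‖N ^ i‖, by positivity, fun t ht x => ?_⟩
  rw [aeval_eq_sum_range' hd, ContinuousLinearMap.sum_apply]
  refine (mul_le_mul_of_nonneg_right (norm_sum_le _ _) (abs_nonneg _)).trans ?_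
  rw [Finset.sum_mul, Finset.sum_mul, Finset.sum_mul]
  refine Finset.sum_le_sum fun i hi => ?_
  rw [ContinuousLinearMap.smul_apply, _root_.smul_pow, ContinuousLinearMap.smul_apply, norm_smul, norm_smul, norm_pow,
    Real.norm_eq_abs, Real.norm_eq_abs]
  have h1 : |t| ^ i * |t| ≤ |t| ^ k := by
    rw [← pow_succ]
    exact pow_le_pow_right₀ ht (by have := Finset.mem_range.1 hi; omega)
  calc _ = |P.coeff i| * (|t| ^ i * |t|) * ‖(N ^ i) x‖ := by ring
    _ ≤ |P.coeff i| * (|t| ^ k) * (‖N ^ i‖ * ‖x‖) := by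
        gcongr
        exact (N ^ i).le_opNorm x
    _ = _ := by ring

lemma aeval_small (N : E →L[ℝ] E) (P : ℝ[X]) (k : ℕ) (hP : P.degree < k) (ts : ℕ → ℝ)
    (hts : Tendsto (fun n => |ts n|) atTop atTop) (xs : ℕ → E) (M : ℝ) (hM : ∀ n, ‖xs n‖ ≤ M) :
    Tendsto (fun n => ((ts n) ^ k)⁻¹ • (aeval (ts n • N) P) (xs n)) atTop (𝓝 0) := by
  obtain ⟨C, hC, hb⟩ := aeval_growth N P k hP
  have h1 : Tendsto (fun n => (C * M) * |ts n|⁻¹) atTop (𝓝 0) := by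
    simpa using (tendsto_inv_atTop_zero.comp hts).const_mul (C * M)
  refine squeeze_zero_norm' ?_ h1
  filter_upwards [hts.eventually_ge_atTop 1] with n hn
  have h2 := hb (ts n) hn (xs n)
  have h0 : 0 < |ts n| := by linarith
  rw [norm_smul, norm_inv, norm_pow, Real.norm_eq_abs]
  rw [inv_mul_le_iff₀ (by positivity), ← mul_assoc, ← div_eq_mul_inv, le_div_iff₀ h0]
  refine h2.trans ?_
  have : C * |ts n| ^ k * ‖xs n‖ ≤ C * |ts n| ^ k * M := by gcongr; exact hM n
  linarith

lemma aeval_bdd (N : E →L[ℝ] E) (P : ℝ[X]) (k : ℕ) (hP : P.degree < (k + 1 : ℕ)) :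
    ∃ C : ℝ, 0 ≤ C ∧ ∀ t : ℝ, 1 ≤ |t| → ∀ x, ‖(t ^ k)⁻¹ • (aeval (t • N) P) x‖ ≤ C * ‖x‖ := by
  obtain ⟨C, hC, hb⟩ := aeval_growth N P (k + 1) hP
  refine ⟨C, hC, fun t ht x => ?_⟩
  have h0 : 0 < |t| := by linarith
  have := hb t ht x
  rw [norm_smul, norm_inv, norm_pow, Real.norm_eq_abs, inv_mul_le_iff₀ (by positivity)]
  rw [pow_succ] at this
  have h2 : ‖(aeval (t • N) P) x‖ * |t| ≤ (|t| ^ k * (C * ‖x‖)) * |t| := by linarith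
  exact le_of_mul_le_mul_right h2 h0

/-- forward / backward prolongational boundedness -/
def FwL (A : E →L[ℝ] E) (V : Submodule ℝ E) (l : Filter ℝ) (x : E) : Prop :=
  ∃ (xs : ℕ → E) (ts : ℕ → ℝ) (M : ℝ), (∀ n, xs n ∈ V) ∧ Tendsto xs atTop (𝓝 x) ∧ Tendsto ts atTop l ∧
    ∀ n, ‖fl A (ts n) (xs n)‖ ≤ M

def Zr (A : E →L[ℝ] E) (V : Submodule ℝ E) (y : E) : Prop :=
  ∃ (xs : ℕ → E) (ts : ℕ → ℝ), (∀ n, xs n ∈ V) ∧ Tendsto xs atTop (𝓝 0) ∧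
    Tendsto (fun n => fl A (ts n) (xs n)) atTop (𝓝 y)

variable {A D N : E →L[ℝ] E} {V : Submodule ℝ E}

lemma bdd_of_tendsto {xs : ℕ → E} {x : E} (h : Tendsto xs atTop (𝓝 x)) : ∃ M, ∀ n, ‖xs n‖ ≤ M := by
  obtain ⟨M, hM⟩ := (Metric.isBounded_range_of_tendsto xs h).exists_norm_le
  exact ⟨M, fun n => hM _ ⟨n, rfl⟩⟩

lemma core1_of_fw (h : JC A D N) (hN : ∀ x ∈ V, N x ∈ V) (hC : V ≤ CC D) {x : E}
    {xs : ℕ → E} {ts : ℕ → ℝ} {M : ℝ} (h1 : ∀ n, xs n ∈ V) (h2 : Tendsto xs atTop (𝓝 x))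
    (h3 : Tendsto (fun n => |ts n|) atTop atTop) (h4 : ∀ n, ‖fl A (ts n) (xs n)‖ ≤ M) : x ∈ Core1 N V := by
  have hcl : ∀ W : Submodule ℝ E, IsClosed (W : Set E) := fun W => W.closed_of_finiteDimensional
  have hxV : x ∈ V := (hcl V).mem_of_tendsto h2 (Eventually.of_forall h1)
  obtain ⟨K, hK, hb⟩ := CC_bound D
  refine Core1_of hN h.nil hxV fun k => ?_
  obtain ⟨m, hm⟩ := h.nil
  obtain ⟨P, Q, hP, hQ, hdvd⟩ := padeB k (m + 2 * k) (by omega)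
  have hm' : N ^ (m + 2 * k) = 0 := by rw [pow_add, hm, zero_mul]
  obtain ⟨M', hM'⟩ := bdd_of_tendsto h2
  have e1 := aeval_small N P k hP ts h3 xs M' hM'
  have hy : ∀ n, ‖fl N (ts n) (xs n)‖ ≤ K * M := by
    intro n
    have h5 := hb (fl A (ts n) (xs n)) (CC_inv D _ (h.fl_commD _) (hC (h1 n))) (-ts n)
    rw [h.fl, fl_neg_apply, ← h.fl] at h5
    exact h5.trans (by gcongr; exact h4 n)
  have e2 := aeval_small N Q k hQ ts h3 (fun n => fl N (ts n) (xs n)) (K * M) hy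
  have e3 : Tendsto (fun n => (N ^ k) (xs n)) atTop (𝓝 ((N ^ k) x)) := ((N ^ k).continuous.tendsto x).comp h2
  have e4 := (e1.sub e2).sub e3
  simp only [sub_zero, zero_sub] at e4
  have : -(N ^ k) x ∈ Im N V (2 * k) := by
    refine (hcl _).mem_of_tendsto e4 ?_
    filter_upwards [h3.eventually_ge_atTop 1] with n hn
    have hne : ts n ≠ 0 := by
      intro h0; rw [h0] at hn; norm_num at hn
    have h6 := aeval_dvd_mem hN (ts n) _ _ hdvd (h1 n)
    rw [map_sub, map_sub, map_mul, map_pow, aeval_X, _root_.smul_pow] at h6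
    simp only [ContinuousLinearMap.sub_apply, ContinuousLinearMap.mul_apply, ContinuousLinearMap.smul_apply, aeval_eT _ hm'] at h6
    have h7 := Submodule.smul_mem _ ((ts n) ^ k)⁻¹ h6
    rw [smul_sub, smul_sub, smul_smul, inv_mul_cancel₀ (pow_ne_zero k hne), one_smul] at h7
    exact h7
  simpa using this

lemma core0_of_zr (h : JC A D N) (hD : ∀ x ∈ V, D x ∈ V) (hN : ∀ x ∈ V, N x ∈ V) (hC : V ≤ CC D) {y : E}
    (hy : Zr A V y) : y ∈ Core0 N V := by
  obtain ⟨xs, ts, h1, h2, h4⟩ := hy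
  have hA : ∀ x ∈ V, A x ∈ V := fun x hx => by rw [h.sum]; exact V.add_mem (hD x hx) (hN x hx)
  by_cases h3 : Tendsto (fun n => |ts n|) atTop atTop
  · have hcl : ∀ W : Submodule ℝ E, IsClosed (W : Set E) := fun W => W.closed_of_finiteDimensional
    have hyV : y ∈ V := (hcl V).mem_of_tendsto h4 (Eventually.of_forall fun n => fl_mem A V hA _ _ (h1 n))
    obtain ⟨K, hK, hb⟩ := CC_bound D
    refine Core0_of hN h.nil hyV fun k => ?_
    obtain ⟨m, hm⟩ := h.nil
    obtain ⟨P, Q, hP, hQ, hdvd⟩ := padeA k (m + (2 * k + 1)) (by omega)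
    have hm' : N ^ (m + (2 * k + 1)) = 0 := by rw [pow_add, hm, zero_mul]
    obtain ⟨M', hM'⟩ := bdd_of_tendsto h4
    obtain ⟨C, hC0, hbC⟩ := aeval_bdd N P k hP
    have e1 : Tendsto (fun n => ((ts n) ^ k)⁻¹ • (aeval (ts n • N) P) (fl D (ts n) (xs n))) atTop (𝓝 0) := by
      have h5 : Tendsto (fun n => C * (K * ‖xs n‖)) atTop (𝓝 0) := by
        simpa using ((tendsto_zero_iff_norm_tendsto_zero.1 h2).const_mul K).const_mul C
      refine squeeze_zero_norm' ?_ h5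
      filter_upwards [h3.eventually_ge_atTop 1] with n hn
      refine (hbC _ hn _).trans ?_
      gcongr
      exact hb _ (hC (h1 n)) _
    have e2 := aeval_small N Q k hQ ts h3 (fun n => fl A (ts n) (xs n)) M' hM'
    have e3 : Tendsto (fun n => (N ^ k) (fl A (ts n) (xs n))) atTop (𝓝 ((N ^ k) y)) :=
      ((N ^ k).continuous.tendsto y).comp h4
    have e4 := e1.sub (e3.add e2)
    simp only [add_zero, zero_sub] at e4
    have : -(N ^ k) y ∈ Im N V (2 * k + 1) := by
      refine (hcl _).mem_of_tendsto e4 ?_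
      filter_upwards [h3.eventually_ge_atTop 1] with n hn
      have hne : ts n ≠ 0 := by
        intro h0; rw [h0] at hn; norm_num at hn
      have h6 := aeval_dvd_mem hN (ts n) _ _ hdvd (fl_mem D V hD (ts n) _ (h1 n))
      rw [map_sub, map_mul, map_add, map_pow, aeval_X, _root_.smul_pow] at h6
      simp only [ContinuousLinearMap.sub_apply, ContinuousLinearMap.mul_apply, ContinuousLinearMap.add_apply,
        ContinuousLinearMap.smul_apply, aeval_eT _ hm'] at h6
      rw [fl_comm_fl D N h.comm, ← h.fl] at h6
      have h7 := Submodule.smul_mem _ ((ts n) ^ k)⁻¹ h6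
      rw [smul_sub, smul_add, smul_smul _ (ts n ^ k), inv_mul_cancel₀ (pow_ne_zero k hne), one_smul] at h7
      exact h7
    simpa using this
  · rw [tendsto_atTop] at h3
    push Not at h3
    obtain ⟨T, hT⟩ := h3
    have h5 : ∃ᶠ n in atTop, |ts n| ≤ T := hT.mono fun n hn => hn.le
    obtain ⟨M, hM⟩ := (isCompact_Icc (a := -T) (b := T)).exists_bound_of_continuousOn
      (f := fun t => fl A t) ((fl_analytic A).continuousOn.mono (Set.subset_univ _))
    have h6 : Tendsto (fun n => M * ‖xs n‖) atTop (𝓝 0) := by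
      simpa using (tendsto_zero_iff_norm_tendsto_zero.1 h2).const_mul M
    have h7 : ∃ᶠ n in atTop, ‖fl A (ts n) (xs n)‖ ≤ M * ‖xs n‖ := by
      refine h5.mono fun n hn => ?_
      refine (ContinuousLinearMap.le_opNorm _ _).trans ?_
      gcongr
      exact hM _ (abs_le.1 hn)
    have hy0 : y = 0 := by
      by_contra hy
      have hy1 : 0 < ‖y‖ := norm_pos_iff.2 hy
      have e1 := h4.norm.eventually_const_lt (half_lt_self hy1)
      have e2 := h6.eventually_lt_const (half_pos hy1)
      obtain ⟨n, hn, h8, h9⟩ := (h7.and_eventually (e1.and e2)).exists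
      linarith
    rw [hy0]; exact Submodule.zero_mem _

lemma fw_of_core1 (h : JC A D N) (hN : ∀ x ∈ V, N x ∈ V) (hC : V ≤ CC D) (σ : ℝ) (hσ : |σ| = 1) {x : E}
    (hx : x ∈ Core1 N V) : ∃ (xs : ℕ → E) (M : ℝ), (∀ n, xs n ∈ V) ∧ Tendsto xs atTop (𝓝 x) ∧
    ∀ n : ℕ, ‖fl A (σ * (n + 1)) (xs n)‖ ≤ M := by
  let W : Submodule ℝ E :=
    { carrier := {x | ∃ (xs : ℕ → E) (M : ℝ), (∀ n, xs n ∈ V) ∧ Tendsto xs atTop (𝓝 x) ∧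
        ∀ n : ℕ, ‖fl A (σ * (n + 1)) (xs n)‖ ≤ M}
      zero_mem' := ⟨fun _ => 0, 0, fun _ => V.zero_mem, tendsto_const_nhds, fun n => by simp⟩
      add_mem' := by
        rintro x y ⟨xs, M, h1, h2, h3⟩ ⟨ys, M', h1', h2', h3'⟩
        refine ⟨fun n => xs n + ys n, M + M', fun n => V.add_mem (h1 n) (h1' n), h2.add h2', fun n => ?_⟩
        rw [map_add]
        exact (norm_add_le _ _).trans (add_le_add (h3 n) (h3' n))
      smul_mem' := by
        rintro c x ⟨xs, M, h1, h2, h3⟩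
        refine ⟨fun n => c • xs n, |c| * M, fun n => V.smul_mem _ (h1 n), h2.const_smul c, fun n => ?_⟩
        rw [map_smul, norm_smul, Real.norm_eq_abs]
        exact mul_le_mul_of_nonneg_left (h3 n) (abs_nonneg _) }
  suffices hW : Core1 N V ≤ W from hW hx
  refine iSup_le fun k => ?_
  rintro _ ⟨hk, z, hz, rfl⟩
  obtain ⟨K, hK, hb⟩ := CC_bound D
  obtain ⟨m, hm⟩ := h.nil
  obtain ⟨P, Q, hP, hQ, hdvd⟩ := padeA k (m + (2 * k + 1)) (by omega)
  have hm' : N ^ (m + (2 * k + 1)) = 0 := by rw [pow_add, hm, zero_mul]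
  obtain ⟨C, hC0, hbC⟩ := aeval_bdd N P k hP
  set ts : ℕ → ℝ := fun n => σ * (n + 1) with hts
  have habs : ∀ n, |ts n| = n + 1 := fun n => by
    rw [hts]; simp only [abs_mul, hσ, one_mul]; exact abs_of_nonneg (by positivity)
  have ht1 : ∀ n, 1 ≤ |ts n| := fun n => by rw [habs]; linarith [(Nat.cast_nonneg n : (0:ℝ) ≤ n)]
  have hne : ∀ n, ts n ≠ 0 := fun n h0 => by have := ht1 n; rw [h0] at this; norm_num at this
  have htt : Tendsto (fun n => |ts n|) atTop atTop := by
    simp only [habs]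
    exact tendsto_atTop_add_const_right _ _ tendsto_natCast_atTop_atTop
  have hsm : ∀ t : ℝ, ∀ x ∈ V, (t • N) x ∈ V := fun t x hx => V.smul_mem _ (hN x hx)
  refine ⟨fun n => (N ^ k) z + ((ts n) ^ k)⁻¹ • (aeval (ts n • N) Q) z, K * (C * ‖z‖), fun n => ?_, ?_, fun n => ?_⟩
  · exact V.add_mem (pow_mem hN k hz) (V.smul_mem _ (aeval_mem (hsm _) Q hz))
  · have := aeval_small N Q k hQ ts htt (fun _ => z) ‖z‖ (fun _ => le_rfl)
    have h2 := (tendsto_const_nhds (x := (N ^ k) z)).add this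
    rw [add_zero] at h2; exact h2
  · change ‖fl A (ts n) _‖ ≤ _
    have hzero : (N ^ (2 * k + 1)) z = 0 := by
      have : (N ^ (k + 1)) ((N ^ k) z) = 0 := hk
      rw [← pow_add_apply] at this
      rw [← this]; congr 2; ring
    have h6 : (aeval (ts n • N) (P - (X ^ k + Q) * eT (m + (2 * k + 1)))) z = 0 := by
      obtain ⟨W, hW⟩ := hdvd
      rw [hW, mul_comm, map_mul, map_pow, aeval_X, _root_.smul_pow, ContinuousLinearMap.mul_apply,
        ContinuousLinearMap.smul_apply, hzero, smul_zero, map_zero]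
    rw [mul_comm, map_sub, map_mul, map_add, map_pow, aeval_X, _root_.smul_pow] at h6
    simp only [ContinuousLinearMap.sub_apply, ContinuousLinearMap.mul_apply, ContinuousLinearMap.add_apply,
        ContinuousLinearMap.smul_apply, aeval_eT _ hm'] at h6
    have h7 := congrArg (fun v => ((ts n) ^ k)⁻¹ • v) (sub_eq_zero.1 h6)
    beta_reduce at h7
    rw [← map_smul (fl N (ts n)), smul_add, smul_smul, inv_mul_cancel₀ (pow_ne_zero k (hne n)), one_smul] at h7
    rw [h.fl]
    change ‖fl D (ts n) (fl N (ts n) ((N ^ k) z + _))‖ ≤ _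
    rw [← h7]
    refine (hb _ (hC (V.smul_mem _ (aeval_mem (hsm _) P hz))) _).trans ?_
    gcongr
    exact hbC _ (ht1 n) z

lemma zr_of_core0 (h : JC A D N) (hD : ∀ x ∈ V, D x ∈ V) (hN : ∀ x ∈ V, N x ∈ V) (hC : V ≤ CC D) {y : E}
    (hy : y ∈ Core0 N V) : Zr A V y := by
  let W : Submodule ℝ E :=
    { carrier := {x | ∃ (xs : ℕ → E), (∀ n, xs n ∈ V) ∧ Tendsto xs atTop (𝓝 0) ∧
        Tendsto (fun n : ℕ => fl A (n + 1) (xs n)) atTop (𝓝 x)}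
      zero_mem' := ⟨fun _ => 0, fun _ => V.zero_mem, tendsto_const_nhds, by simp⟩
      add_mem' := by
        rintro x y ⟨xs, h1, h2, h3⟩ ⟨ys, h1', h2', h3'⟩
        refine ⟨fun n => xs n + ys n, fun n => V.add_mem (h1 n) (h1' n), by simpa using h2.add h2', ?_⟩
        simp only [map_add]
        exact h3.add h3'
      smul_mem' := by
        rintro c x ⟨xs, h1, h2, h3⟩
        refine ⟨fun n => c • xs n, fun n => V.smul_mem _ (h1 n), by simpa using h2.const_smul c, ?_⟩
        simp only [map_smul]
        exact h3.const_smul c }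
  suffices hW : Core0 N V ≤ W by
    obtain ⟨xs, h1, h2, h3⟩ := hW hy
    exact ⟨xs, fun n => n + 1, h1, h2, h3⟩
  refine iSup_le fun k => ?_
  rintro _ ⟨hk, z, hz, rfl⟩
  obtain ⟨K, hK, hb⟩ := CC_bound D
  obtain ⟨m, hm⟩ := h.nil
  obtain ⟨P, Q, hP, hQ, hdvd⟩ := padeB k (m + (2 * k)) (by omega)
  have hm' : N ^ (m + (2 * k)) = 0 := by rw [pow_add, hm, zero_mul]
  set ts : ℕ → ℝ := fun n => (n + 1) with hts
  have habs : ∀ n, |ts n| = n + 1 := fun n => abs_of_nonneg (by rw [hts]; positivity)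
  have hne : ∀ n, ts n ≠ 0 := fun n => by rw [hts]; positivity
  have htt : Tendsto (fun n => |ts n|) atTop atTop := by
    simp only [habs]
    exact tendsto_atTop_add_const_right _ _ tendsto_natCast_atTop_atTop
  have hsm : ∀ t : ℝ, ∀ x ∈ V, (t • N) x ∈ V := fun t x hx => V.smul_mem _ (hN x hx)
  have hmem : ∀ n, (aeval (ts n • N) Q) z ∈ V := fun n => aeval_mem (hsm _) Q hz
  have e1 := aeval_small N Q k hQ ts htt (fun _ => z) ‖z‖ (fun _ => le_rfl)
  have e2 := aeval_small N P k hP ts htt (fun _ => z) ‖z‖ (fun _ => le_rfl)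
  refine ⟨fun n => fl D (-ts n) (-(((ts n) ^ k)⁻¹ • (aeval (ts n • N) Q) z)), fun n => ?_, ?_, ?_⟩
  · exact fl_mem D V hD _ _ (V.neg_mem (V.smul_mem _ (hmem n)))
  · have h5 := (tendsto_zero_iff_norm_tendsto_zero.1 e1).const_mul K
    rw [mul_zero] at h5
    refine squeeze_zero_norm (fun n => ?_) h5
    refine (hb _ (hC (V.neg_mem (V.smul_mem _ (hmem n)))) _).trans ?_
    rw [norm_neg]
  · have h5 := (tendsto_const_nhds (x := (N ^ k) z)).sub e2
    rw [sub_zero] at h5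
    refine h5.congr fun n => ?_
    change _ = fl A (ts n) (fl D (-ts n) _)
    have hzero : (N ^ (2 * k)) z = 0 := by
      have : (N ^ k) ((N ^ k) z) = 0 := hk
      rw [← pow_add_apply] at this
      rw [← this]; congr 2; ring
    have h6 : (aeval (ts n • N) (P - Q * eT (m + (2 * k)) - X ^ k)) z = 0 := by
      obtain ⟨W, hW⟩ := hdvd
      rw [hW, mul_comm, map_mul, map_pow, aeval_X, _root_.smul_pow, ContinuousLinearMap.mul_apply,
        ContinuousLinearMap.smul_apply, hzero, smul_zero, map_zero]
    rw [mul_comm Q, map_sub, map_sub, map_mul, map_pow, aeval_X, _root_.smul_pow] at h6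
    simp only [ContinuousLinearMap.sub_apply, ContinuousLinearMap.mul_apply,
        ContinuousLinearMap.smul_apply, aeval_eT _ hm'] at h6
    have h7 := congrArg (fun v => ((ts n) ^ k)⁻¹ • v) h6
    simp only [smul_zero, smul_sub] at h7
    rw [smul_smul _ (ts n ^ k), inv_mul_cancel₀ (pow_ne_zero k (hne n)), one_smul, ← map_smul (fl N (ts n))] at h7
    rw [h.fl, fl_comm_fl D N h.comm, fl_apply_neg, map_neg]
    rw [sub_sub, sub_eq_zero] at h7
    rw [h7]; abel

end CoreDyn

end M4c_part

section M5_part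

section Transport
variable {E : Type*} [NormedAddCommGroup E] [NormedSpace ℝ E] [FiniteDimensional ℝ E] [CompleteSpace E]
variable {A D N B D' N' : E →L[ℝ] E} {V V' : Submodule ℝ E} {h : E ≃ₜ E}

lemma mono_limit (τs : ℕ → ℝ → ℝ) (τ : ℝ → ℝ) (ts : ℕ → ℝ) (h0 : ∀ n, τs n 0 = 0)
    (hm : ∀ n, StrictMono (τs n) ∨ StrictAnti (τs n)) (hlim : ∀ b, Tendsto (fun n => τs n b) atTop (𝓝 (τ b)))
    (hτ : StrictMono τ) (hτs : Function.Surjective τ) (hτ0 : τ 0 = 0) (ht : Tendsto ts atTop atTop) :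
    Tendsto (fun n => τs n (ts n)) atTop atTop := by
  rw [tendsto_atTop]
  intro c
  obtain ⟨b, hb⟩ := hτs (max c 1 + 1)
  have hb0 : 0 < b := by
    rw [← hτ.lt_iff_lt, hτ0, hb]; have := le_max_right c 1; linarith
  have e1 := (hlim b).eventually_const_lt (show max c 1 < τ b by rw [hb]; linarith)
  filter_upwards [e1, ht.eventually_ge_atTop b] with n hn hn'
  rcases hm n with hmn | hmn
  · have := hmn.monotone hn'
    have := le_max_left c 1
    linarith
  · have := hmn hb0
    rw [h0] at this
    have := le_max_right c 1
    linarith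

lemma img_bdd (h : E ≃ₜ E) (M : ℝ) : ∃ M', ∀ x, ‖x‖ ≤ M → ‖h x‖ ≤ M' := by
  obtain ⟨M', hM'⟩ := (isCompact_closedBall (0 : E) M).exists_bound_of_continuousOn h.continuous.continuousOn
  exact ⟨M', fun x hx => hM' x (by simpa using hx)⟩

lemma fw_const (V : Submodule ℝ E) {x : E} (hx : x ∈ V) (hA : A x = 0) :
    FwL A V atTop x ∧ FwL A V atBot x :=
  ⟨⟨fun _ => x, fun n => n, ‖x‖, fun _ => hx, tendsto_const_nhds, tendsto_natCast_atTop_atTop, fun n => by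
    simp only [(fl_fixed_iff A x).1 hA, le_refl]⟩,
   ⟨fun _ => x, fun n => -n, ‖x‖, fun _ => hx, tendsto_const_nhds,
    tendsto_neg_atTop_atBot.comp tendsto_natCast_atTop_atTop, fun n => by
    simp only [(fl_fixed_iff A x).1 hA, le_refl]⟩⟩

lemma fw_transport_aux (H : OrbEq A B h) (hV : ∀ x, x ∈ V ↔ h x ∈ V') {x : E} (hA : A x ≠ 0) {l l' : Filter ℝ}
    (hl : ∀ (τs : ℕ → ℝ → ℝ) (ts : ℕ → ℝ), (∀ n, τs n 0 = 0) → (∀ n, StrictMono (τs n) ∨ StrictAnti (τs n)) →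
      (∀ b, Tendsto (fun n => τs n b) atTop (𝓝 (lft A B h x b))) → Tendsto ts atTop l →
      Tendsto (fun n => τs n (ts n)) atTop l')
    (hf : FwL A V l x) : FwL B V' l' (h x) := by
  obtain ⟨xs, ts, M, h1, h2, h3, h4⟩ := hf
  have hne : ∀ᶠ n in atTop, A (xs n) ≠ 0 := h2.eventually (A.continuous.continuousAt.eventually_ne hA)
  obtain ⟨n0, hn0⟩ := eventually_atTop.1 hne
  obtain ⟨M', hM'⟩ := img_bdd h M
  have hs : Tendsto (fun n : ℕ => n + n0) atTop atTop := tendsto_add_atTop_nat n0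
  have hn : ∀ n, A (xs (n + n0)) ≠ 0 := fun n => hn0 _ (by omega)
  refine ⟨fun n => h (xs (n + n0)), fun n => lft A B h (xs (n + n0)) (ts (n + n0)), M', fun n => (hV _).1 (h1 _),
    (h.continuous.tendsto x).comp (h2.comp hs), ?_, fun n => ?_⟩
  · exact hl (fun n => lft A B h (xs (n + n0))) (fun n => ts (n + n0)) (fun n => H.lft_zero (hn n))
      (fun n => H.lft_mono (hn n)) (fun b => Tendsto.comp (H.lft_stable hA b) (h2.comp hs)) (h3.comp hs)
  · rw [← H.lft_eq (hn n)]
    exact hM' _ (h4 _)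

lemma fw_transport (H : OrbEq A B h) (hV : ∀ x, x ∈ V ↔ h x ∈ V') {x : E}
    (hf : FwL A V atTop x ∧ FwL A V atBot x) : FwL B V' atTop (h x) ∧ FwL B V' atBot (h x) := by
  have hxV : x ∈ V := by
    obtain ⟨xs, ts, M, h1, h2, -⟩ := hf.1
    exact V.closed_of_finiteDimensional.mem_of_tendsto h2 (Eventually.of_forall h1)
  by_cases hA : A x = 0
  · exact fw_const V' ((hV x).1 hxV) (H.fixed_iff.2 hA)
  have hz := H.lft_zero hA
  have hsu := H.lft_surj hA
  have hnn : ∀ f : ℝ → ℝ, StrictMono f ∨ StrictAnti f → StrictMono (fun t => - f t) ∨ StrictAnti (fun t => - f t) := by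
    rintro f (hf | hf)
    · exact Or.inr fun a b hab => neg_lt_neg (hf hab)
    · exact Or.inl fun a b hab => neg_lt_neg (hf hab)
  have hnr : ∀ f : ℝ → ℝ, StrictMono f ∨ StrictAnti f → StrictMono (fun t => f (-t)) ∨ StrictAnti (fun t => f (-t)) := by
    rintro f (hf | hf)
    · exact Or.inr fun a b hab => hf (neg_lt_neg hab)
    · exact Or.inl fun a b hab => hf (neg_lt_neg hab)
  have hsn : Function.Surjective (fun t => - lft A B h x t) := fun s => by
    obtain ⟨t, ht⟩ := hsu (-s); exact ⟨t, by simp [ht]⟩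
  have hsr : Function.Surjective (fun t => lft A B h x (-t)) := fun s => by
    obtain ⟨t, ht⟩ := hsu s; exact ⟨-t, by simp [ht]⟩
  have hsnr : Function.Surjective (fun t => -lft A B h x (-t)) := fun s => by
    obtain ⟨t, ht⟩ := hsn s; exact ⟨-t, by simpa using ht⟩
  rcases H.lft_mono hA with hm | hm
  · refine ⟨fw_transport_aux H hV hA ?_ hf.1, fw_transport_aux H hV hA ?_ hf.2⟩
    · intro τs ts h0 h1 h2 h3
      exact mono_limit τs _ ts h0 h1 h2 hm hsu hz h3
    · intro τs ts h0 h1 h2 h3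
      have := mono_limit (fun n t => -τs n (-t)) (fun t => -lft A B h x (-t)) (fun n => - ts n) (fun n => by simp [h0])
        (fun n => hnn _ (hnr _ (h1 n))) (fun b => (h2 (-b)).neg) (fun a b hab => neg_lt_neg (hm (neg_lt_neg hab)))
        hsnr (by simp [hz]) (tendsto_neg_atBot_atTop.comp h3)
      simp only [neg_neg] at this
      exact tendsto_neg_atTop_iff.1 this
  · refine ⟨fw_transport_aux H hV hA ?_ hf.2, fw_transport_aux H hV hA ?_ hf.1⟩
    · intro τs ts h0 h1 h2 h3
      have := mono_limit (fun n t => τs n (-t)) (fun t => lft A B h x (-t)) (fun n => - ts n) (fun n => by simp [h0])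
        (fun n => (hnr _ (h1 n))) (fun b => (h2 (-b))) (fun a b hab => (hm (neg_lt_neg hab)))
        hsr (by simp [hz]) (tendsto_neg_atBot_atTop.comp h3)
      simpa only [neg_neg] using this
    · intro τs ts h0 h1 h2 h3
      have := mono_limit (fun n t => -τs n t) (fun t => -lft A B h x t) ts (fun n => by simp [h0])
        (fun n => hnn _ (h1 n)) (fun b => (h2 b).neg) (fun a b hab => neg_lt_neg (hm hab))
        hsn (by simp [hz]) h3
      exact tendsto_neg_atTop_iff.1 this

lemma zr_transport (H : OrbEq A B h) (h0 : h 0 = 0) (hV : ∀ x, x ∈ V ↔ h x ∈ V') {y : E} (hy : Zr A V y) :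
    Zr B V' (h y) := by
  obtain ⟨xs, ts, h1, h2, h3⟩ := hy
  choose ss hss using fun n => (H (xs n) (fl A (ts n) (xs n))).1 ⟨ts n, rfl⟩
  refine ⟨fun n => h (xs n), ss, fun n => (hV _).1 (h1 n), ?_, ?_⟩
  · have := (h.continuous.tendsto 0).comp h2
    rwa [h0] at this
  · have := (h.continuous.tendsto y).comp h3
    exact this.congr fun n => hss n

lemma mem_core1_iff (J : JC A D N) (hN : ∀ x ∈ V, N x ∈ V) (hC : V ≤ CC D) {x : E} :
    x ∈ Core1 N V ↔ FwL A V atTop x ∧ FwL A V atBot x := by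
  constructor
  · intro hx
    obtain ⟨xs, M, h1, h2, h3⟩ := fw_of_core1 J hN hC 1 (by simp) hx
    obtain ⟨xs', M', h1', h2', h3'⟩ := fw_of_core1 J hN hC (-1) (by simp) hx
    have ht : Tendsto (fun n : ℕ => (1:ℝ) * (n + 1)) atTop atTop := by
      simp only [one_mul]
      exact tendsto_atTop_add_const_right _ _ tendsto_natCast_atTop_atTop
    refine ⟨⟨xs, _, M, h1, h2, ht, h3⟩, xs', _, M', h1', h2', ?_, h3'⟩
    have := tendsto_neg_atTop_atBot.comp ht
    refine this.congr fun n => by simp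
  · rintro ⟨⟨xs, ts, M, h1, h2, h3, h4⟩, -⟩
    exact core1_of_fw J hN hC h1 h2 (tendsto_abs_atTop_atTop.comp h3) h4

lemma mem_core0_iff (J : JC A D N) (hD : ∀ x ∈ V, D x ∈ V) (hN : ∀ x ∈ V, N x ∈ V) (hC : V ≤ CC D) {x : E} :
    x ∈ Core0 N V ↔ Zr A V x :=
  ⟨zr_of_core0 J hD hN hC, core0_of_zr J hD hN hC⟩

lemma JC.projS_zero (J : JC A D N) {xs : ℕ → E} {ts : ℕ → ℝ} {M : ℝ} (h1 : ∀ n, xs n ∈ SS D)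
    (h3 : Tendsto ts atTop atBot) (h4 : ∀ n, ‖LF.fl A (ts n) (xs n)‖ ≤ M) : Tendsto xs atTop (𝓝 0) := by
  obtain ⟨a, K, ha, hK, hb⟩ := J.boundS
  have e : Tendsto (fun n => K * Real.exp (-(a * (-ts n))) * M) atTop (𝓝 0) := by
    have : Tendsto (fun n => Real.exp (-(a * (-ts n)))) atTop (𝓝 0) := by
      refine Real.tendsto_exp_atBot.comp ?_
      simp only [mul_neg, neg_neg]
      exact h3.const_mul_atBot ha
    simpa using (this.const_mul K).mul_const M
  refine squeeze_zero_norm' ?_ e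
  filter_upwards [h3.eventually_le_atBot 0] with n hn
  have := hb (LF.fl A (ts n) (xs n)) (SS_inv D _ (J.fl_commD _) (h1 n)) (-ts n) (by linarith)
  rw [fl_neg_apply] at this
  refine this.trans ?_
  gcongr
  exact h4 n

lemma JC.projU_zero (J : JC A D N) {xs : ℕ → E} {ts : ℕ → ℝ} {M : ℝ} (h1 : ∀ n, xs n ∈ UU D)
    (h3 : Tendsto ts atTop atTop) (h4 : ∀ n, ‖LF.fl A (ts n) (xs n)‖ ≤ M) : Tendsto xs atTop (𝓝 0) := by
  refine J.neg.projS_zero h1 (ts := fun n => -ts n) (M := M) (tendsto_neg_atTop_atBot.comp h3) fun n => ?_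
  rw [fl_neg, neg_neg]; exact h4 n

lemma mem_core1_top (J : JC A D N) {x : E} :
    x ∈ Core1 N (CC D) ↔ FwL A ⊤ atTop x ∧ FwL A ⊤ atBot x := by
  have hN : ∀ x ∈ CC D, N x ∈ CC D := fun x hx => CC_inv D N J.comm hx
  rw [mem_core1_iff J hN le_rfl]
  constructor
  · rintro ⟨⟨xs, ts, M, h1, h2⟩, ⟨xs', ts', M', h1', h2'⟩⟩
    exact ⟨⟨xs, ts, M, fun _ => trivial, h2⟩, ⟨xs', ts', M', fun _ => trivial, h2'⟩⟩
  · rintro ⟨⟨xs, ts, M, h1, h2, h3, h4⟩, ⟨xs', ts', M', h1', h2', h3', h4'⟩⟩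
    obtain ⟨PS, PU, PC, a1, a2, a3, a4⟩ := exists_proj D J.ss
    have P : SProj D PS PU PC := ⟨a1, a2, a3, a4⟩
    have hb : ∀ (Q : E →L[ℝ] E) (M : ℝ) (z : E), ‖z‖ ≤ M → ‖Q z‖ ≤ ‖Q‖ * M := fun Q M z hz =>
      (Q.le_opNorm z).trans (by gcongr)
    have hU : PU x = 0 := by
      have e1 : Tendsto (fun n => PU (xs n)) atTop (𝓝 (PU x)) := (PU.continuous.tendsto x).comp h2
      refine tendsto_nhds_unique e1 (J.projU_zero (fun n => P.memU _) h3 (M := ‖PU‖ * M) fun n => ?_)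
      rw [← (P.comm (fl A (ts n)) (J.fl_commD _) _).2.1]
      exact hb _ _ _ (h4 n)
    have hS : PS x = 0 := by
      have e1 : Tendsto (fun n => PS (xs' n)) atTop (𝓝 (PS x)) := (PS.continuous.tendsto x).comp h2'
      refine tendsto_nhds_unique e1 (J.projS_zero (fun n => P.memS _) h3' (M := ‖PS‖ * M') fun n => ?_)
      rw [← (P.comm (fl A (ts' n)) (J.fl_commD _) _).1]
      exact hb _ _ _ (h4' n)
    have hx : PC x = x := by
      have := P.sum x
      rw [hU, hS] at this
      simpa using this
    have e : ∀ {xs : ℕ → E}, Tendsto xs atTop (𝓝 x) → Tendsto (fun n => PC (xs n)) atTop (𝓝 x) := fun {xs} hxs => by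
      have := (PC.continuous.tendsto x).comp hxs
      rwa [hx] at this
    refine ⟨⟨fun n => PC (xs n), ts, ‖PC‖ * M, fun n => P.memC _, e h2, h3, fun n => ?_⟩,
      ⟨fun n => PC (xs' n), ts', ‖PC‖ * M', fun n => P.memC _, e h2', h3', fun n => ?_⟩⟩
    · rw [← (P.comm (fl A (ts n)) (J.fl_commD _) _).2.2]
      exact hb _ _ _ (h4 n)
    · rw [← (P.comm (fl A (ts' n)) (J.fl_commD _) _).2.2]
      exact hb _ _ _ (h4' n)

lemma mem_core0_top (J : JC A D N) {x : E} :
    x ∈ Core0 N (CC D) ↔ x ∈ Core1 N (CC D) ∧ Zr A ⊤ x := by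
  have hN : ∀ x ∈ CC D, N x ∈ CC D := fun x hx => CC_inv D N J.comm hx
  have hD : ∀ x ∈ CC D, D x ∈ CC D := fun x hx => CC_inv D D (fun _ => rfl) hx
  rw [mem_core0_iff J hD hN le_rfl]
  constructor
  · intro hz
    refine ⟨Core0_le_Core1 (core0_of_zr J hD hN le_rfl hz), ?_⟩
    obtain ⟨xs, ts, h1, h2⟩ := hz
    exact ⟨xs, ts, fun _ => trivial, h2⟩
  · rintro ⟨hx1, xs, ts, h1, h2, h3⟩
    obtain ⟨PS, PU, PC, a1, a2, a3, a4⟩ := exists_proj D J.ss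
    have P : SProj D PS PU PC := ⟨a1, a2, a3, a4⟩
    have hx : PC x = x := (P.onC (Core1_le hN hx1)).2.2
    refine ⟨fun n => PC (xs n), ts, fun n => P.memC _, ?_, ?_⟩
    · have := (PC.continuous.tendsto 0).comp h2
      rw [map_zero] at this; exact this
    · have := (PC.continuous.tendsto x).comp h3
      rw [hx] at this
      exact this.congr fun n => (P.comm (fl A (ts n)) (J.fl_commD _) _).2.2

lemma iff_of_two (H : OrbEq A B h) {P Q : E → Prop} (h1 : ∀ x, P x → Q (h x)) (h2 : ∀ x, Q x → P (h.symm x)) (x : E) :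
    P x ↔ Q (h x) := ⟨h1 x, fun hq => by simpa using h2 _ hq⟩

lemma core1_map (H : OrbEq A B h) (J : JC A D N) (J' : JC B D' N') (hN : ∀ x ∈ V, N x ∈ V)
    (hN' : ∀ x ∈ V', N' x ∈ V') (hC : V ≤ CC D) (hC' : V' ≤ CC D') (hV : ∀ x, x ∈ V ↔ h x ∈ V') (x : E) :
    x ∈ Core1 N V ↔ h x ∈ Core1 N' V' := by
  rw [mem_core1_iff J hN hC, mem_core1_iff J' hN' hC']
  refine iff_of_two H (P := fun x => FwL A V atTop x ∧ FwL A V atBot x)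
    (Q := fun x => FwL B V' atTop x ∧ FwL B V' atBot x) (fun x => fw_transport H hV) (fun x => fw_transport H.symm ?_) x
  intro y; rw [hV]; simp

lemma core0_map (H : OrbEq A B h) (h0 : h 0 = 0) (J : JC A D N) (J' : JC B D' N') (hN : ∀ x ∈ V, N x ∈ V)
    (hN' : ∀ x ∈ V', N' x ∈ V') (hD : ∀ x ∈ V, D x ∈ V)
    (hD' : ∀ x ∈ V', D' x ∈ V') (hC : V ≤ CC D) (hC' : V' ≤ CC D') (hV : ∀ x, x ∈ V ↔ h x ∈ V') (x : E) :
    x ∈ Core0 N V ↔ h x ∈ Core0 N' V' := by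
  rw [mem_core0_iff J hD hN hC, mem_core0_iff J' hD' hN' hC']
  refine iff_of_two H (P := fun x => Zr A V x)
    (Q := fun x => Zr B V' x) (fun x => zr_transport H h0 hV)
      (fun x => zr_transport H.symm (by rw [h.symm_apply_eq, h0]) ?_) x
  intro y; rw [hV]; simp

lemma core1_map_top (H : OrbEq A B h) (J : JC A D N) (J' : JC B D' N') (x : E) :
    x ∈ Core1 N (CC D) ↔ h x ∈ Core1 N' (CC D') := by
  rw [mem_core1_top J, mem_core1_top J']
  exact iff_of_two H (P := fun x => FwL A ⊤ atTop x ∧ FwL A ⊤ atBot x)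
    (Q := fun x => FwL B ⊤ atTop x ∧ FwL B ⊤ atBot x) (fun x => fw_transport H (by simp))
    (fun x => fw_transport H.symm (by simp)) x

lemma core0_map_top (H : OrbEq A B h) (h0 : h 0 = 0) (J : JC A D N) (J' : JC B D' N') (x : E) :
    x ∈ Core0 N (CC D) ↔ h x ∈ Core0 N' (CC D') := by
  rw [mem_core0_top J, mem_core0_top J', core1_map_top H J J']
  refine and_congr_right fun _ => ?_
  exact iff_of_two H (P := fun x => Zr A ⊤ x)
    (Q := fun x => Zr B ⊤ x) (fun x => zr_transport H h0 (by simp))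
    (fun x => zr_transport H.symm (by rw [h.symm_apply_eq, h0]) (by simp)) x

lemma FF_triv (hV : ∀ x ∈ V, N x ∈ V) (hN0 : ∀ x ∈ V, N x = 0) (j : ℕ) : FF N V j = if j = 0 then V else ⊥ := by
  split_ifs with hj
  · subst hj
    refine le_antisymm (FF_le hV 0) fun x hx => ⟨?_, ?_⟩
    · rw [SetLike.mem_coe, mem_Kr, pow_one]; exact hN0 x hx
    · rw [SetLike.mem_coe, Im_zero]; exact hx
  · rw [eq_bot_iff]
    rintro x ⟨-, z, hz, rfl⟩
    obtain ⟨i, rfl⟩ := Nat.exists_eq_succ_of_ne_zero hj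
    change (N ^ (i + 1)) z ∈ _
    rw [pow_add_apply, pow_one, hN0 z hz, map_zero]
    exact Submodule.zero_mem _

lemma FF_map (H : OrbEq A B h) (h0 : h 0 = 0) (J : JC A D N) (J' : JC B D' N') :
    ∀ (n : ℕ) (V V' : Submodule ℝ E), Module.finrank ℝ V ≤ n → (∀ x ∈ V, N x ∈ V) →
    (∀ x ∈ V', N' x ∈ V') → (∀ x ∈ V, D x ∈ V) → (∀ x ∈ V', D' x ∈ V') → V ≤ CC D → V' ≤ CC D' →
    (∀ x, x ∈ V ↔ h x ∈ V') → ∀ j x, x ∈ FF N V j ↔ h x ∈ FF N' V' j := by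
  intro n
  induction n with
  | zero =>
    intro V V' hn hN hN' hD hD' hC hC' hV j x
    have hVb : V = ⊥ := Submodule.finrank_eq_zero.1 (by omega)
    have hVb' : V' = ⊥ := by
      rw [eq_bot_iff]; intro y hy
      have := (hV (h.symm y)).2 (by simpa using hy)
      rw [hVb, Submodule.mem_bot] at this
      rw [Submodule.mem_bot, ← h0, ← this]; simp
    rw [FF_triv hN (by rw [hVb]; simp), FF_triv hN' (by rw [hVb']; simp)]
    split_ifs
    · exact hV x
    · have := hV x; rw [hVb, hVb'] at this; exact this
  | succ n ih =>
    intro V V' hn hN hN' hD hD' hC hC' hV j x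
    have c1 := core1_map H J J' hN hN' hC hC' hV
    have c0 := core0_map H h0 J J' hN hN' hD hD' hC hC' hV
    by_cases hfull : V ≤ Core1 N V
    · have hfull' : V' ≤ Core1 N' V' := by
        intro y hy
        have := hfull ((hV (h.symm y)).2 (by simpa using hy))
        rw [c1] at this; simpa using this
      rw [FF_triv hN (Core1_eq hN J.nil hfull), FF_triv hN' (Core1_eq hN' J'.nil hfull')]
      split_ifs
      · exact hV x
      · rw [Submodule.mem_bot, Submodule.mem_bot]
        constructor
        · rintro rfl; exact h0
        · intro hx; apply h.injective; rw [hx, h0]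
    · have hlt : Core1 N V < V := lt_of_le_of_ne (Core1_le hN) (fun e => hfull e.ge)
      have hr1 := Submodule.finrank_lt_finrank_of_lt hlt
      have hr0 := Submodule.finrank_mono (Core0_le_Core1 (N := N) (V := V))
      have iN := Core_inv N (fun _ => rfl) hN
      have iN' := Core_inv N' (fun _ => rfl) hN'
      have iD := Core_inv D (fun x => (J.comm x).symm) hD
      have iD' := Core_inv D' (fun x => (J'.comm x).symm) hD'
      rcases Nat.even_or_odd' j with ⟨i, rfl | rfl⟩
      · rw [← FF_core1 hN, ← FF_core1 hN']
        exact ih _ _ (by omega) iN.1 iN'.1 iD.1 iD'.1 ((Core1_le hN).trans hC) ((Core1_le hN').trans hC') c1 i x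
      · rw [← FF_core0 hN, ← FF_core0 hN']
        exact ih _ _ (by omega) iN.2.1 iN'.2.1 iD.2.1 iD'.2.1 ((Core0_le hN).trans hC)
          ((Core0_le hN').trans hC') c0 i x

theorem FF_map_CC (H : OrbEq A B h) (h0 : h 0 = 0) (J : JC A D N) (J' : JC B D' N') (j : ℕ) (x : E) :
    x ∈ FF N (CC D) j ↔ h x ∈ FF N' (CC D') j := by
  have hN : ∀ x ∈ CC D, N x ∈ CC D := fun x hx => CC_inv D N J.comm hx
  have hD : ∀ x ∈ CC D, D x ∈ CC D := fun x hx => CC_inv D D (fun _ => rfl) hx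
  have hN' : ∀ x ∈ CC D', N' x ∈ CC D' := fun x hx => CC_inv D' N' J'.comm hx
  have hD' : ∀ x ∈ CC D', D' x ∈ CC D' := fun x hx => CC_inv D' D' (fun _ => rfl) hx
  have iN := Core_inv N (fun _ => rfl) hN
  have iN' := Core_inv N' (fun _ => rfl) hN'
  have iD := Core_inv D (fun x => (J.comm x).symm) hD
  have iD' := Core_inv D' (fun x => (J'.comm x).symm) hD'
  rcases Nat.even_or_odd' j with ⟨i, rfl | rfl⟩
  · rw [← FF_core1 hN, ← FF_core1 hN']
    exact FF_map H h0 J J' _ _ _ le_rfl iN.1 iN'.1 iD.1 iD'.1 (Core1_le hN) (Core1_le hN') (core1_map_top H J J') i x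
  · rw [← FF_core0 hN, ← FF_core0 hN']
    exact FF_map H h0 J J' _ _ _ le_rfl iN.2.1 iN'.2.1 iD.2.1 iD'.2.1 (Core0_le hN) (Core0_le hN')
      (core0_map_top H h0 J J') i x

end Transport

end M5_part

section M6_part

section BoundedFlow
variable {E : Type*} [NormedAddCommGroup E] [NormedSpace ℝ E] [FiniteDimensional ℝ E] [CompleteSpace E]
variable {A D N B D' N' : E →L[ℝ] E} {h : E ≃ₜ E}

lemma SS_CC_zero (D : E →L[ℝ] E) {x : E} (h1 : x ∈ SS D) (h2 : x ∈ CC D) : x = 0 :=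
  (SUC_indep D h1 (Submodule.zero_mem _) ((CC D).neg_mem h2) (by abel)).1

lemma UU_CC_zero (D : E →L[ℝ] E) {x : E} (h1 : x ∈ UU D) (h2 : x ∈ CC D) : x = 0 :=
  (SUC_indep D (Submodule.zero_mem _) h1 ((CC D).neg_mem h2) (by abel)).2.1

lemma CC_exp (D : E →L[ℝ] E) {a : ℝ} {x : E} (hx : x ∈ CC D) (K : ℝ)
    (hb : ∀ t, ‖fl D t x‖ ≤ K * Real.exp (a * t)) : a = 0 ∨ x = 0 := by
  rcases lt_trichotomy a 0 with ha | ha | ha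
  · refine Or.inr (SS_CC_zero D ⟨-a, by linarith, K, fun t _ => ?_⟩ hx)
    simpa using hb t
  · exact Or.inl ha
  · refine Or.inr (UU_CC_zero D ⟨a, ha, K, fun t _ => ?_⟩ hx)
    rw [fl_neg]
    simpa using hb (-t)

lemma CC_eig (D : E →L[ℝ] E) {a : ℝ} {x : E} (hx : x ∈ CC D) (h : D x = a • x) : a = 0 ∨ x = 0 := by
  refine CC_exp D hx ‖x‖ fun t => ?_
  rw [fl_eig D a x h, norm_smul, Real.norm_eq_abs, Real.abs_exp, mul_comm]

lemma CC_eig2 (D : E →L[ℝ] E) {a w : ℝ} (hw : 0 < w) {x : E} (hx : x ∈ CC D)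
    (h : D (D x - a • x) - a • (D x - a • x) = - (w ^ 2) • x) : a = 0 ∨ x = 0 := by
  refine CC_exp D hx (‖x‖ + w⁻¹ * ‖D x - a • x‖) fun t => ?_
  rw [fl_eig2 D a w hw.ne' x h, norm_smul, Real.norm_eq_abs, Real.abs_exp, mul_comm]
  refine mul_le_mul_of_nonneg_right ?_ (Real.exp_pos _).le
  refine (norm_add_le _ _).trans (add_le_add ?_ ?_)
  · rw [norm_smul]
    exact mul_le_of_le_one_left (norm_nonneg _) (Real.abs_cos_le_one _)
  · rw [norm_smul]
    refine mul_le_mul_of_nonneg_right ?_ (norm_nonneg _)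
    rw [norm_div, Real.norm_eq_abs, Real.norm_eq_abs, abs_of_pos hw, div_eq_mul_inv]
    exact mul_le_of_le_one_left (by positivity) (Real.abs_sin_le_one _)

lemma CC_span (hD : Module.End.IsSemisimple (D : E →ₗ[ℝ] E)) {W V : Submodule ℝ E} (hW : W ≤ CC D)
    (hDW : ∀ x ∈ W, D x ∈ W) (h1 : ∀ x ∈ W, D x = 0 → x ∈ V)
    (h2 : ∀ w : ℝ, 0 < w → ∀ x ∈ W, D (D x) = -(w ^ 2) • x → x ∈ V) : W ≤ V := by
  have hp : W ∈ Module.End.invtSubmodule (D : E →ₗ[ℝ] E) := hDW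
  have := semisimple_top _ (hD.restrict hp) (V.comap W.subtype) ?_ ?_
  · intro x hx
    have h3 : (⟨x, hx⟩ : W) ∈ V.comap W.subtype := by rw [this]; trivial
    exact h3
  · rintro a ⟨x, hx⟩ hax
    have hax' : D x = a • x := congrArg Subtype.val hax
    change x ∈ V
    rcases CC_eig D (hW hx) hax' with rfl | rfl
    · exact h1 x hx (by simpa using hax')
    · exact V.zero_mem
  · rintro a w ⟨x, hx⟩ hw hax
    have hax' : D (D x - a • x) - a • (D x - a • x) = - (w ^ 2) • x := congrArg Subtype.val hax
    change x ∈ V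
    rcases CC_eig2 D hw (hW hx) hax' with rfl | rfl
    · exact h2 w hw x hx (by simpa using hax')
    · exact V.zero_mem

lemma periodic_of_eig (A : E →L[ℝ] E) {w : ℝ} (hw : 0 < w) {x : E} (hx : A (A x) = -(w ^ 2) • x) :
    fl A (2 * Real.pi / w) x = x := by
  rw [fl_eig2 A 0 w hw.ne' x (by simpa using hx)]
  rw [mul_div_cancel₀ _ hw.ne']
  simp

lemma nonfixed_connected (A : E →L[ℝ] E) (K : Submodule ℝ E) (hK : ∀ x ∈ K, A x ∈ K) {w : ℝ} (hw : 0 < w) {y : E}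
    (hy : y ∈ K) (hy0 : y ≠ 0) (hyw : A (A y) = -(w ^ 2) • y) : IsPreconnected {x | x ∈ K ∧ A x ≠ 0} := by
  let L : K →ₗ[ℝ] E := (A : E →ₗ[ℝ] E).comp K.subtype
  have hr : 1 < Module.rank ℝ (K ⧸ LinearMap.ker L) := by
    rw [L.quotKerEquivRange.rank_eq]
    by_contra hcon
    rw [not_lt, rank_le_one_iff] at hcon
    obtain ⟨v0, hv0⟩ := hcon
    have e1 : (-(w ^ 2))⁻¹ • A (A y) = y := by
      rw [hyw, smul_smul, inv_mul_cancel₀, one_smul]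
      have : 0 < w ^ 2 := by positivity
      linarith
    have m1 : y ∈ LinearMap.range L := ⟨⟨(-(w ^ 2))⁻¹ • A y, K.smul_mem _ (hK _ hy)⟩, by
      change A ((-(w ^ 2))⁻¹ • A y) = y
      rw [map_smul, e1]⟩
    have m2 : A y ∈ LinearMap.range L := ⟨⟨y, hy⟩, rfl⟩
    obtain ⟨r, hr⟩ := hv0 ⟨y, m1⟩
    obtain ⟨s, hs⟩ := hv0 ⟨A y, m2⟩
    have hr' : r • (v0 : E) = y := congrArg Subtype.val hr
    have hs' : s • (v0 : E) = A y := congrArg Subtype.val hs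
    have hr0 : r ≠ 0 := by rintro rfl; exact hy0 (by rw [← hr', zero_smul])
    have e2 : A y = (s / r) • y := by
      rw [← hs', ← hr', smul_smul, div_mul_cancel₀ _ hr0]
    have e3 : A (A y) = (s / r) ^ 2 • y := by
      rw [e2, map_smul, e2, smul_smul, sq]
    rw [hyw, ← sub_eq_zero, ← sub_smul, smul_eq_zero] at e3
    rcases e3 with e3 | e3
    · have : 0 < w ^ 2 := by positivity
      have := sq_nonneg (s / r)
      linarith
    · exact hy0 e3
  have hc := (isConnected_compl_of_one_lt_codim hr).isPreconnected.image (Subtype.val : K → E)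
    continuous_subtype_val.continuousOn
  convert hc using 1
  ext x
  constructor
  · rintro ⟨hx, hA⟩
    exact ⟨⟨x, hx⟩, hA, rfl⟩
  · rintro ⟨⟨x, hx⟩, hA, rfl⟩
    exact ⟨hx, hA⟩

lemma avoid_bound {f : ℝ → ℝ} (hf : Continuous f) (h0 : f 0 = 0) {s : ℝ} (hs : 0 < s)
    (h : ∀ t, f t ≠ s ∧ f t ≠ -s) (t : ℝ) : |f t| ≤ s := by
  rw [abs_le]
  constructor
  · by_contra hc
    push Not at hc
    have := mem_range_of_exists_le_of_exists_ge hf ⟨t, hc.le⟩ ⟨0, by rw [h0]; linarith⟩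
    obtain ⟨u, hu⟩ := this
    exact (h u).2 hu
  · by_contra hc
    push Not at hc
    have := mem_range_of_exists_le_of_exists_ge hf ⟨0, by rw [h0]; exact hs.le⟩ ⟨t, hc.le⟩
    obtain ⟨u, hu⟩ := this
    exact (h u).1 hu

lemma bdd_local (H : OrbEq A B h) {K K' : Submodule ℝ E} (hKK : ∀ x, x ∈ K → h x ∈ K')
    (hA : ∀ x ∈ K, A x ∈ K) (hB : ∀ x ∈ K', B x ∈ K') {M M' : ℝ} (hM0 : 0 < M) (hM0' : 0 < M')
    (hM : ∀ x ∈ K, ∀ t, ‖fl A t x‖ ≤ M * ‖x‖) (hM' : ∀ x ∈ K', ∀ t, ‖fl B t x‖ ≤ M' * ‖x‖) {u : E} (hu : u ∈ K)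
    (hAu : A u ≠ 0) : ∀ᶠ u' in 𝓝[{x | x ∈ K ∧ A x ≠ 0}] u, ∃ c, ∀ t, |lft A B h u' t - lft A B h u t| ≤ c := by
  have hv : B (h u) ≠ 0 := fun e => hAu (H.fixed_iff.1 e)
  obtain ⟨s, hs, hsv⟩ : ∃ s > 0, fl B s (h u) ≠ h u := by
    by_contra hcon
    push Not at hcon
    refine hv ((fl_fixed_iff B _).2 fun t => ?_)
    rcases lt_trichotomy t 0 with ht | rfl | ht
    · have := hcon (-t) (by linarith)
      have h2 := fl_apply_neg B t (h u)
      rwa [this] at h2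
    · exact fl_zero_apply B _
    · exact hcon t ht
  have hsv' : fl B (-s) (h u) ≠ h u := fun e => hsv (by
    have h2 := fl_apply_neg B s (h u)
    rwa [e] at h2)
  set η := min ‖fl B s (h u) - h u‖ ‖fl B (-s) (h u) - h u‖ with hη
  have hη0 : 0 < η := lt_min (norm_pos_iff.2 (sub_ne_zero.2 hsv)) (norm_pos_iff.2 (sub_ne_zero.2 hsv'))
  set R := M * (‖u‖ + 1) with hR
  have huc := (isCompact_closedBall (0 : E) R).uniformContinuousOn_of_continuous h.continuous.continuousOn
  rw [Metric.uniformContinuousOn_iff] at huc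
  obtain ⟨δ, hδ, hd⟩ := huc (η / (2 * M')) (by positivity)
  have e1 : ∀ᶠ u' in 𝓝 u, ‖h u - h u'‖ < η / (2 * M' * M') := by
    have : Tendsto (fun u' => ‖h u - h u'‖) (𝓝 u) (𝓝 ‖h u - h u‖) :=
      ((continuous_const.sub h.continuous).norm).tendsto u
    rw [sub_self, norm_zero] at this
    exact this.eventually_lt_const (by positivity)
  have e2 : ∀ᶠ u' in 𝓝 u, dist u' u < min 1 (δ / M) := Metric.ball_mem_nhds u (by positivity)
  filter_upwards [nhdsWithin_le_nhds e1, nhdsWithin_le_nhds e2, self_mem_nhdsWithin] with u' h1 h2 h3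
  obtain ⟨hu', hAu'⟩ := h3
  refine ⟨s, avoid_bound ((H.lft_cont hAu').sub (H.lft_cont hAu)) (by simp [H.lft_zero hAu', H.lft_zero hAu]) hs ?_⟩
  intro t
  have key : ‖fl B (lft A B h u' t - lft A B h u t) (h u) - h u‖ < η := by
    have hd1 : ‖u' - u‖ < 1 := by rw [← dist_eq_norm]; exact h2.trans_le (min_le_left _ _)
    have hd2 : ‖u' - u‖ < δ / M := by rw [← dist_eq_norm]; exact h2.trans_le (min_le_right _ _)
    have f1 : ‖h (fl A t u') - h (fl A t u)‖ < η / (2 * M') := by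
      rw [← dist_eq_norm]
      refine hd _ ?_ _ ?_ ?_
      · rw [mem_closedBall_zero_iff]
        refine (hM _ hu' t).trans ?_
        have : ‖u'‖ ≤ ‖u‖ + ‖u' - u‖ := by
          have := norm_add_le u (u' - u); rwa [add_sub_cancel] at this
        rw [hR]; gcongr; linarith
      · rw [mem_closedBall_zero_iff]
        refine (hM _ hu t).trans ?_
        rw [hR]; gcongr; linarith
      · rw [dist_eq_norm, ← map_sub]
        refine (hM _ (K.sub_mem hu' hu) t).trans_lt ?_
        rw [mul_comm]
        exact (lt_div_iff₀ hM0).1 hd2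
    rw [H.lft_eq hAu', H.lft_eq hAu] at f1
    set p := lft A B h u' t
    set q := lft A B h u t
    have f2 : fl B (p - q) (h u) - h u = fl B (-q) (fl B p (h u - h u') + (fl B p (h u') - fl B q (h u))) := by
      rw [map_sub, sub_add_sub_cancel, map_sub, fl_neg_apply, ← fl_add_apply]
      congr 2; ring_nf
    rw [f2]
    have k1 := hKK _ hu
    have k2 := hKK _ hu'
    have m1 : fl B p (h u - h u') ∈ K' := fl_mem B K' hB _ _ (K'.sub_mem k1 k2)
    have m2 : fl B p (h u') - fl B q (h u) ∈ K' := K'.sub_mem (fl_mem B K' hB _ _ k2) (fl_mem B K' hB _ _ k1)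
    refine (hM' _ (K'.add_mem m1 m2) _).trans_lt ?_
    have f3 := hM' _ (K'.sub_mem k1 k2) p
    have f4 := norm_add_le (fl B p (h u - h u')) (fl B p (h u') - fl B q (h u))
    have f5 : M' * ‖h u - h u'‖ < η / (2 * M') := by
      rw [lt_div_iff₀ (by positivity)] at h1 ⊢
      linarith
    calc _ ≤ M' * (M' * ‖h u - h u'‖ + ‖fl B p (h u') - fl B q (h u)‖) := by gcongr; linarith
      _ < M' * (η / (2 * M') + η / (2 * M')) := by gcongr
      _ = η := by field_simp; norm_num
  constructor
  · intro e
    change lft A B h u' t - lft A B h u t = _ at e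
    rw [e] at key
    exact absurd (key.trans_le (min_le_left _ _)) (lt_irrefl _)
  · intro e
    change lft A B h u' t - lft A B h u t = _ at e
    rw [e] at key
    exact absurd (key.trans_le (min_le_right _ _)) (lt_irrefl _)

lemma lft_nat (H : OrbEq A B h) {u : E} (hu : A u ≠ 0) {T : ℝ} (hT : fl A T u = u) (n : ℕ) :
    lft A B h u (n * T) = n * lft A B h u T := by
  induction n with
  | zero => simp [H.lft_zero hu]
  | succ n ih =>
    push_cast
    rw [add_mul, one_mul, H.lft_add hu, hT, ih]; ring

theorem exists_speed (H : OrbEq A B h) {K K' : Submodule ℝ E} (hKK : ∀ x, x ∈ K ↔ h x ∈ K')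
    (hA : ∀ x ∈ K, A x ∈ K) (hB : ∀ x ∈ K', B x ∈ K') {M M' : ℝ} (hM0 : 0 < M) (hM0' : 0 < M')
    (hM : ∀ x ∈ K, ∀ t, ‖fl A t x‖ ≤ M * ‖x‖) (hM' : ∀ x ∈ K', ∀ t, ‖fl B t x‖ ≤ M' * ‖x‖)
    (hper : (∀ x ∈ K, A x = 0) ∨ ∃ w : ℝ, 0 < w ∧ ∃ y ∈ K, y ≠ 0 ∧ A (A y) = -(w ^ 2) • y) :
    ∃ α : ℝ, α ≠ 0 ∧ ∀ x ∈ K, ∀ T, fl A T x = x ↔ fl B (α * T) (h x) = h x := by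
  rcases hper with hper | ⟨w, hw, y, hy, hy0, hyw⟩
  · refine ⟨1, one_ne_zero, fun x hx T => ?_⟩
    have h1 := (fl_fixed_iff A x).1 (hper x hx)
    have h2 := (fl_fixed_iff B _).1 (H.fixed_iff.2 (hper x hx))
    exact ⟨fun _ => h2 _, fun _ => h1 _⟩
  have hyA : A y ≠ 0 := by
    intro h0
    rw [h0, map_zero] at hyw
    have := smul_eq_zero.1 hyw.symm
    rcases this with h1 | h1
    · have : 0 < w ^ 2 := by positivity
      linarith
    · exact hy0 h1
  have hper := periodic_of_eig A hw hyw
  set T0 := 2 * Real.pi / w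
  have hT0 : T0 ≠ 0 := by positivity
  set β := lft A B h y T0 / T0 with hβ
  have hβ0 : β ≠ 0 := by
    refine div_ne_zero (fun e => hT0 ?_) hT0
    apply H.lft_inj hyA; rw [e, H.lft_zero hyA]
  have hb0 : ∃ c, ∀ t, |lft A B h y t - β * t| ≤ c := by
    have hp : Function.Periodic (fun t => lft A B h y t - β * t) T0 := by
      intro t
      beta_reduce
      rw [H.lft_add hyA, hper, hβ]
      field_simp
      ring
    have := hp.isBounded_of_continuous hT0 ((H.lft_cont hyA).sub (continuous_const.mul continuous_id))
    obtain ⟨c, hc⟩ := this.exists_norm_le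
    exact ⟨c, fun t => hc _ ⟨t, rfl⟩⟩
  have hall : ∀ u ∈ K, A u ≠ 0 → ∃ c, ∀ t, |lft A B h u t - β * t| ≤ c := by
    intro u hu hAu
    have hc := nonfixed_connected A K hA hw hy hy0 hyw
    have hP := hc.induction₂ (fun u v => ∃ c, ∀ t, |lft A B h v t - lft A B h u t| ≤ c)
      (fun x hx => bdd_local H (fun x => (hKK x).1) hA hB hM0 hM0' hM hM' hx.1 hx.2) ?_ ?_ ⟨hy, hyA⟩ (y := u) ⟨hu, hAu⟩
    · obtain ⟨c, hc⟩ := hP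
      obtain ⟨c', hc'⟩ := hb0
      refine ⟨c + c', fun t => ?_⟩
      have := abs_add_le (lft A B h u t - lft A B h y t) (lft A B h y t - β * t)
      rw [sub_add_sub_cancel] at this
      linarith [hc t, hc' t]
    · rintro x y z - - - ⟨c, hc⟩ ⟨c', hc'⟩
      refine ⟨c' + c, fun t => ?_⟩
      have := abs_add_le (lft A B h z t - lft A B h y t) (lft A B h y t - lft A B h x t)
      rw [sub_add_sub_cancel] at this
      linarith [hc t, hc' t]
    · rintro x y - - ⟨c, hc⟩
      exact ⟨c, fun t => by rw [abs_sub_comm]; exact hc t⟩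
  have hT : ∀ u ∈ K, A u ≠ 0 → ∀ T, fl A T u = u → lft A B h u T = β * T := by
    intro u hu hAu T hTu
    obtain ⟨c, hc⟩ := hall u hu hAu
    by_contra hne
    have hpos : 0 < |lft A B h u T - β * T| := abs_pos.2 (sub_ne_zero.2 hne)
    obtain ⟨n, hn⟩ := exists_nat_gt (c / |lft A B h u T - β * T|)
    rw [div_lt_iff₀ hpos] at hn
    have := hc (n * T)
    rw [lft_nat H hAu hTu] at this
    have e : (n : ℝ) * lft A B h u T - β * (n * T) = n * (lft A B h u T - β * T) := by ring
    rw [e, abs_mul, Nat.abs_cast] at this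
    linarith
  refine ⟨β, hβ0, fun x hx T => ?_⟩
  by_cases hAx : A x = 0
  · have h1 := (fl_fixed_iff A x).1 hAx
    have h2 := (fl_fixed_iff B _).1 (H.fixed_iff.2 hAx)
    exact ⟨fun _ => h2 _, fun _ => h1 _⟩
  constructor
  · intro hTx
    rw [← hT x hx hAx T hTx, ← H.lft_eq hAx, hTx]
  · intro hTx
    obtain ⟨T', hT'⟩ := H.lft_surj hAx (β * T)
    have h1 : fl A T' x = x := by
      apply h.injective
      rw [H.lft_eq hAx, hT', hTx]
    have h2 := hT x hx hAx T' h1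
    rw [hT'] at h2
    have : T = T' := mul_left_cancel₀ hβ0 h2
    rw [this]; exact h1

lemma FF_zero_mem {x : E} (J : JC A D N) : x ∈ FF N (CC D) 0 ↔ N x = 0 ∧ x ∈ CC D := by
  have : x ∈ FF N (CC D) 0 ↔ x ∈ Kr N 1 ∧ x ∈ Im N (CC D) 0 := Iff.rfl
  rw [this, mem_Kr, Im_zero, pow_one]

lemma FF_anti (hN : ∀ x ∈ CC D, N x ∈ CC D) : Antitone (FF N (CC D)) := fun i j hij =>
  inf_le_inf_left _ (Im_anti N hN hij)

theorem speed_FF (H : OrbEq A B h) (h0 : h 0 = 0) (J : JC A D N) (J' : JC B D' N') :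
    ∃ α : ℝ, α ≠ 0 ∧ ∀ x ∈ FF N (CC D) 0, ∀ T, fl A T x = x ↔ fl B (α * T) (h x) = h x := by
  have gen : ∀ {A D N : E →L[ℝ] E} (J : JC A D N), (∀ x ∈ FF N (CC D) 0, A x ∈ FF N (CC D) 0) ∧
      (∃ M, 0 < M ∧ ∀ x ∈ FF N (CC D) 0, ∀ t, ‖fl A t x‖ ≤ M * ‖x‖) ∧
      ((∀ x ∈ FF N (CC D) 0, A x = 0) ∨ ∃ w : ℝ, 0 < w ∧ ∃ y ∈ FF N (CC D) 0, y ≠ 0 ∧ A (A y) = -(w ^ 2) • y) := by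
    intro A D N J
    have hAD : ∀ x ∈ FF N (CC D) 0, A x = D x := fun x hx => by
      rw [J.sum]; simp [((FF_zero_mem J).1 hx).1]
    have hinv : ∀ x ∈ FF N (CC D) 0, D x ∈ FF N (CC D) 0 := fun x hx => by
      rw [FF_zero_mem J] at hx ⊢
      exact ⟨by rw [J.comm, hx.1, map_zero], CC_inv D D (fun _ => rfl) hx.2⟩
    refine ⟨fun x hx => by rw [hAD x hx]; exact hinv x hx, ?_, ?_⟩
    · obtain ⟨K, hK, hb⟩ := CC_bound D
      refine ⟨K, hK, fun x hx t => ?_⟩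
      rw [FF_zero_mem J] at hx
      rw [J.fl, (fl_fixed_iff N x).1 hx.1]
      exact hb x hx.2 t
    · by_contra hcon
      push Not at hcon
      obtain ⟨⟨x, hx, hAx⟩, hcon⟩ := hcon
      have := CC_span J.ss (W := FF N (CC D) 0) (V := LinearMap.ker (D : E →ₗ[ℝ] E))
        (fun x hx => ((FF_zero_mem J).1 hx).2) hinv (fun x _ hx => hx) (fun w hw y hy hyw => by
          by_cases hy0 : y = 0
          · rw [hy0]; exact Submodule.zero_mem _
          · exfalso
            refine hcon w hw y hy hy0 ?_
            rw [hAD y hy, hAD _ (hinv y hy)]; exact hyw)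
      exact hAx (by rw [hAD x hx]; exact this hx)
  obtain ⟨a1, ⟨M, hM0, hM⟩, a3⟩ := gen J
  obtain ⟨b1, ⟨M', hM0', hM'⟩, b3⟩ := gen J'
  exact exists_speed H (FF_map_CC H h0 J J' 0) a1 b1 hM0 hM0' hM hM' a3

end BoundedFlow

end M6_part

section M7a_part

section SemisimpleMod
open Polynomial
universe u

section basic
variable {V W : Type u} [AddCommGroup V] [Module ℝ V] [Module ℝ[X] V] [IsScalarTower ℝ ℝ[X] V]
  [AddCommGroup W] [Module ℝ W] [Module ℝ[X] W] [IsScalarTower ℝ ℝ[X] W]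

/-- the real dimension of the `q`-torsion -/
def cnt (q : ℝ[X]) (V : Type u) [AddCommGroup V] [Module ℝ V] [Module ℝ[X] V]
    [IsScalarTower ℝ ℝ[X] V] : ℕ := Module.finrank ℝ (Submodule.torsionBy ℝ[X] V q)

lemma cnt_prod [FiniteDimensional ℝ V] [FiniteDimensional ℝ W] (q : ℝ[X]) :
    cnt q (V × W) = cnt q V + cnt q W := by
  have : FiniteDimensional ℝ (Submodule.torsionBy ℝ[X] V q) :=
    FiniteDimensional.of_injective ((Submodule.subtype _).restrictScalars ℝ) Subtype.val_injective
  have : FiniteDimensional ℝ (Submodule.torsionBy ℝ[X] W q) :=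
    FiniteDimensional.of_injective ((Submodule.subtype _).restrictScalars ℝ) Subtype.val_injective
  unfold cnt
  rw [← Module.finrank_prod]
  refine LinearEquiv.finrank_eq (R := ℝ) (M := Submodule.torsionBy ℝ[X] (V × W) q)
    (N := Submodule.torsionBy ℝ[X] V q × Submodule.torsionBy ℝ[X] W q)
    { toFun := fun x => (⟨x.1.1, congrArg Prod.fst x.2⟩, ⟨x.1.2, congrArg Prod.snd x.2⟩)
      invFun := fun x => ⟨(x.1.1, x.2.1), Prod.ext x.1.2 x.2.2⟩
      map_add' := fun _ _ => rfl
      map_smul' := fun _ _ => rfl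
      left_inv := fun _ => rfl
      right_inv := fun _ => rfl }

lemma cnt_congr (e : V ≃ₗ[ℝ[X]] W) (q : ℝ[X]) : cnt q V = cnt q W := by
  unfold cnt
  refine LinearEquiv.finrank_eq (R := ℝ) (M := Submodule.torsionBy ℝ[X] V q)
    (N := Submodule.torsionBy ℝ[X] W q)
    { toFun := fun x => ⟨e x.1, by
        have h : q • x.1 = 0 := x.2
        have : q • e x.1 = 0 := by rw [← map_smul, h, map_zero]
        exact this⟩
      invFun := fun x => ⟨e.symm x.1, by
        have h : q • x.1 = 0 := x.2
        have : q • e.symm x.1 = 0 := by rw [← map_smul, h, map_zero]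
        exact this⟩
      map_add' := fun x y => Subtype.ext (map_add e x.1 y.1)
      map_smul' := fun x y => Subtype.ext (map_smul (e.restrictScalars ℝ) x y.1)
      left_inv := fun x => Subtype.ext (e.symm_apply_apply x.1)
      right_inv := fun x => Subtype.ext (e.apply_symm_apply x.1) }

lemma fd_sub [FiniteDimensional ℝ V] (p : Submodule ℝ[X] V) : FiniteDimensional ℝ p :=
  FiniteDimensional.of_injective ((Submodule.subtype _).restrictScalars ℝ) Subtype.val_injective

lemma exists_irr [FiniteDimensional ℝ V] [IsSemisimpleModule ℝ[X] V] [Nontrivial V] :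
    ∃ q : ℝ[X], Irreducible q ∧ ∃ y : V, y ≠ 0 ∧ q • y = 0 := by
  obtain ⟨m, hm⟩ := IsSemisimpleModule.exists_simple_submodule ℝ[X] V
  obtain ⟨I, hI, ⟨e⟩⟩ := isSimpleModule_iff_quot_maximal.1 hm
  have hy : (e.symm (Submodule.Quotient.mk 1) : V) ≠ 0 := by
    intro h
    have h1 : e.symm (Submodule.Quotient.mk 1) = 0 := Subtype.ext h
    rw [LinearEquiv.map_eq_zero_iff] at h1
    rw [Submodule.Quotient.mk_eq_zero] at h1
    exact hI.ne_top ((Ideal.eq_top_iff_one I).2 h1)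
  have hker : ∀ r : ℝ[X], r ∈ I ↔ r • (e.symm (Submodule.Quotient.mk 1) : V) = 0 := by
    intro r
    rw [← Submodule.coe_smul, ← map_smul, ← Submodule.Quotient.mk_smul, smul_eq_mul, mul_one,
      ZeroMemClass.coe_eq_zero, LinearEquiv.map_eq_zero_iff, Submodule.Quotient.mk_eq_zero]
  have hI0 : I ≠ ⊥ := by
    intro h0
    have hinj : Function.Injective ((LinearMap.toSpanSingleton ℝ[X] V
        (e.symm (Submodule.Quotient.mk 1) : V)).restrictScalars ℝ) := by
      rw [injective_iff_map_eq_zero]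
      intro r hr
      have := (hker r).2 (by simpa using hr)
      rwa [h0, Submodule.mem_bot] at this
    have : Module.Finite ℝ ℝ[X] := FiniteDimensional.of_injective _ hinj
    exact Polynomial.not_finite this
  have hp := Submodule.IsPrincipal.prime_generator_of_isPrime I hI0
  exact ⟨_, hp.irreducible, _, hy, (hker _).1 (Submodule.IsPrincipal.generator_mem I)⟩

lemma torsionOf_eq {q : ℝ[X]} (hq : Irreducible q) {y : V} (hy : y ≠ 0) (h : q • y = 0) :
    Ideal.torsionOf ℝ[X] V y = Ideal.span {q} := by
  have hmax : (Ideal.span {q}).IsMaximal := PrincipalIdealRing.isMaximal_of_irreducible hq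
  refine (hmax.eq_of_le ?_ ?_).symm
  · rw [Ne, Ideal.eq_top_iff_one, Ideal.mem_torsionOf_iff, one_smul]
    exact hy
  · rw [Ideal.span_le, Set.singleton_subset_iff]
    exact h

lemma span_equiv {q : ℝ[X]} (hq : Irreducible q) {y : V} (hy : y ≠ 0) (h : q • y = 0)
    {z : W} (hz : z ≠ 0) (h' : q • z = 0) :
    Nonempty ((ℝ[X] ∙ y) ≃ₗ[ℝ[X]] (ℝ[X] ∙ z)) :=
  ⟨((Ideal.quotTorsionOfEquivSpanSingleton ℝ[X] V y).symm.trans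
    (Submodule.quotEquivOfEq _ _ ((torsionOf_eq hq hy h).trans (torsionOf_eq hq hz h').symm))).trans
    (Ideal.quotTorsionOfEquivSpanSingleton ℝ[X] W z)⟩

lemma cnt_pos_iff [FiniteDimensional ℝ V] (q : ℝ[X]) : 0 < cnt q V ↔ ∃ y : V, y ≠ 0 ∧ q • y = 0 := by
  have := fd_sub (Submodule.torsionBy ℝ[X] V q)
  unfold cnt
  rw [Module.finrank_pos_iff_exists_ne_zero]
  constructor
  · rintro ⟨x, hx⟩
    exact ⟨x.1, fun h => hx (Subtype.ext h), x.2⟩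
  · rintro ⟨y, hy, h⟩
    exact ⟨⟨y, h⟩, fun h => hy (congrArg Subtype.val h)⟩
end basic

lemma semis_equiv_aux (n : ℕ) : ∀ (V W : Type u) [AddCommGroup V] [Module ℝ V] [Module ℝ[X] V]
    [IsScalarTower ℝ ℝ[X] V] [AddCommGroup W] [Module ℝ W] [Module ℝ[X] W] [IsScalarTower ℝ ℝ[X] W]
    [FiniteDimensional ℝ V] [FiniteDimensional ℝ W] [IsSemisimpleModule ℝ[X] V]
    [IsSemisimpleModule ℝ[X] W], Module.finrank ℝ V = n →
    (∀ q : ℝ[X], Irreducible q → cnt q V = cnt q W) → Nonempty (V ≃ₗ[ℝ[X]] W) := by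
  induction n using Nat.strong_induction_on with
  | _ n ih =>
  intro V W _ _ _ _ _ _ _ _ _ _ _ _ hn hq
  by_cases hV : Nontrivial V
  · obtain ⟨q, hqi, y, hy, hqy⟩ := exists_irr (V := V)
    obtain ⟨z, hz, hqz⟩ := (cnt_pos_iff (V := W) q).1 (hq q hqi ▸ (cnt_pos_iff q).2 ⟨y, hy, hqy⟩)
    obtain ⟨e⟩ := span_equiv hqi hy hqy hz hqz
    obtain ⟨p, hp⟩ := exists_isCompl (ℝ[X] ∙ y)
    obtain ⟨p', hp'⟩ := exists_isCompl (ℝ[X] ∙ z)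
    have i1 := fd_sub p
    have i2 := fd_sub p'
    have i3 := fd_sub (ℝ[X] ∙ y)
    have i4 := fd_sub (ℝ[X] ∙ z)
    have e1 := Submodule.prodEquivOfIsCompl _ _ hp
    have e2 := Submodule.prodEquivOfIsCompl _ _ hp'
    have hlt : Module.finrank ℝ p < n := by
      rw [← hn, ← (e1.restrictScalars ℝ).finrank_eq, Module.finrank_prod]
      have : 0 < Module.finrank ℝ (ℝ[X] ∙ y) := by
        rw [Module.finrank_pos_iff_exists_ne_zero]
        exact ⟨⟨y, Submodule.mem_span_singleton_self y⟩, fun h => hy (congrArg Subtype.val h)⟩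
      omega
    obtain ⟨f⟩ := ih _ hlt p p' rfl (fun r hr => by
      have a1 := cnt_congr e1 r
      have a2 := cnt_congr e2 r
      rw [cnt_prod] at a1 a2
      have a3 := cnt_congr e r
      have a4 := hq r hr
      omega)
    exact ⟨(e1.symm.trans (e.prodCongr f)).trans e2⟩
  · have hW : ¬ Nontrivial W := by
      intro hW
      obtain ⟨q, hqi, y, hy, hqy⟩ := exists_irr (V := W)
      obtain ⟨z, hz, hqz⟩ := (cnt_pos_iff (V := V) q).1
        ((hq q hqi).symm ▸ (cnt_pos_iff q).2 ⟨y, hy, hqy⟩)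
      exact hV ⟨z, 0, hz⟩
    rw [not_nontrivial_iff_subsingleton] at hV hW
    exact ⟨LinearEquiv.ofBijective (0 : V →ₗ[ℝ[X]] W)
      ⟨fun x y _ => Subsingleton.elim _ _, fun x => ⟨0, Subsingleton.elim _ _⟩⟩⟩

section glue
variable {V W : Type u} [AddCommGroup V] [Module ℝ V] [Module ℝ[X] V] [IsScalarTower ℝ ℝ[X] V]
  [AddCommGroup W] [Module ℝ W] [Module ℝ[X] W] [IsScalarTower ℝ ℝ[X] W]

lemma coprod_inj {p q : Submodule ℝ[X] V} (hd : Disjoint p q) :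
    Function.Injective (p.subtype.coprod q.subtype) := by
  rw [injective_iff_map_eq_zero]
  rintro ⟨a, b⟩ h
  have h : (a : V) + b = 0 := by simpa using h
  have h1 : (a : V) = -b := eq_neg_of_add_eq_zero_left h
  have h2 : (a : V) = 0 := Submodule.disjoint_def.1 hd _ a.2 (h1 ▸ q.neg_mem b.2)
  have h3 : (b : V) = 0 := by rw [h2, zero_add] at h; exact h
  exact Prod.ext (Subtype.ext h2) (Subtype.ext h3)

lemma glue_disj [IsSemisimpleModule ℝ[X] V] {p q : Submodule ℝ[X] V} (hd : Disjoint p q)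
    (f : p →ₗ[ℝ[X]] W) (g : q →ₗ[ℝ[X]] W) :
    ∃ Q : V →ₗ[ℝ[X]] W, (∀ x : p, Q x = f x) ∧ ∀ x : q, Q x = g x := by
  obtain ⟨Q, hQ⟩ := IsSemisimpleModule.extension_property _ (coprod_inj hd) (f.coprod g)
  refine ⟨Q, fun x => ?_, fun x => ?_⟩
  · simpa using LinearMap.congr_fun hQ (x, 0)
  · simpa using LinearMap.congr_fun hQ (0, x)

lemma cnt_sup [FiniteDimensional ℝ V] {p q : Submodule ℝ[X] V} (hd : Disjoint p q) (r : ℝ[X]) :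
    cnt r (p ⊔ q : Submodule ℝ[X] V) = cnt r p + cnt r q := by
  have i1 := fd_sub p
  have i2 := fd_sub q
  rw [← cnt_prod]
  refine (cnt_congr ((LinearEquiv.ofInjective _ (coprod_inj hd)).trans (LinearEquiv.ofEq _ _ ?_)) r).symm
  rw [LinearMap.range_coprod, Submodule.range_subtype, Submodule.range_subtype]

lemma cnt_map (p : Submodule ℝ[X] V) (f : V →ₗ[ℝ[X]] W) (hf : Function.Injective f) (r : ℝ[X]) :
    cnt r (p.map f) = cnt r p :=
  (cnt_congr (Submodule.equivMapOfInjective f hf p) r).symm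

/-- restriction of an endomorphism to its range -/
def rr (N : V →ₗ[ℝ[X]] V) : LinearMap.range N →ₗ[ℝ[X]] LinearMap.range N :=
  N.restrict (fun x _ => LinearMap.mem_range_self N x)

lemma rr_pow (N : V →ₗ[ℝ[X]] V) (j : ℕ) (x : LinearMap.range N) :
    (((rr N) ^ j) x : V) = (N ^ j) x := by
  induction j generalizing x with
  | zero => simp
  | succ j ih => rw [pow_succ, pow_succ, Module.End.mul_apply, Module.End.mul_apply, ih]; rfl

/-- kernel of `N` intersected with the image of `N ^ j` -/
def FR (N : V →ₗ[ℝ[X]] V) (j : ℕ) : Submodule ℝ[X] V := LinearMap.ker N ⊓ LinearMap.range (N ^ j)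

lemma FR_rr (N : V →ₗ[ℝ[X]] V) (j : ℕ) :
    (FR (rr N) j).map (LinearMap.range N).subtype = FR N (j + 1) := by
  ext x
  constructor
  · rintro ⟨y, ⟨hy, z, hz⟩, rfl⟩
    refine ⟨congrArg Subtype.val hy, ?_⟩
    obtain ⟨w, hw⟩ := z.2
    refine ⟨w, ?_⟩
    rw [pow_succ, Module.End.mul_apply, hw, ← rr_pow, hz]
    rfl
  · rintro ⟨hx, z, hz⟩
    rw [pow_succ, Module.End.mul_apply] at hz
    have h1 := rr_pow N j ⟨N z, LinearMap.mem_range_self N z⟩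
    refine ⟨((rr N) ^ j) ⟨N z, LinearMap.mem_range_self N z⟩, ⟨?_, ⟨_, rfl⟩⟩, h1.trans hz⟩
    apply Subtype.ext
    change N (((rr N) ^ j) ⟨N z, LinearMap.mem_range_self N z⟩ : LinearMap.range N) = 0
    rw [h1.trans hz]
    exact hx

lemma exists_H [IsSemisimpleModule ℝ[X] V] (N : V →ₗ[ℝ[X]] V) :
    ∃ H : Submodule ℝ[X] V, Disjoint (LinearMap.range N) H ∧ FR N 1 ⊔ H = LinearMap.ker N := by
  obtain ⟨C, hC⟩ := exists_isCompl (FR N 1)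
  refine ⟨C ⊓ LinearMap.ker N, ?_, ?_⟩
  · rw [Submodule.disjoint_def]
    rintro x hx ⟨hx1, hx2⟩
    exact Submodule.disjoint_def.1 hC.disjoint x ⟨hx2, by rwa [pow_one]⟩ hx1
  · rw [← sup_inf_assoc_of_le C (show FR N 1 ≤ LinearMap.ker N from inf_le_left), hC.sup_eq_top, top_inf_eq]
end glue

lemma nil_equiv_aux (m : ℕ) : ∀ (V W : Type u) [AddCommGroup V] [Module ℝ V] [Module ℝ[X] V]
    [IsScalarTower ℝ ℝ[X] V] [AddCommGroup W] [Module ℝ W] [Module ℝ[X] W] [IsScalarTower ℝ ℝ[X] W]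
    [FiniteDimensional ℝ V] [FiniteDimensional ℝ W] [IsSemisimpleModule ℝ[X] V]
    [IsSemisimpleModule ℝ[X] W] (N : V →ₗ[ℝ[X]] V) (N' : W →ₗ[ℝ[X]] W), N ^ m = 0 → N' ^ m = 0 →
    (∀ q : ℝ[X], Irreducible q → ∀ j, cnt q (FR N j) = cnt q (FR N' j)) →
    ∃ Q : V ≃ₗ[ℝ[X]] W, ∀ x, Q (N x) = N' (Q x) := by
  induction m with
  | zero =>
    intro V W _ _ _ _ _ _ _ _ _ _ _ _ N N' h h' _
    have hV : Subsingleton V := ⟨fun x y => by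
      have h1 : ∀ x : V, x = 0 := fun x => by simpa using LinearMap.congr_fun h x
      rw [h1 x, h1 y]⟩
    have hW : Subsingleton W := ⟨fun x y => by
      have h1 : ∀ x : W, x = 0 := fun x => by simpa using LinearMap.congr_fun h' x
      rw [h1 x, h1 y]⟩
    exact ⟨LinearEquiv.ofBijective (0 : V →ₗ[ℝ[X]] W)
      ⟨fun x y _ => Subsingleton.elim _ _, fun x => ⟨0, Subsingleton.elim _ _⟩⟩,
      fun x => Subsingleton.elim _ _⟩
  | succ m ih =>
    intro V W _ _ _ _ _ _ _ _ _ _ _ _ N N' h h' hq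
    have key : ∀ {V : Type u} [AddCommGroup V] [Module ℝ V] [Module ℝ[X] V] [IsScalarTower ℝ ℝ[X] V]
        (N : V →ₗ[ℝ[X]] V), N ^ (m + 1) = 0 → rr N ^ m = 0 := by
      intro V _ _ _ _ N hN
      ext ⟨x, z, rfl⟩
      rw [rr_pow]
      have := LinearMap.congr_fun hN z
      rw [pow_succ] at this
      exact this
    have j1 := fd_sub (LinearMap.range N)
    have j2 := fd_sub (LinearMap.range N')
    obtain ⟨Q0, hQ0⟩ := ih (LinearMap.range N) (LinearMap.range N') (rr N) (rr N') (key N h)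
      (key N' h') (fun q hqi j => by
        rw [← cnt_map _ (LinearMap.range N).subtype Subtype.val_injective, FR_rr,
          ← cnt_map _ (LinearMap.range N').subtype Subtype.val_injective, FR_rr, hq q hqi])
    have hk : ∀ {V : Type u} [AddCommGroup V] [Module ℝ[X] V] (N : V →ₗ[ℝ[X]] V),
        FR N 0 = LinearMap.ker N := by
      intro V _ _ N
      unfold FR
      rw [pow_zero, Module.End.one_eq_id, LinearMap.range_id, inf_top_eq]
    have k1 := fd_sub (LinearMap.ker N)
    have k2 := fd_sub (LinearMap.ker N')
    obtain ⟨eK⟩ := semis_equiv_aux _ (LinearMap.ker N) (LinearMap.ker N') rfl (fun q hqi => by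
      rw [← hk N, ← hk N', hq q hqi])
    obtain ⟨H, hH1, hH2⟩ := exists_H N
    obtain ⟨H', hH1', hH2'⟩ := exists_H N'
    have l1 := fd_sub H
    have l2 := fd_sub H'
    have hF : ∀ {V : Type u} [AddCommGroup V] [Module ℝ[X] V] (N : V →ₗ[ℝ[X]] V),
        FR N 1 ≤ LinearMap.range N := by
      intro V _ _ N x hx
      have := hx.2
      rwa [pow_one] at this
    obtain ⟨QH⟩ := semis_equiv_aux _ H H' rfl (fun q hqi => by
      have a1 := cnt_sup (hH1.mono_left (hF N)) q
      have a2 := cnt_sup (hH1'.mono_left (hF N')) q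
      rw [hH2, ← hk N] at a1
      rw [hH2', ← hk N'] at a2
      have a3 := hq q hqi 0
      have a4 := hq q hqi 1
      omega)
    obtain ⟨Z, hZ⟩ := exists_isCompl (LinearMap.range N ⊔ H)
    obtain ⟨τ, hτ⟩ := IsSemisimpleModule.lifting_property N'.rangeRestrict N'.surjective_rangeRestrict
      (LinearMap.id)
    have hτ' : ∀ w : LinearMap.range N', N' (τ w) = w := fun w =>
      congrArg Subtype.val (LinearMap.congr_fun hτ w)
    obtain ⟨Q1, hQ1, hQ1'⟩ := glue_disj hH1 ((LinearMap.range N').subtype ∘ₗ Q0.toLinearMap)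
      (H'.subtype ∘ₗ QH.toLinearMap)
    obtain ⟨Q, hQ, hQz⟩ := glue_disj hZ.disjoint (Q1 ∘ₗ (Submodule.subtype _))
      (τ ∘ₗ Q0.toLinearMap ∘ₗ N.rangeRestrict ∘ₗ Z.subtype)
    have cW : ∀ w : LinearMap.range N, Q w = Q0 w := fun w => by
      have := hQ ⟨w, Submodule.mem_sup_left w.2⟩
      exact this.trans (hQ1 w)
    have cH : ∀ w : H, Q w = QH w := fun w => by
      have := hQ ⟨w, Submodule.mem_sup_right w.2⟩
      exact this.trans (hQ1' w)
    have hHk : ∀ x ∈ H, N x = 0 := fun x hx => by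
      have : x ∈ LinearMap.ker N := hH2 ▸ Submodule.mem_sup_right hx
      exact this
    have hHk' : ∀ x ∈ H', N' x = 0 := fun x hx => by
      have : x ∈ LinearMap.ker N' := hH2' ▸ Submodule.mem_sup_right hx
      exact this
    have hcomm : ∀ v, Q (N v) = N' (Q v) := by
      intro v
      have hv : v ∈ (LinearMap.range N ⊔ H) ⊔ Z := hZ.sup_eq_top ▸ Submodule.mem_top
      obtain ⟨y, hy, z, hz, rfl⟩ := Submodule.mem_sup.1 hv
      obtain ⟨w, hw, k, hk1, rfl⟩ := Submodule.mem_sup.1 hy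
      have e1 : Q (N w) = N' (Q w) := by
        have a := cW ⟨N w, LinearMap.mem_range_self N w⟩
        have b := cW ⟨w, hw⟩
        simp only at a b
        rw [a, b]
        exact congrArg Subtype.val (hQ0 ⟨w, hw⟩)
      have e2 : Q (N k) = N' (Q k) := by
        have b := cH ⟨k, hk1⟩
        simp only at b
        rw [hHk k hk1, map_zero, b, hHk' _ (QH ⟨k, hk1⟩).2]
      have e3 : Q (N z) = N' (Q z) := by
        have a := cW ⟨N z, LinearMap.mem_range_self N z⟩
        have b := hQz ⟨z, hz⟩
        simp only at a b
        rw [a, b]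
        exact (hτ' _).symm
      simp only [map_add, e1, e2, e3]
    have hinj : Function.Injective Q := by
      rw [injective_iff_map_eq_zero]
      intro v hv
      have h1 : N v = 0 := by
        have a := cW ⟨N v, LinearMap.mem_range_self N v⟩
        simp only at a
        rw [hcomm, hv, map_zero] at a
        have b : Q0 ⟨N v, LinearMap.mem_range_self N v⟩ = 0 := Subtype.ext a.symm
        rw [LinearEquiv.map_eq_zero_iff] at b
        exact congrArg Subtype.val b
      have h2 : v ∈ FR N 1 ⊔ H := hH2.symm ▸ h1
      obtain ⟨w, hw, k, hk1, rfl⟩ := Submodule.mem_sup.1 h2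
      have a := cW ⟨w, hF N hw⟩
      have b := cH ⟨k, hk1⟩
      simp only at a b
      have h3 : ((Q0 ⟨w, hF N hw⟩ : LinearMap.range N') : W) + (QH ⟨k, hk1⟩ : H') = 0 := by
        rw [← a, ← b, ← map_add, hv]
      have h4 := coprod_inj hH1' (a₁ := (Q0 ⟨w, hF N hw⟩, QH ⟨k, hk1⟩)) (a₂ := 0) (by simpa using h3)
      have h5 : Q0 ⟨w, hF N hw⟩ = 0 := congrArg Prod.fst h4
      have h6 : QH ⟨k, hk1⟩ = 0 := congrArg Prod.snd h4
      rw [LinearEquiv.map_eq_zero_iff] at h5 h6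
      have h7 : w = 0 := congrArg Subtype.val h5
      have h8 : k = 0 := congrArg Subtype.val h6
      rw [h7, h8, add_zero]
    have hfr : Module.finrank ℝ V = Module.finrank ℝ W := by
      have a1 := LinearMap.finrank_range_add_finrank_ker (N.restrictScalars ℝ)
      have a2 := LinearMap.finrank_range_add_finrank_ker (N'.restrictScalars ℝ)
      have a3 := (Q0.restrictScalars ℝ).finrank_eq
      have a4 := (eK.restrictScalars ℝ).finrank_eq
      rw [← a1, ← a2]
      exact congrArg₂ (· + ·) a3 a4
    have hsurj : Function.Surjective Q :=
      (LinearMap.injective_iff_surjective_of_finrank_eq_finrank (f := Q.restrictScalars ℝ) hfr).1 hinj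
    exact ⟨LinearEquiv.ofBijective Q ⟨hinj, hsurj⟩, hcomm⟩

end SemisimpleMod

end M7a_part

section M7b_part

section NilEquiv
open Polynomial
universe u

section one
variable {V : Type u} [AddCommGroup V] [Module ℝ V]

/-- an endomorphism commuting with `D`, seen as `ℝ[X]`-linear -/
def polyEnd (D N : V →ₗ[ℝ] V) (hc : ∀ x, N (D x) = D (N x)) :
    Module.AEval' D →ₗ[ℝ[X]] Module.AEval' D :=
  LinearMap.ofAEval (M := V) D ((Module.AEval'.of D).toLinearMap ∘ₗ N) (fun m => by
    change Module.AEval'.of D (N (D m)) = X • (Module.AEval'.of D (N m))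
    rw [Module.AEval'.X_smul_of, hc])

lemma polyEnd_apply (D N : V →ₗ[ℝ] V) (hc : ∀ x, N (D x) = D (N x)) (x : V) :
    polyEnd D N hc (Module.AEval'.of D x) = Module.AEval'.of D (N x) := rfl

lemma polyEnd_pow (D N : V →ₗ[ℝ] V) (hc : ∀ x, N (D x) = D (N x)) (j : ℕ) (x : V) :
    (polyEnd D N hc ^ j) (Module.AEval'.of D x) = Module.AEval'.of D ((N ^ j) x) := by
  induction j generalizing x with
  | zero => rfl
  | succ j ih => rw [pow_succ, pow_succ, Module.End.mul_apply, Module.End.mul_apply, polyEnd_apply, ih]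

lemma cnt_FR (D N : V →ₗ[ℝ] V) (hc : ∀ x, N (D x) = D (N x)) (q : ℝ[X]) (j : ℕ) :
    cnt q (FR (polyEnd D N hc) j) = Module.finrank ℝ
      (LinearMap.ker N ⊓ LinearMap.range (N ^ j) ⊓ LinearMap.ker (aeval D q) : Submodule ℝ V) := by
  unfold cnt
  refine LinearEquiv.finrank_eq (R := ℝ)
    (N := (LinearMap.ker N ⊓ LinearMap.range (N ^ j) ⊓ LinearMap.ker (aeval D q) : Submodule ℝ V))
    { toFun := fun x => ⟨(Module.AEval'.of D).symm x.1.1, by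
        obtain ⟨⟨x, hx1, y, hy⟩, hx2⟩ := x
        refine ⟨⟨hx1, (Module.AEval'.of D).symm y, ?_⟩, ?_⟩
        · have := polyEnd_pow D N hc j ((Module.AEval'.of D).symm y)
          exact this.symm.trans hy
        · exact congrArg Subtype.val hx2⟩
      invFun := fun x => ⟨⟨Module.AEval'.of D x.1, by
        obtain ⟨x, ⟨hx1, y, hy⟩, hx2⟩ := x
        refine ⟨hx1, Module.AEval'.of D y, ?_⟩
        rw [polyEnd_pow, hy]⟩, Subtype.ext x.2.2⟩
      map_add' := fun _ _ => rfl
      map_smul' := fun _ _ => rfl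
      left_inv := fun _ => rfl
      right_inv := fun _ => rfl }
end one

lemma nil_equiv (V W : Type u) [AddCommGroup V] [Module ℝ V] [AddCommGroup W] [Module ℝ W] 
    [FiniteDimensional ℝ V] [FiniteDimensional ℝ W] (D N : V →ₗ[ℝ] V) (D' N' : W →ₗ[ℝ] W)
    (hc : ∀ x, N (D x) = D (N x)) (hc' : ∀ x, N' (D' x) = D' (N' x))
    (hs : Module.End.IsSemisimple D) (hs' : Module.End.IsSemisimple D')
    (hn : ∃ m, N ^ m = 0) (hn' : ∃ m, N' ^ m = 0)
    (hq : ∀ q : ℝ[X], Irreducible q → ∀ j, Module.finrank ℝ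
      (LinearMap.ker N ⊓ LinearMap.range (N ^ j) ⊓ LinearMap.ker (aeval D q) : Submodule ℝ V)
      = Module.finrank ℝ (LinearMap.ker N' ⊓ LinearMap.range (N' ^ j) ⊓ LinearMap.ker (aeval D' q) : Submodule ℝ W)) :
    ∃ Q : V ≃ₗ[ℝ] W, (∀ x, Q (D x) = D' (Q x)) ∧ ∀ x, Q (N x) = N' (Q x) := by
  obtain ⟨m, hm⟩ := hn
  obtain ⟨m', hm'⟩ := hn'
  have i1 : FiniteDimensional ℝ (Module.AEval' D) := inferInstanceAs (FiniteDimensional ℝ V)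
  have i2 : FiniteDimensional ℝ (Module.AEval' D') := inferInstanceAs (FiniteDimensional ℝ W)
  have i3 : IsSemisimpleModule ℝ[X] (Module.AEval' D) := hs
  have i4 : IsSemisimpleModule ℝ[X] (Module.AEval' D') := hs'
  obtain ⟨Q, hQ⟩ := nil_equiv_aux (m + m') (Module.AEval' D) (Module.AEval' D') (polyEnd D N hc)
    (polyEnd D' N' hc') (by
      apply LinearMap.ext
      intro x
      have := polyEnd_pow D N hc (m + m') ((Module.AEval'.of D).symm x)
      rw [pow_add, pow_add, hm, zero_mul] at this
      rw [pow_add]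
      exact this) (by
      apply LinearMap.ext
      intro x
      have := polyEnd_pow D' N' hc' (m + m') ((Module.AEval'.of D').symm x)
      rw [pow_add, pow_add, hm', mul_zero] at this
      rw [pow_add]
      exact this) (fun q hqi j => by rw [cnt_FR, cnt_FR, hq q hqi j])
  refine ⟨(Module.AEval'.of D).trans ((Q.restrictScalars ℝ).trans (Module.AEval'.of D').symm), 
    fun x => ?_, fun x => ?_⟩
  · change (Module.AEval'.of D').symm (Q (Module.AEval'.of D (D x))) = _
    rw [← Module.AEval'.X_smul_of, map_smul, Module.AEval'.of_symm_X_smul]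
    rfl
  · exact hQ (Module.AEval'.of D x)

end NilEquiv

end M7b_part

section M7c_part

section NilCC
open Polynomial
variable {E : Type*} [NormedAddCommGroup E] [NormedSpace ℝ E] [FiniteDimensional ℝ E] [CompleteSpace E]
variable {A D N B D' N' : E →L[ℝ] E} {h : E ≃ₜ E}

/-- the `(±iw)`-eigenspace of `D` -/
def GG (D : E →L[ℝ] E) (w : ℝ) : Submodule ℝ E where
  carrier := {x | D (D x) = -(w ^ 2) • x}
  zero_mem' := by simp
  add_mem' := by
    intro x y hx hy
    have hx : D (D x) = -(w ^ 2) • x := hx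
    have hy : D (D y) = -(w ^ 2) • y := hy
    change D (D (x + y)) = -(w ^ 2) • (x + y)
    rw [map_add, map_add, hx, hy, smul_add]
  smul_mem' := by
    intro c x hx
    have hx : D (D x) = -(w ^ 2) • x := hx
    change D (D (c • x)) = -(w ^ 2) • (c • x)
    rw [map_smul, map_smul, hx, smul_comm]

lemma mem_GG {w : ℝ} {x : E} : x ∈ GG D w ↔ D (D x) = -(w ^ 2) • x := Iff.rfl

lemma GG_zero (hD : Module.End.IsSemisimple (D : E →ₗ[ℝ] E)) {x : E} (hx : x ∈ CC D) :
    x ∈ GG D 0 ↔ D x = 0 := by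
  constructor
  · intro h
    refine CC_span hD (W := CC D ⊓ GG D 0) (V := LinearMap.ker (D : E →ₗ[ℝ] E)) inf_le_left ?_ ?_ ?_ ⟨hx, h⟩
    · rintro y ⟨hy1, hy2⟩
      refine ⟨CC_inv D D (fun _ => rfl) hy1, ?_⟩
      have hy2 : D (D y) = _ := hy2
      change D (D (D y)) = _
      rw [hy2]; simp
    · intro y _ hy; exact hy
    · rintro w hw y ⟨_, hy2⟩ hy
      have hy2 : D (D y) = _ := hy2
      rw [hy] at hy2
      have h0 : w ^ 2 • y = 0 := by simpa using hy2
      rcases smul_eq_zero.1 h0 with h1 | h1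
      · exact absurd h1 (by positivity)
      · rw [h1]; exact Submodule.zero_mem _
  · intro h
    rw [mem_GG, h]; simp

/-- restrictions to the central space -/
def resC (D L : E →L[ℝ] E) (h : ∀ x, L (D x) = D (L x)) : CC D →ₗ[ℝ] CC D :=
  (L : E →ₗ[ℝ] E).restrict (fun x hx => CC_inv D L h hx)

lemma resC_apply (D L : E →L[ℝ] E) (h : ∀ x, L (D x) = D (L x)) (x : CC D) :
    (resC D L h x : E) = L x := rfl

lemma resC_pow (D L : E →L[ℝ] E) (h : ∀ x, L (D x) = D (L x)) (j : ℕ) (x : CC D) :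
    ((resC D L h ^ j) x : E) = (L ^ j) x := by
  induction j generalizing x with
  | zero => rfl
  | succ j ih =>
    rw [pow_succ, pow_succ, Module.End.mul_apply, ih]
    rfl

/-- the invariants -/
def dims (D N : E →L[ℝ] E) (j : ℕ) (w : ℝ) : ℕ :=
  Module.finrank ℝ (FF N (CC D) j ⊓ GG D w : Submodule ℝ E)

lemma irr_quad {w : ℝ} (hw : 0 < w) : Irreducible (X ^ 2 + C (w ^ 2) : ℝ[X]) := by
  have hd : (X ^ 2 + C (w ^ 2) : ℝ[X]).natDegree = 2 := by compute_degree!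
  refine irreducible_of_degree_le_three_of_not_isRoot (by rw [hd]; decide) ?_
  intro x hx
  have : x ^ 2 + w ^ 2 = 0 := by simpa using hx
  nlinarith [sq_nonneg x]

lemma aeval_quad {V : Type*} [AddCommGroup V] [Module ℝ V] (f : V →ₗ[ℝ] V) (w : ℝ) (x : V) :
    aeval f (X ^ 2 + C (w ^ 2) : ℝ[X]) x = 0 ↔ f (f x) = -(w ^ 2) • x := by
  rw [map_add, map_pow, aeval_X, aeval_C, LinearMap.add_apply, sq f, Module.End.mul_apply,
    Module.algebraMap_end_apply, neg_smul, add_eq_zero_iff_eq_neg]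

lemma ker_assoc {V : Type*} [AddCommGroup V] [Module ℝ V] (f : V →ₗ[ℝ] V) {p q : ℝ[X]}
    (h : Associated p q) (x : V) : aeval f p x = 0 ↔ aeval f q x = 0 := by
  have key : ∀ {p q : ℝ[X]}, p ∣ q → aeval f p x = 0 → aeval f q x = 0 := by
    rintro p q ⟨r, rfl⟩ h
    rw [mul_comm, map_mul, Module.End.mul_apply, h, map_zero]
  exact ⟨key h.dvd, key h.symm.dvd⟩

lemma finrank_res (J : JC A D N) (j : ℕ) (q : ℝ[X]) (w : ℝ)
    (hw : ∀ x : CC D, aeval (resC D D (fun _ => rfl)) q x = 0 ↔ (x : E) ∈ GG D w) :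
    Module.finrank ℝ (LinearMap.ker (resC D N J.comm) ⊓ LinearMap.range (resC D N J.comm ^ j)
      ⊓ LinearMap.ker (aeval (resC D D (fun _ => rfl)) q) : Submodule ℝ (CC D)) = dims D N j w := by
  unfold dims
  rw [LinearEquiv.finrank_eq (Submodule.equivMapOfInjective (CC D).subtype Subtype.val_injective _)]
  have : Submodule.map (CC D).subtype (LinearMap.ker (resC D N J.comm) ⊓ LinearMap.range (resC D N J.comm ^ j)
      ⊓ LinearMap.ker (aeval (resC D D (fun _ => rfl)) q) : Submodule ℝ (CC D)) = FF N (CC D) j ⊓ GG D w := by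
    ext x
    constructor
    · rintro ⟨y, ⟨⟨hy1, z, hz⟩, hy2⟩, rfl⟩
      refine ⟨⟨?_, z, z.2, ?_⟩, (hw y).1 hy2⟩
      · rw [SetLike.mem_coe, mem_Kr, pow_one]
        exact congrArg Subtype.val hy1
      · have := resC_pow D N J.comm j z
        rw [hz] at this
        exact this.symm
    · rintro ⟨⟨hx1, z, hz, hx3⟩, hx2⟩
      have e1 := resC_pow D N J.comm j ⟨z, hz⟩
      have e2 : ((resC D N J.comm ^ j) ⟨z, hz⟩ : E) = x := e1.trans hx3
      refine ⟨(resC D N J.comm ^ j) ⟨z, hz⟩, ⟨⟨?_, ⟨_, rfl⟩⟩, ?_⟩, e2⟩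
      · apply Subtype.ext
        change N ((resC D N J.comm ^ j) ⟨z, hz⟩ : CC D) = 0
        rw [e2]
        rw [SetLike.mem_coe, mem_Kr, pow_one] at hx1
        exact hx1
      · refine (hw _).2 ?_
        rw [e2]
        exact hx2
  rw [this]

lemma finrank_res_zero (J : JC A D N) (j : ℕ) (q : ℝ[X]) (h1 : IsCoprime X q)
    (h2 : ∀ w : ℝ, 0 < w → IsCoprime (X ^ 2 + C (w ^ 2)) q) :
    Module.finrank ℝ (LinearMap.ker (resC D N J.comm) ⊓ LinearMap.range (resC D N J.comm ^ j)
      ⊓ LinearMap.ker (aeval (resC D D (fun _ => rfl)) q) : Submodule ℝ (CC D)) = 0 := by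
  have hb : LinearMap.ker (aeval (resC D D (fun _ => rfl)) q) = ⊥ := by
    rw [eq_bot_iff]
    intro y hy
    have hz : (y : E) ∈ (⊥ : Submodule ℝ E) := by
      refine CC_span J.ss (W := Submodule.map (CC D).subtype
        (LinearMap.ker (aeval (resC D D (fun _ => rfl)) q))) ?_ ?_ ?_ ?_ ⟨y, hy, rfl⟩
      · rintro x ⟨z, _, rfl⟩; exact z.2
      · rintro x ⟨z, hz, rfl⟩
        refine ⟨resC D D (fun _ => rfl) z, ?_, rfl⟩
        have hz : aeval (resC D D (fun _ => rfl)) q z = 0 := hz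
        change aeval (resC D D (fun _ => rfl)) q (resC D D (fun _ => rfl) z) = 0
        have : aeval (resC D D (fun _ => rfl)) (q * X) z = 0 := by
          rw [mul_comm, map_mul, Module.End.mul_apply, hz, map_zero]
        rwa [map_mul, aeval_X, Module.End.mul_apply] at this
      · rintro x ⟨z, hz, rfl⟩ hx
        have := Submodule.disjoint_def.1 (disjoint_ker_aeval_of_isCoprime (resC D D (fun _ => rfl)) h1) z
          (by rw [aeval_X]; exact Subtype.ext hx) hz
        rw [this]; simp
      · rintro w hw x ⟨z, hz, rfl⟩ hx
        have := Submodule.disjoint_def.1 (disjoint_ker_aeval_of_isCoprime (resC D D (fun _ => rfl)) (h2 w hw)) z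
          (by rw [LinearMap.mem_ker, aeval_quad]; exact Subtype.ext hx) hz
        rw [this]; simp
    exact Subtype.ext hz
  rw [hb, inf_bot_eq, finrank_bot]

theorem sim_of_dims (J : JC A D N) (J' : JC B D' N') (hd : ∀ j w, dims D N j w = dims D' N' j w) :
    ∃ Q : CC D ≃ₗ[ℝ] CC D', ∀ x y : CC D, (y : E) = A x → (Q y : E) = B (Q x) := by
  have hall : ∀ q : ℝ[X], Irreducible q → ∀ j, Module.finrank ℝ
      (LinearMap.ker (resC D N J.comm) ⊓ LinearMap.range (resC D N J.comm ^ j)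
      ⊓ LinearMap.ker (aeval (resC D D (fun _ => rfl)) q) : Submodule ℝ (CC D)) = Module.finrank ℝ
      (LinearMap.ker (resC D' N' J'.comm) ⊓ LinearMap.range (resC D' N' J'.comm ^ j)
      ⊓ LinearMap.ker (aeval (resC D' D' (fun _ => rfl)) q) : Submodule ℝ (CC D')) := by
    intro q hq j
    by_cases h1 : Associated X q
    · rw [finrank_res J j q 0, finrank_res J' j q 0, hd]
      · intro x
        rw [← ker_assoc _ h1, aeval_X, GG_zero J'.ss x.2]
        exact ⟨fun h => congrArg Subtype.val h, fun h => Subtype.ext h⟩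
      · intro x
        rw [← ker_assoc _ h1, aeval_X, GG_zero J.ss x.2]
        exact ⟨fun h => congrArg Subtype.val h, fun h => Subtype.ext h⟩
    by_cases h2 : ∃ w : ℝ, 0 < w ∧ Associated (X ^ 2 + C (w ^ 2)) q
    · obtain ⟨w, hw, h2⟩ := h2
      rw [finrank_res J j q w, finrank_res J' j q w, hd]
      · intro x
        rw [← ker_assoc _ h2, aeval_quad, mem_GG]
        exact ⟨fun h => congrArg Subtype.val h, fun h => Subtype.ext h⟩
      · intro x
        rw [← ker_assoc _ h2, aeval_quad, mem_GG]
        exact ⟨fun h => congrArg Subtype.val h, fun h => Subtype.ext h⟩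
    · push Not at h2
      have c1 : IsCoprime X q := by
        rw [irreducible_X.coprime_iff_not_dvd]
        exact fun hdv => h1 (irreducible_X.associated_of_dvd hq hdv)
      have c2 : ∀ w : ℝ, 0 < w → IsCoprime (X ^ 2 + C (w ^ 2)) q := fun w hw => by
        rw [(irr_quad hw).coprime_iff_not_dvd]
        exact fun hdv => h2 w hw ((irr_quad hw).associated_of_dvd hq hdv)
      rw [finrank_res_zero J j q c1 c2, finrank_res_zero J' j q c1 c2]
  obtain ⟨Q, hQ1, hQ2⟩ := nil_equiv (CC D) (CC D') (resC D D (fun _ => rfl)) (resC D N J.comm)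
    (resC D' D' (fun _ => rfl)) (resC D' N' J'.comm)
    (fun x => Subtype.ext (J.comm x)) (fun x => Subtype.ext (J'.comm x))
    (J.ss.restrict _) (J'.ss.restrict _)
    (by
      obtain ⟨m, hm⟩ := J.nil
      refine ⟨m, LinearMap.ext fun x => Subtype.ext ?_⟩
      rw [resC_pow, hm]; rfl)
    (by
      obtain ⟨m, hm⟩ := J'.nil
      refine ⟨m, LinearMap.ext fun x => Subtype.ext ?_⟩
      rw [resC_pow, hm]; rfl) hall
  · refine ⟨Q, fun x y hxy => ?_⟩
    have : y = resC D D (fun _ => rfl) x + resC D N J.comm x := by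
      apply Subtype.ext
      rw [hxy, show A x = D x + N x from congrArg (fun L : E →L[ℝ] E => L x) J.sum]; rfl
    rw [this, map_add, hQ1, hQ2,
      show B (Q x) = D' (Q x) + N' (Q x) from congrArg (fun L : E →L[ℝ] E => L (Q x)) J'.sum]; rfl
end NilCC

end M7c_part

section M7d_part

section DimsEq
variable {E : Type*} [NormedAddCommGroup E] [NormedSpace ℝ E] [FiniteDimensional ℝ E] [CompleteSpace E]
variable {A D N B D' N' : E →L[ℝ] E} {h : E ≃ₜ E}

/-- fixed space of the time-`T` map -/
def Fx (D : E →L[ℝ] E) (T : ℝ) : Submodule ℝ E :=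
  LinearMap.ker ((fl D T - 1 : E →L[ℝ] E) : E →ₗ[ℝ] E)

lemma mem_Fx {T : ℝ} {x : E} : x ∈ Fx D T ↔ fl D T x = x := by
  change (fl D T - 1) x = 0 ↔ _
  rw [ContinuousLinearMap.sub_apply, sub_eq_zero]; rfl

lemma GG_fixed {w T : ℝ} (hw : 0 < w) {x : E} (hx : x ∈ GG D w) (hc : Real.cos (w * T) = 1) :
    fl D T x = x := by
  have hs : Real.sin (w * T) = 0 := by
    have := Real.sin_sq_add_cos_sq (w * T)
    rw [hc] at this
    nlinarith [sq_nonneg (Real.sin (w * T))]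
  rw [fl_eig2 D 0 w hw.ne' x (by simpa using mem_GG.1 hx), hc, hs]
  simp

lemma GG_cos {w T : ℝ} (hw : 0 < w) {x : E} (hx : x ∈ GG D w) (h0 : x ≠ 0) (hf : fl D T x = x) :
    Real.cos (w * T) = 1 := by
  rw [fl_eig2 D 0 w hw.ne' x (by simpa using mem_GG.1 hx)] at hf
  set c := Real.cos (w * T)
  set s := Real.sin (w * T) / w with hs
  have e1 : c • x + s • D x = x := by simpa using hf
  have e2 : c • D x + s • D (D x) = D x := by simpa using congrArg D e1
  rw [mem_GG.1 hx] at e2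
  have e3 : ((c - 1) ^ 2 + s ^ 2 * w ^ 2) • x = 0 := by
    have : ((c - 1) ^ 2 + s ^ 2 * w ^ 2) • x =
        (c - 1) • (c • x + s • D x - x) - s • (c • D x + s • (-(w ^ 2) • x) - D x) := by module
    rw [this, e1, e2]; simp
  rcases smul_eq_zero.1 e3 with h | h
  · have : (c - 1) ^ 2 = 0 := by nlinarith [sq_nonneg (c - 1), sq_nonneg (s * w)]
    have := pow_eq_zero_iff (two_ne_zero) |>.1 this
    linarith
  · exact absurd h h0

lemma GG_disjoint {w : ℝ} (hw : 0 ≤ w) (S : Finset ℝ) (hS : ∀ v ∈ S, 0 ≤ v) (hwS : w ∉ S)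
    (F : Submodule ℝ E) : Disjoint (F ⊓ GG D w) (S.sup fun v => F ⊓ GG D v) := by
  have key := Module.End.eigenspaces_iSupIndep ((D : E →ₗ[ℝ] E) * (D : E →ₗ[ℝ] E)) (-(w ^ 2))
  have h1 : ∀ v, GG D v ≤ Module.End.eigenspace ((D : E →ₗ[ℝ] E) * (D : E →ₗ[ℝ] E)) (-(v ^ 2)) := by
    intro v x hx
    rw [Module.End.mem_eigenspace_iff]
    exact hx
  refine key.mono (inf_le_right.trans (h1 w)) ?_
  refine Finset.sup_le fun v hv => (inf_le_right.trans (h1 v)).trans ?_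
  refine le_iSup₂_of_le (-(v ^ 2)) ?_ le_rfl
  intro e
  have e : v ^ 2 = w ^ 2 := neg_injective e
  have : v = w := by
    rcases sq_eq_sq_iff_eq_or_eq_neg.1 e with h | h
    · exact h
    · have := hS v hv; linarith
  exact hwS (this ▸ hv)

lemma finrank_sup_GG (S : Finset ℝ) (hS : ∀ v ∈ S, 0 ≤ v) (F : Submodule ℝ E) :
    Module.finrank ℝ (S.sup fun v => F ⊓ GG D v : Submodule ℝ E)
      = ∑ v ∈ S, Module.finrank ℝ (F ⊓ GG D v : Submodule ℝ E) := by
  classical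
  induction S using Finset.induction_on with
  | empty => simp
  | insert w S hw ih =>
    rw [Finset.sup_insert, Finset.sum_insert hw, ← ih (fun v hv => hS v (Finset.mem_insert_of_mem hv))]
    have hd := GG_disjoint (D := D) (hS w (Finset.mem_insert_self w S)) S
      (fun v hv => hS v (Finset.mem_insert_of_mem hv)) hw F
    have := Submodule.finrank_sup_add_finrank_inf_eq (F ⊓ GG D w) (S.sup fun v => F ⊓ GG D v)
    rw [hd.eq_bot, finrank_bot, add_zero] at this
    exact this

lemma finite_supp (D N : E →L[ℝ] E) (j : ℕ) : {w : ℝ | dims D N j w ≠ 0}.Finite := by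
  have hf := Module.End.finite_hasEigenvalue ((D : E →ₗ[ℝ] E) * (D : E →ₗ[ℝ] E))
  have : {w : ℝ | dims D N j w ≠ 0} ⊆ (fun w : ℝ => -(w ^ 2)) ⁻¹'
      {μ | Module.End.HasEigenvalue ((D : E →ₗ[ℝ] E) * (D : E →ₗ[ℝ] E)) μ} := by
    intro w hw
    have hw : dims D N j w ≠ 0 := hw
    have : ∃ x : (FF N (CC D) j ⊓ GG D w : Submodule ℝ E), x ≠ 0 :=
      Module.finrank_pos_iff_exists_ne_zero.1 (Nat.pos_of_ne_zero hw)
    obtain ⟨⟨x, hx1, hx2⟩, hx⟩ := this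
    refine Module.End.hasEigenvalue_of_hasEigenvector (x := x)
      ⟨Module.End.mem_eigenspace_iff.2 hx2, fun h => hx (Subtype.ext h)⟩
  refine Set.Finite.subset (Set.Finite.preimage' hf ?_) this
  intro b _
  refine Set.Finite.subset (Set.toFinite {Real.sqrt (-b), -Real.sqrt (-b)}) ?_
  intro w hw
  have hw : -(w ^ 2) = b := hw
  rw [← hw, neg_neg, Real.sqrt_sq_eq_abs]
  rcases abs_choice w with h | h
  · left; exact h.symm
  · right; rw [Set.mem_singleton_iff, h, neg_neg]

lemma dims_abs (D N : E →L[ℝ] E) (j : ℕ) (w : ℝ) : dims D N j |w| = dims D N j w := by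
  unfold dims
  have : GG D |w| = GG D w := by
    ext x; rw [mem_GG, mem_GG, sq_abs]
  rw [this]

lemma FF_invD (J : JC A D N) (j : ℕ) {x : E} (hx : x ∈ FF N (CC D) j) : D x ∈ FF N (CC D) j := by
  obtain ⟨h1, z, hz, h3⟩ := hx
  have hc : ∀ k (y : E), (N ^ k) (D y) = D ((N ^ k) y) := by
    intro k
    induction k with
    | zero => intro y; rfl
    | succ k ih => intro y; rw [pow_succ, ContinuousLinearMap.mul_apply, ContinuousLinearMap.mul_apply, J.comm, ih]
  refine ⟨?_, D z, CC_inv D D (fun _ => rfl) hz, ?_⟩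
  · rw [SetLike.mem_coe, mem_Kr] at h1 ⊢
    rw [hc, h1, map_zero]
  · change (N ^ j) z = x at h3
    change (N ^ j) (D z) = D x
    rw [hc, h3]

lemma FF_CC (J : JC A D N) (j : ℕ) : FF N (CC D) j ≤ CC D := fun x hx =>
  ((FF_zero_mem J).1 (FF_anti (fun x hx => CC_inv D N J.comm hx) (Nat.zero_le j) hx)).2

lemma FF_N (J : JC A D N) (j : ℕ) {x : E} (hx : x ∈ FF N (CC D) j) : N x = 0 :=
  ((FF_zero_mem J).1 (FF_anti (fun x hx => CC_inv D N J.comm hx) (Nat.zero_le j) hx)).1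

open Classical in
lemma finrank_Fx (J : JC A D N) (j : ℕ) (S : Finset ℝ) (hS : ∀ v ∈ S, 0 ≤ v) (h0 : (0 : ℝ) ∈ S)
    (hsupp : ∀ w, 0 < w → dims D N j w ≠ 0 → w ∈ S) (T : ℝ) :
    Module.finrank ℝ (FF N (CC D) j ⊓ Fx D T : Submodule ℝ E)
      = ∑ v ∈ S.filter (fun v => Real.cos (v * T) = 1), dims D N j v := by
  unfold dims
  rw [← finrank_sup_GG _ (fun v hv => hS v (Finset.mem_filter.1 hv).1)]
  have : FF N (CC D) j ⊓ Fx D T = (S.filter (fun v => Real.cos (v * T) = 1)).sup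
      fun v => FF N (CC D) j ⊓ GG D v := by
    apply le_antisymm
    · refine CC_span J.ss (inf_le_left.trans (FF_CC J j)) ?_ ?_ ?_
      · rintro x ⟨hx1, hx2⟩
        refine ⟨FF_invD J j hx1, ?_⟩
        rw [SetLike.mem_coe, mem_Fx] at hx2 ⊢
        rw [← fl_comm, hx2]
      · rintro x ⟨hx1, hx2⟩ hx
        refine Finset.le_sup (f := fun v => FF N (CC D) j ⊓ GG D v)
          (Finset.mem_filter.2 ⟨h0, by simp⟩) ⟨hx1, ?_⟩
        rw [SetLike.mem_coe, mem_GG, hx]; simp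
      · rintro w hw x ⟨hx1, hx2⟩ hx
        by_cases hx0 : x = 0
        · rw [hx0]; exact Submodule.zero_mem _
        refine Finset.le_sup (f := fun v => FF N (CC D) j ⊓ GG D v)
          (Finset.mem_filter.2 ⟨hsupp w hw ?_, ?_⟩) ⟨hx1, hx⟩
        · have : 0 < dims D N j w :=
            Module.finrank_pos_iff_exists_ne_zero.2 ⟨⟨x, hx1, hx⟩, fun h => hx0 (congrArg Subtype.val h)⟩
          exact this.ne'
        · exact GG_cos hw hx hx0 (mem_Fx.1 hx2)
    · refine Finset.sup_le fun v hv => ?_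
      rintro x ⟨hx1, hx2⟩
      refine ⟨hx1, ?_⟩
      rw [SetLike.mem_coe, mem_Fx]
      obtain ⟨hv1, hv2⟩ := Finset.mem_filter.1 hv
      rcases (hS v hv1).eq_or_lt with h | h
      · rw [SetLike.mem_coe, ← h, GG_zero J.ss (FF_CC J j hx1)] at hx2
        exact (fl_fixed_iff D x).1 hx2 T
      · exact GG_fixed h hx2 hv2
  rw [this]

lemma sum_determines (f g : ℝ → ℕ) (S : Finset ℝ) (hS : ∀ v ∈ S, 0 ≤ v)
    (hf : ∀ w, 0 < w → f w ≠ 0 → w ∈ S) (hg : ∀ w, 0 < w → g w ≠ 0 → w ∈ S)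
    (h0 : f 0 = g 0) 
    (h : ∀ T : ℝ, (open Classical in ∑ v ∈ S.filter (fun v => Real.cos (v * T) = 1), f v) =
      (open Classical in ∑ v ∈ S.filter (fun v => Real.cos (v * T) = 1), g v)) :
    ∀ w, 0 ≤ w → f w = g w := by
  classical
  by_contra hcon
  push Not at hcon
  obtain ⟨w0, hw0, hne⟩ := hcon
  have hw0' : 0 < w0 := lt_of_le_of_ne hw0 (fun e => hne (e ▸ h0))
  have hmem : w0 ∈ S := by
    by_cases hz : f w0 = 0
    · exact hg w0 hw0' (fun e => hne (hz.trans e.symm))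
    · exact hf w0 hw0' hz
  obtain ⟨w, hw, hmax⟩ := (S.filter (fun v => f v ≠ g v)).exists_max_image id
    ⟨w0, Finset.mem_filter.2 ⟨hmem, hne⟩⟩
  obtain ⟨hwS, hwne⟩ := Finset.mem_filter.1 hw
  have hwpos : 0 < w := lt_of_lt_of_le hw0' (hmax w0 (Finset.mem_filter.2 ⟨hmem, hne⟩))
  have hT := h (2 * Real.pi / w)
  have hin : w ∈ S.filter (fun v => Real.cos (v * (2 * Real.pi / w)) = 1) := by
    refine Finset.mem_filter.2 ⟨hwS, ?_⟩
    rw [mul_div_cancel₀ _ hwpos.ne', Real.cos_two_pi]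
  rw [← Finset.add_sum_erase _ _ hin, ← Finset.add_sum_erase _ _ hin] at hT
  have hrest : ∑ v ∈ (S.filter (fun v => Real.cos (v * (2 * Real.pi / w)) = 1)).erase w, f v
      = ∑ v ∈ (S.filter (fun v => Real.cos (v * (2 * Real.pi / w)) = 1)).erase w, g v := by
    refine Finset.sum_congr rfl fun v hv => ?_
    obtain ⟨hvw, hv⟩ := Finset.mem_erase.1 hv
    obtain ⟨hvS, hv⟩ := Finset.mem_filter.1 hv
    by_contra hfg
    have hle : v ≤ w := hmax v (Finset.mem_filter.2 ⟨hvS, hfg⟩)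
    have hlt : v < w := lt_of_le_of_ne hle hvw
    have hv0 : 0 < v := lt_of_le_of_ne (hS v hvS) (fun e => hfg (e ▸ h0))
    have hpi := Real.pi_pos
    have b1 : v * (2 * Real.pi / w) < 2 * Real.pi := by
      rw [mul_div_assoc', div_lt_iff₀ hwpos]; nlinarith
    have b2 : 0 < v * (2 * Real.pi / w) := by positivity
    have := (Real.cos_eq_one_iff_of_lt_of_lt (by linarith) b1).1 hv
    linarith
  rw [hrest] at hT
  exact hwne (by omega)

theorem dims_eq (J : JC A D N) (J' : JC B D' N') (j : ℕ) (h0 : dims D N j 0 = dims D' N' j 0)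
    (hT : ∀ T, Module.finrank ℝ (FF N (CC D) j ⊓ Fx D T : Submodule ℝ E)
      = Module.finrank ℝ (FF N' (CC D') j ⊓ Fx D' T : Submodule ℝ E)) (w : ℝ) :
    dims D N j w = dims D' N' j w := by
  classical
  rw [← dims_abs, ← dims_abs D']
  set S : Finset ℝ := insert 0 (((finite_supp D N j).toFinset ∪ (finite_supp D' N' j).toFinset).filter (0 < ·))
    with hSdef
  have hS : ∀ v ∈ S, 0 ≤ v := by
    intro v hv
    rcases Finset.mem_insert.1 hv with h | h
    · exact h.ge
    · exact (Finset.mem_filter.1 h).2.le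
  have hs1 : ∀ w, 0 < w → dims D N j w ≠ 0 → w ∈ S := by
    intro w hw h
    refine Finset.mem_insert_of_mem (Finset.mem_filter.2 ⟨Finset.mem_union_left _ ?_, hw⟩)
    rw [Set.Finite.mem_toFinset]; exact h
  have hs2 : ∀ w, 0 < w → dims D' N' j w ≠ 0 → w ∈ S := by
    intro w hw h
    refine Finset.mem_insert_of_mem (Finset.mem_filter.2 ⟨Finset.mem_union_right _ ?_, hw⟩)
    rw [Set.Finite.mem_toFinset]; exact h
  refine sum_determines _ _ S hS hs1 hs2 h0 (fun T => ?_) _ (abs_nonneg w)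
  have a1 := finrank_Fx J j S hS (Finset.mem_insert_self _ _) hs1 T
  have a2 := finrank_Fx J' j S hS (Finset.mem_insert_self _ _) hs2 T
  rw [← a1, ← a2, hT T]

end DimsEq

end M7d_part

section M7e_part

section CentralSim
variable {E : Type*} [NormedAddCommGroup E] [NormedSpace ℝ E] [FiniteDimensional ℝ E] [CompleteSpace E]
variable {A D N B D' N' : E →L[ℝ] E} {h : E ≃ₜ E}

lemma smul_pow_apply (a : ℝ) (N : E →L[ℝ] E) (k : ℕ) (x : E) : ((a • N) ^ k) x = a ^ k • (N ^ k) x := by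
  rw [_root_.smul_pow]; rfl

lemma JC.smul (J : JC A D N) (a : ℝ) : JC (a • A) (a • D) (a • N) := by
  refine ⟨by rw [J.sum, smul_add], fun x => ?_, ?_, ?_⟩
  · simp [J.comm]
  · have := Module.End.IsSemisimple.aeval J.ss (Polynomial.C a * Polynomial.X)
    rw [map_mul, Polynomial.aeval_X, Polynomial.aeval_C, Algebra.algebraMap_eq_smul_one, smul_mul_assoc,
      one_mul] at this
    exact this
  · obtain ⟨m, hm⟩ := J.nil
    exact ⟨m, by rw [_root_.smul_pow, hm, smul_zero]⟩

lemma CC_smul (D : E →L[ℝ] E) {a : ℝ} (ha : a ≠ 0) : CC (a • D) = CC D := by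
  ext x
  constructor
  · rintro ⟨K, hK⟩
    refine ⟨K, fun t => ?_⟩
    have := hK (a⁻¹ * t)
    rwa [fl_smul, mul_inv_cancel_left₀ ha] at this
  · rintro ⟨K, hK⟩
    refine ⟨K, fun t => ?_⟩
    rw [fl_smul]; exact hK _

lemma FF_smul (N : E →L[ℝ] E) {a : ℝ} (ha : a ≠ 0) (V : Submodule ℝ E) (j : ℕ) :
    FF (a • N) V j = FF N V j := by
  ext x
  constructor
  · rintro ⟨h1, z, hz, h3⟩
    refine ⟨?_, a ^ j • z, V.smul_mem _ hz, ?_⟩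
    · rw [SetLike.mem_coe, mem_Kr] at h1 ⊢
      rw [smul_pow_apply] at h1
      exact (smul_eq_zero.1 h1).resolve_left (pow_ne_zero _ ha)
    · change ((a • N) ^ j) z = x at h3
      change (N ^ j) (a ^ j • z) = x
      rw [map_smul, ← smul_pow_apply, h3]
  · rintro ⟨h1, z, hz, h3⟩
    refine ⟨?_, (a ^ j)⁻¹ • z, V.smul_mem _ hz, ?_⟩
    · rw [SetLike.mem_coe, mem_Kr] at h1 ⊢
      rw [smul_pow_apply, h1, smul_zero]
    · change (N ^ j) z = x at h3
      change ((a • N) ^ j) ((a ^ j)⁻¹ • z) = x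
      rw [smul_pow_apply, map_smul, smul_inv_smul₀ (pow_ne_zero _ ha), h3]

/-- restriction of a homeomorphism to corresponding subspaces -/
lemma finrank_of_corr (h : E ≃ₜ E) (p q : Submodule ℝ E) (hpq : ∀ x, x ∈ p ↔ h x ∈ q) :
    Module.finrank ℝ p = Module.finrank ℝ q := by
  refine finrank_eq_of_homeo (Homeomorph.subtype h hpq)

theorem central_sim (H : OrbEq A B h) (h0 : h 0 = 0) (J : JC A D N) (J' : JC B D' N') :
    ∃ α : ℝ, α ≠ 0 ∧ ∃ Q : CC D ≃ₗ[ℝ] CC D', ∀ x y : CC D, (y : E) = A x → (Q y : E) = α • B (Q x) := by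
  obtain ⟨α, hα, hsp⟩ := speed_FF H h0 J J'
  refine ⟨α, hα, ?_⟩
  have hFF : ∀ j x, x ∈ FF N (CC D) j ↔ h x ∈ FF (α • N') (CC (α • D')) j := by
    intro j x
    rw [FF_smul _ hα, CC_smul _ hα]
    exact FF_map_CC H h0 J J' j x
  have hfl : ∀ {A D N : E →L[ℝ] E} (J : JC A D N) j x, x ∈ FF N (CC D) j → ∀ t, fl D t x = fl A t x := by
    intro A D N J j x hx t
    rw [J.fl, (fl_fixed_iff N x).1 (FF_N J j hx)]
  have J2 := J'.smul α
  have hd : ∀ j w, dims D N j w = dims (α • D') (α • N') j w := by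
    intro j w
    refine dims_eq J J2 j ?_ ?_ w
    · refine finrank_of_corr h _ _ fun x => ?_
      rw [Submodule.mem_inf, Submodule.mem_inf]
      constructor
      · rintro ⟨h1, h2⟩
        have h3 := (hFF j x).1 h1
        refine ⟨h3, ?_⟩
        rw [GG_zero J.ss (FF_CC J j h1)] at h2
        rw [GG_zero J2.ss (FF_CC J2 j h3)]
        have h4 : A x = 0 := by rw [J.sum, ContinuousLinearMap.add_apply, h2, FF_N J j h1, add_zero]
        have h5 := H.fixed_iff.2 h4
        have h6 : (α • B) (h x) = 0 := by rw [ContinuousLinearMap.smul_apply, h5, smul_zero]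
        rw [J2.sum, ContinuousLinearMap.add_apply, FF_N J2 j h3, add_zero] at h6
        exact h6
      · rintro ⟨h3, h2⟩
        have h1 := (hFF j x).2 h3
        refine ⟨h1, ?_⟩
        rw [GG_zero J2.ss (FF_CC J2 j h3)] at h2
        rw [GG_zero J.ss (FF_CC J j h1)]
        have h4 : (α • B) (h x) = 0 := by
          rw [J2.sum, ContinuousLinearMap.add_apply, h2, FF_N J2 j h3, add_zero]
        have h5 := H.fixed_iff.1 ((smul_eq_zero.1 h4).resolve_left hα)
        rw [J.sum, ContinuousLinearMap.add_apply, FF_N J j h1, add_zero] at h5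
        exact h5
    · intro T
      refine finrank_of_corr h _ _ fun x => ?_
      rw [Submodule.mem_inf, Submodule.mem_inf, mem_Fx, mem_Fx, ← hFF]
      refine and_congr_right fun h1 => ?_
      rw [hfl J j x h1, hfl J2 j _ ((hFF j x).1 h1), fl_smul]
      exact hsp x (FF_anti (fun x hx => CC_inv D N J.comm hx) (Nat.zero_le j) h1) T
  obtain ⟨Q, hQ⟩ := sim_of_dims J J2 hd
  have e : CC (α • D') = CC D' := CC_smul _ hα
  refine ⟨Q.trans (LinearEquiv.ofEq _ _ e), fun x y hxy => ?_⟩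
  exact hQ x y hxy

theorem central_neg (J : JC A D N) :
    ∃ Q : CC D ≃ₗ[ℝ] CC D, ∀ x y : CC D, (y : E) = A x → (Q y : E) = -A (Q x) := by
  have h1 : (-1 : ℝ) ≠ 0 := by norm_num
  have J2 := J.smul (-1)
  have hd : ∀ j w, dims D N j w = dims ((-1 : ℝ) • D) ((-1 : ℝ) • N) j w := by
    intro j w
    unfold dims
    rw [FF_smul _ h1, CC_smul _ h1]
    have : GG ((-1 : ℝ) • D) w = GG D w := by
      ext x; rw [mem_GG, mem_GG]; simp
    rw [this]
  obtain ⟨Q, hQ⟩ := sim_of_dims J J2 hd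
  have e : CC ((-1 : ℝ) • D) = CC D := CC_smul _ h1
  refine ⟨Q.trans (LinearEquiv.ofEq _ _ e), fun x y hxy => ?_⟩
  refine (hQ x y hxy).trans ?_
  rw [ContinuousLinearMap.smul_apply, neg_one_smul]; rfl

end CentralSim

end M7e_part

section M7f_part

section TwoSpaces
variable {E : Type*} [NormedAddCommGroup E] [NormedSpace ℝ E] [FiniteDimensional ℝ E] [CompleteSpace E]

lemma precon_compl (V : Submodule ℝ E) (hV : 2 ≤ Module.finrank ℝ V) (y : V) :
    IsPreconnected ({y}ᶜ : Set V) := by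
  have : 1 < Module.rank ℝ V := by
    rw [← Module.finrank_eq_rank]
    exact_mod_cast hV
  exact (isConnected_compl_singleton_of_one_lt_rank this y).isPreconnected

lemma no_inj (V : Submodule ℝ E) (hV : 2 ≤ Module.finrank ℝ V) (f : V → ℝ) (hf : Continuous f)
    (hi : Function.Injective f) : False := by
  have key : ∀ x y z : V, f x < f y → f y < f z → False := by
    intro x y z h1 h2
    have hp := (precon_compl V hV y).image f hf.continuousOn
    have hx : f x ∈ f '' ({y}ᶜ : Set V) := ⟨x, fun e => by rw [Set.mem_singleton_iff] at e; rw [e] at h1; exact lt_irrefl _ h1, rfl⟩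
    have hz : f z ∈ f '' ({y}ᶜ : Set V) := ⟨z, fun e => by rw [Set.mem_singleton_iff] at e; rw [e] at h2; exact lt_irrefl _ h2, rfl⟩
    obtain ⟨w, hw, hw2⟩ := hp.Icc_subset hx hz ⟨h1.le, h2.le⟩
    exact hw (hi hw2)
  have hpos : 0 < Module.finrank ℝ V := by omega
  obtain ⟨v, hv⟩ := Module.finrank_pos_iff_exists_ne_zero.1 hpos
  have n1 : f 0 ≠ f v := fun e => hv (hi e).symm
  have n2 : f v ≠ f ((2 : ℝ) • v) := fun e => by
    have := hi e
    have h3 : ((2 : ℝ) - 1) • v = 0 := by rw [sub_smul, ← this, one_smul, sub_self]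
    exact hv ((smul_eq_zero.1 h3).resolve_left (by norm_num))
  have n3 : f 0 ≠ f ((2 : ℝ) • v) := fun e => by
    have := hi e
    exact hv ((smul_eq_zero.1 this.symm).resolve_left (by norm_num))
  rcases lt_or_gt_of_ne n1 with a | a <;> rcases lt_or_gt_of_ne n2 with b | b <;>
    rcases lt_or_gt_of_ne n3 with c | c
  · exact key _ _ _ a b
  · exact key _ _ _ a b
  · exact key _ _ _ c b
  · exact key _ _ _ c a
  · exact key _ _ _ a c
  · exact key _ _ _ b c
  · exact key _ _ _ b a
  · exact key _ _ _ b a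

lemma one_or_other (h : E ≃ₜ E) (h0 : h 0 = 0) (V W1 W2 : Submodule ℝ E)
    (hV : 2 ≤ Module.finrank ℝ V) (hd : ∀ x ∈ W1, x ∈ W2 → x = 0) (hm : ∀ x ∈ V, h x ∈ W1 ∨ h x ∈ W2) :
    (∀ x ∈ V, h x ∈ W1) ∨ (∀ x ∈ V, h x ∈ W2) := by
  have hc : Continuous (fun x : V => h x) := h.continuous.comp continuous_subtype_val
  have h1 := (isPreconnected_closed_iff.1 (precon_compl V hV 0)) _ _
    ((W1.closed_of_finiteDimensional).preimage hc) ((W2.closed_of_finiteDimensional).preimage hc)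
    (fun x _ => hm x x.2)
  by_contra hcon
  push Not at hcon
  obtain ⟨⟨x, hx, hx1⟩, ⟨y, hy, hy2⟩⟩ := hcon
  have hx2 := (hm x hx).resolve_left hx1
  have hy1 := (hm y hy).resolve_right hy2
  have hx0 : (⟨x, hx⟩ : V) ∈ ({0}ᶜ : Set V) := by
    intro e
    have e : x = 0 := congrArg Subtype.val e
    rw [e, h0] at hx1; exact hx1 W1.zero_mem
  have hy0 : (⟨y, hy⟩ : V) ∈ ({0}ᶜ : Set V) := by
    intro e
    have e : y = 0 := congrArg Subtype.val e
    rw [e, h0] at hy2; exact hy2 W2.zero_mem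
  obtain ⟨z, hz0, hz1, hz2⟩ := h1 ⟨_, hy0, hy1⟩ ⟨_, hx0, hx2⟩
  have hz : h z = 0 := hd _ hz1 hz2
  rw [← h0] at hz
  exact hz0 (Subtype.ext (h.injective hz))

lemma dim_ge_two (h : E ≃ₜ E) (V W : Submodule ℝ E) (hV : 2 ≤ Module.finrank ℝ V)
    (hm : ∀ x ∈ V, h x ∈ W) : 2 ≤ Module.finrank ℝ W := by
  by_contra hcon
  have hle : Module.finrank ℝ W ≤ 1 := by omega
  have hinj : ∃ f : W →ₗ[ℝ] ℝ, Function.Injective f := by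
    rcases Nat.le_one_iff_eq_zero_or_eq_one.1 hle with h1 | h1
    · have := Module.finrank_zero_iff.1 h1
      exact ⟨0, fun x y _ => Subsingleton.elim _ _⟩
    · have e : W ≃ₗ[ℝ] ℝ := LinearEquiv.ofFinrankEq _ _ (by rw [h1, Module.finrank_self])
      exact ⟨e.toLinearMap, e.injective⟩
  obtain ⟨f, hf⟩ := hinj
  refine no_inj V hV (fun x => f ⟨h x, hm x x.2⟩) ?_ ?_
  · exact f.continuous_of_finiteDimensional.comp
      ((h.continuous.comp continuous_subtype_val).subtype_mk _)
  · intro x y hxy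
    have := congrArg Subtype.val (hf hxy)
    exact Subtype.ext (h.injective this)

lemma big_aux (h : E ≃ₜ E) (h0 : h 0 = 0) (V1 V2 W1 W2 : Submodule ℝ E)
    (hV : 2 ≤ Module.finrank ℝ V1) (hdV : ∀ x ∈ V1, x ∈ V2 → x = 0) (hdW : ∀ x ∈ W1, x ∈ W2 → x = 0)
    (hm : ∀ x, (x ∈ V1 ∨ x ∈ V2) ↔ (h x ∈ W1 ∨ h x ∈ W2)) (hin : ∀ x ∈ V1, h x ∈ W1) :
    Module.finrank ℝ V1 = Module.finrank ℝ W1 ∧ Module.finrank ℝ V2 = Module.finrank ℝ W2 := by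
  have hW := dim_ge_two h V1 W1 hV hin
  have h0' : h.symm 0 = 0 := by rw [Homeomorph.symm_apply_eq, h0]
  have hback : ∀ x ∈ W1, h.symm x ∈ V1 := by
    rcases one_or_other h.symm h0' W1 V1 V2 hW hdV (fun x hx => by
      rw [hm, h.apply_symm_apply]; exact Or.inl hx) with h1 | h1
    · exact h1
    · exfalso
      have hpos : 0 < Module.finrank ℝ V1 := by omega
      obtain ⟨v, hv⟩ := Module.finrank_pos_iff_exists_ne_zero.1 hpos
      have := h1 _ (hin v v.2)
      rw [h.symm_apply_apply] at this
      exact hv (Subtype.ext (hdV _ v.2 this))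
  have c1 : ∀ x, x ∈ V1 ↔ h x ∈ W1 := fun x => ⟨hin x, fun hx => by
    have := hback _ hx; rwa [h.symm_apply_apply] at this⟩
  refine ⟨finrank_of_corr h _ _ c1, finrank_of_corr h _ _ fun x => ?_⟩
  by_cases hx0 : x = 0
  · rw [hx0, h0]; exact ⟨fun _ => W2.zero_mem, fun _ => V2.zero_mem⟩
  have hx0' : h x ≠ 0 := fun e => hx0 (h.injective (e.trans h0.symm))
  constructor
  · intro hx
    refine ((hm x).1 (Or.inr hx)).resolve_left fun hw => hx0 (hdV x ((c1 x).2 hw) hx)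
  · intro hx
    refine ((hm x).2 (Or.inr hx)).resolve_left fun hw => hx0' (hdW _ ((c1 x).1 hw) hx)

lemma big (h : E ≃ₜ E) (h0 : h 0 = 0) (V1 V2 W1 W2 : Submodule ℝ E)
    (hV : 2 ≤ Module.finrank ℝ V1) (hdV : ∀ x ∈ V1, x ∈ V2 → x = 0) (hdW : ∀ x ∈ W1, x ∈ W2 → x = 0)
    (hm : ∀ x, (x ∈ V1 ∨ x ∈ V2) ↔ (h x ∈ W1 ∨ h x ∈ W2)) :
    ({Module.finrank ℝ V1, Module.finrank ℝ V2} : Multiset ℕ) = {Module.finrank ℝ W1, Module.finrank ℝ W2} := by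
  rcases one_or_other h h0 V1 W1 W2 hV hdW (fun x hx => (hm x).1 (Or.inl hx)) with h1 | h1
  · obtain ⟨e1, e2⟩ := big_aux h h0 V1 V2 W1 W2 hV hdV hdW hm h1
    rw [e1, e2]
  · obtain ⟨e1, e2⟩ := big_aux h h0 V1 V2 W2 W1 hV hdV (fun x a b => hdW x b a)
      (fun x => (hm x).trans or_comm) h1
    rw [e1, e2, Multiset.pair_comm]

lemma seg_collide (h : E ≃ₜ E) (h0 : h 0 = 0) (W : Submodule ℝ E) (f : W →ₗ[ℝ] ℝ) (hf : Function.Injective f)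
    (x y : E) (hx : ∀ r : ℝ, h (r • x) ∈ W) (hy : ∀ r : ℝ, h (r • y) ∈ W)
    (hxy : ∀ r q : ℝ, 0 ≤ r → 0 ≤ q → r • x = q • y → r • x = 0)
    (hs : 0 < f ⟨h x, by simpa using hx 1⟩ * f ⟨h y, by simpa using hy 1⟩) : False := by
  have hg : ∀ (x : E) (hx : ∀ r : ℝ, h (r • x) ∈ W), Continuous (fun r : ℝ => f ⟨h (r • x), hx r⟩) :=
    fun x hx => f.continuous_of_finiteDimensional.comp
      ((h.continuous.comp (continuous_id.smul continuous_const)).subtype_mk _)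
  have hz : ∀ (x : E) (hx : ∀ r : ℝ, h (r • x) ∈ W), f ⟨h ((0 : ℝ) • x), hx 0⟩ = 0 := by
    intro x hx
    have : (⟨h ((0 : ℝ) • x), hx 0⟩ : W) = 0 := Subtype.ext (by simp [h0])
    rw [this, map_zero]
  have hone : ∀ (x : E) (hx : ∀ r : ℝ, h (r • x) ∈ W),
      f ⟨h ((1 : ℝ) • x), hx 1⟩ = f ⟨h x, by simpa using hx 1⟩ := by
    intro x hx
    congr 1
    exact Subtype.ext (by simp)
  set a := f ⟨h x, by simpa using hx 1⟩ with ha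
  set b := f ⟨h y, by simpa using hy 1⟩ with hb
  have ex : ∃ c : ℝ, c ≠ 0 ∧ c ∈ Set.uIcc 0 a ∧ c ∈ Set.uIcc 0 b := by
    rcases lt_trichotomy a 0 with h1 | h1 | h1
    · have h2 : b < 0 := by nlinarith
      refine ⟨max a b, (max_lt h1 h2).ne, ?_, ?_⟩
      · rw [Set.uIcc_of_ge h1.le]; exact ⟨le_max_left _ _, (max_lt h1 h2).le⟩
      · rw [Set.uIcc_of_ge h2.le]; exact ⟨le_max_right _ _, (max_lt h1 h2).le⟩
    · rw [h1, zero_mul] at hs; exact absurd hs (lt_irrefl _)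
    · have h2 : 0 < b := by nlinarith
      refine ⟨min a b, (lt_min h1 h2).ne', ?_, ?_⟩
      · rw [Set.uIcc_of_le h1.le]; exact ⟨(lt_min h1 h2).le, min_le_left _ _⟩
      · rw [Set.uIcc_of_le h2.le]; exact ⟨(lt_min h1 h2).le, min_le_right _ _⟩
  obtain ⟨c, hc, hca, hcb⟩ := ex
  have i1 := intermediate_value_uIcc (a := 0) (b := 1) (hg x hx).continuousOn
  have i2 := intermediate_value_uIcc (a := 0) (b := 1) (hg y hy).continuousOn
  rw [hz x hx, hone x hx] at i1
  rw [hz y hy, hone y hy] at i2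
  obtain ⟨r, hr, hrc⟩ := i1 hca
  obtain ⟨q, hq, hqc⟩ := i2 hcb
  rw [Set.uIcc_of_le zero_le_one] at hr hq
  simp only at hrc hqc
  have e := hf (hrc.trans hqc.symm)
  have e2 := h.injective (congrArg Subtype.val e)
  have e3 := hxy r q hr.1 hq.1 e2
  apply hc
  rw [← hrc]
  have : (⟨h (r • x), hx r⟩ : W) = 0 := Subtype.ext (by simp [e3, h0])
  rw [this, map_zero]

lemma small (h : E ≃ₜ E) (h0 : h 0 = 0) (V1 V2 W1 W2 : Submodule ℝ E)
    (hV1 : Module.finrank ℝ V1 ≤ 1) (hV2 : Module.finrank ℝ V2 ≤ 1) (hW1 : Module.finrank ℝ W1 ≤ 1)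
    (hW2 : Module.finrank ℝ W2 ≤ 1)
    (hdV : ∀ x ∈ V1, x ∈ V2 → x = 0) 
    (hm : ∀ x, (x ∈ V1 ∨ x ∈ V2) → (h x ∈ W1 ∨ h x ∈ W2)) :
    Module.finrank ℝ V1 + Module.finrank ℝ V2 ≤ Module.finrank ℝ W1 + Module.finrank ℝ W2 := by
  have hz : ∀ {V : Submodule ℝ E}, Module.finrank ℝ V = 0 → ∀ x ∈ V, x = 0 := by
    intro V hV x hx
    rw [Submodule.finrank_eq_zero.1 hV] at hx
    exact hx
  have hex : ∀ {V : Submodule ℝ E}, Module.finrank ℝ V ≠ 0 → ∃ x ∈ V, x ≠ 0 := by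
    intro V hV
    obtain ⟨v, hv⟩ := Module.finrank_pos_iff_exists_ne_zero.1 (Nat.pos_of_ne_zero hV)
    exact ⟨v, v.2, fun e => hv (Subtype.ext e)⟩
  have hne : ∀ x, x ≠ 0 → h x ≠ 0 := fun x hx e => hx (h.injective (e.trans h0.symm))
  by_contra hcon
  by_cases hW0 : Module.finrank ℝ W1 = 0 ∧ Module.finrank ℝ W2 = 0
  · have : ∃ x, (x ∈ V1 ∨ x ∈ V2) ∧ x ≠ 0 := by
      by_cases h1 : Module.finrank ℝ V1 = 0
      · obtain ⟨x, hx, hx0⟩ := hex (V := V2) (by omega)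
        exact ⟨x, Or.inr hx, hx0⟩
      · obtain ⟨x, hx, hx0⟩ := hex h1
        exact ⟨x, Or.inl hx, hx0⟩
    obtain ⟨x, hx, hx0⟩ := this
    rcases hm x hx with h1 | h1
    · exact hne x hx0 (hz hW0.1 _ h1)
    · exact hne x hx0 (hz hW0.2 _ h1)
  obtain ⟨W, hW, hmW⟩ : ∃ W : Submodule ℝ E, Module.finrank ℝ W = 1 ∧ ∀ x, (x ∈ V1 ∨ x ∈ V2) → h x ∈ W := by
    by_cases h1 : Module.finrank ℝ W1 = 0
    · refine ⟨W2, by omega, fun x hx => ?_⟩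
      rcases hm x hx with h2 | h2
      · rw [hz h1 _ h2]; exact W2.zero_mem
      · exact h2
    · refine ⟨W1, by omega, fun x hx => ?_⟩
      rcases hm x hx with h2 | h2
      · exact h2
      · rw [hz (by omega : Module.finrank ℝ W2 = 0) _ h2]; exact W1.zero_mem
  obtain ⟨s, hs, hs0⟩ := hex (V := V1) (by omega)
  obtain ⟨u, hu, hu0⟩ := hex (V := V2) (by omega)
  let e : W ≃ₗ[ℝ] ℝ := LinearEquiv.ofFinrankEq _ _ (by rw [hW, Module.finrank_self])
  have m1 : ∀ r : ℝ, h (r • s) ∈ W := fun r => hmW _ (Or.inl (V1.smul_mem _ hs))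
  have m2 : ∀ r : ℝ, h (r • (-s)) ∈ W := fun r => hmW _ (Or.inl (V1.smul_mem _ (V1.neg_mem hs)))
  have m3 : ∀ r : ℝ, h (r • u) ∈ W := fun r => hmW _ (Or.inr (V2.smul_mem _ hu))
  have c1 := seg_collide h h0 W e.toLinearMap e.injective s (-s) m1 m2 (by
    intro r q hr hq e
    have e1 : (r + q) • s = 0 := by rw [add_smul, e, smul_neg, neg_add_cancel]
    have e2 := (smul_eq_zero.1 e1).resolve_right hs0
    have : r = 0 := by linarith
    rw [this, zero_smul])
  have c2 := seg_collide h h0 W e.toLinearMap e.injective s u m1 m3 (by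
    intro r q hr hq e
    exact hdV _ (V1.smul_mem _ hs) (e ▸ V2.smul_mem _ hu))
  have c3 := seg_collide h h0 W e.toLinearMap e.injective (-s) u m2 m3 (by
    intro r q hr hq e
    exact hdV _ (V1.smul_mem _ (V1.neg_mem hs)) (e ▸ V2.smul_mem _ hu))
  have nz : ∀ x (hx : h x ∈ W), x ≠ 0 → e ⟨h x, hx⟩ ≠ 0 := by
    intro x hx hx0 he
    rw [LinearEquiv.map_eq_zero_iff] at he
    exact hne x hx0 (congrArg Subtype.val he)
  have n1 := nz s (by simpa using m1 1) hs0
  have n2 := nz (-s) (by simpa using m2 1) (neg_ne_zero.2 hs0)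
  have n3 := nz u (by simpa using m3 1) hu0
  simp only [LinearEquiv.coe_coe] at c1 c2 c3
  rcases lt_or_gt_of_ne n1 with a | a <;> rcases lt_or_gt_of_ne n2 with b | b <;>
    rcases lt_or_gt_of_ne n3 with c | c
  · exact c1 (mul_pos_of_neg_of_neg a b)
  · exact c1 (mul_pos_of_neg_of_neg a b)
  · exact c2 (mul_pos_of_neg_of_neg a c)
  · exact c3 (mul_pos b c)
  · exact c3 (mul_pos_of_neg_of_neg b c)
  · exact c2 (mul_pos a c)
  · exact c1 (mul_pos a b)
  · exact c1 (mul_pos a b)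

theorem two_spaces (h : E ≃ₜ E) (h0 : h 0 = 0) (V1 V2 W1 W2 : Submodule ℝ E)
    (hdV : ∀ x ∈ V1, x ∈ V2 → x = 0) (hdW : ∀ x ∈ W1, x ∈ W2 → x = 0)
    (hm : ∀ x, (x ∈ V1 ∨ x ∈ V2) ↔ (h x ∈ W1 ∨ h x ∈ W2)) :
    ({Module.finrank ℝ V1, Module.finrank ℝ V2} : Multiset ℕ) = {Module.finrank ℝ W1, Module.finrank ℝ W2} := by
  have h0' : h.symm 0 = 0 := by rw [Homeomorph.symm_apply_eq, h0]
  have hm' : ∀ x, (x ∈ W1 ∨ x ∈ W2) ↔ (h.symm x ∈ V1 ∨ h.symm x ∈ V2) := fun x => by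
    rw [hm, h.apply_symm_apply]
  by_cases a1 : 2 ≤ Module.finrank ℝ V1
  · exact big h h0 V1 V2 W1 W2 a1 hdV hdW hm
  by_cases a2 : 2 ≤ Module.finrank ℝ V2
  · rw [Multiset.pair_comm]
    exact big h h0 V2 V1 W1 W2 a2 (fun x a b => hdV x b a) hdW (fun x => or_comm.trans (hm x))
  by_cases a3 : 2 ≤ Module.finrank ℝ W1
  · exact (big h.symm h0' W1 W2 V1 V2 a3 hdW hdV hm').symm
  by_cases a4 : 2 ≤ Module.finrank ℝ W2
  · rw [Multiset.pair_comm (Module.finrank ℝ W1)]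
    exact (big h.symm h0' W2 W1 V1 V2 a4 (fun x a b => hdW x b a) hdV (fun x => or_comm.trans (hm' x))).symm
  have b1 := small h h0 V1 V2 W1 W2 (by omega) (by omega) (by omega) (by omega) hdV (fun x => (hm x).1)
  have b2 := small h.symm h0' W1 W2 V1 V2 (by omega) (by omega) (by omega) (by omega) hdW (fun x => (hm' x).1)
  have : (Module.finrank ℝ V1 = Module.finrank ℝ W1 ∧ Module.finrank ℝ V2 = Module.finrank ℝ W2) ∨
      (Module.finrank ℝ V1 = Module.finrank ℝ W2 ∧ Module.finrank ℝ V2 = Module.finrank ℝ W1) := by omega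
  rcases this with ⟨e1, e2⟩ | ⟨e1, e2⟩
  · rw [e1, e2]
  · rw [e1, e2, Multiset.pair_comm]

variable {A D N B D' N' : E →L[ℝ] E} {h : E ≃ₜ E}

lemma img_SU (H : OrbEq A B h) (h0 : h 0 = 0) (J : JC A D N) (J' : JC B D' N') (x : E)
    (hx : x ∈ SS D ∨ x ∈ UU D) : h x ∈ SS D' ∨ h x ∈ UU D' := by
  rw [J.memS_iff, J.memU_iff] at hx
  by_cases hA : A x = 0
  · have h1 : ∀ t, fl A t x = x := (fl_fixed_iff A x).1 hA
    simp only [h1] at hx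
    have hx0 : x = 0 := by
      rcases hx with hx | hx
      · exact tendsto_nhds_unique tendsto_const_nhds hx
      · exact tendsto_nhds_unique tendsto_const_nhds hx
    left
    rw [hx0, h0]
    exact Submodule.zero_mem _
  have hB : B (h x) ≠ 0 := fun e => hA (H.fixed_iff.1 e)
  rw [J'.memS_iff, J'.memU_iff]
  set σ := lft B A h.symm (h x) with hσ
  have e1 : ∀ s, fl B s (h x) = h (fl A (σ s) x) := by
    intro s
    have := H.symm.lft_eq hB s
    rw [h.symm_apply_apply] at this
    rw [hσ, ← this, h.apply_symm_apply]
  have hs : Function.Surjective σ := H.symm.lft_surj hB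
  have key : ∀ l l' : Filter ℝ, Tendsto σ l l' → Tendsto (fun t => fl A t x) l' (𝓝 0) →
      Tendsto (fun t => fl B t (h x)) l (𝓝 0) := by
    intro l l' h1 h2
    simp only [e1]
    have h3 : Tendsto h (𝓝 0) (𝓝 0) := by
      have := h.continuous.tendsto 0
      rwa [h0] at this
    exact h3.comp (h2.comp h1)
  rcases H.symm.lft_mono hB with hm | hm
  · have t1 : Tendsto σ atTop atTop := hm.monotone.tendsto_atTop_atTop fun b =>
      let ⟨a, ha⟩ := hs b; ⟨a, ha.ge⟩
    have t2 : Tendsto σ atBot atBot := hm.monotone.tendsto_atBot_atBot fun b =>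
      let ⟨a, ha⟩ := hs b; ⟨a, ha.le⟩
    rcases hx with hx | hx
    · exact Or.inl (key _ _ t1 hx)
    · exact Or.inr (key _ _ t2 hx)
  · have t1 : Tendsto σ atTop atBot := tendsto_atTop_atBot.2 fun b =>
      let ⟨a, ha⟩ := hs b; ⟨a, fun c hc => (hm.antitone hc).trans ha.le⟩
    have t2 : Tendsto σ atBot atTop := tendsto_atBot_atTop.2 fun b =>
      let ⟨a, ha⟩ := hs b; ⟨a, fun c hc => ha.ge.trans (hm.antitone hc)⟩
    rcases hx with hx | hx
    · exact Or.inr (key _ _ t2 hx)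
    · exact Or.inl (key _ _ t1 hx)

lemma SU_disj (D : E →L[ℝ] E) (x : E) (hs : x ∈ SS D) (hu : x ∈ UU D) : x = 0 :=
  (SUC_indep D hs ((UU D).neg_mem hu) (CC D).zero_mem (by simp)).1

theorem dims_SU (H : OrbEq A B h) (h0 : h 0 = 0) (J : JC A D N) (J' : JC B D' N') :
    ({Module.finrank ℝ (SS D), Module.finrank ℝ (UU D)} : Multiset ℕ) =
      {Module.finrank ℝ (SS D'), Module.finrank ℝ (UU D')} := by
  refine two_spaces h h0 _ _ _ _ (SU_disj D) (SU_disj D') fun x => ⟨img_SU H h0 J J' x, fun hx => ?_⟩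
  have := img_SU H.symm (by rw [Homeomorph.symm_apply_eq, h0]) J' J (h x) hx
  rwa [h.symm_apply_apply] at this

end TwoSpaces

end M7f_part

section M8a_part

section StableConj
variable {V : Type*} [NormedAddCommGroup V] [NormedSpace ℝ V] [CompleteSpace V]
variable {W : Type*} [NormedAddCommGroup W] [NormedSpace ℝ W] [CompleteSpace W]

/-- An adapted norm for a stable linear flow. -/
structure Lyap (A : V →L[ℝ] V) (p : V → ℝ) (c K : ℝ) : Prop where
  cpos : 0 < c
  Kpos : 0 < K
  lo : ∀ x, ‖x‖ ≤ p x
  hi : ∀ x, p x ≤ K * ‖x‖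
  tri : ∀ x y, p x ≤ p y + K * ‖x - y‖
  hom : ∀ (a : ℝ) x, 0 ≤ a → p (a • x) = a * p x
  dec : ∀ s x, 0 ≤ s → p (fl A s x) ≤ Real.exp (-(c * s)) * p x

lemma exists_Lyap (A : V →L[ℝ] V) {c K : ℝ} (hc : 0 < c) (hK : 0 < K)
    (hA : ∀ x, ∀ t : ℝ, 0 ≤ t → ‖fl A t x‖ ≤ K * Real.exp (-(c * t)) * ‖x‖) :
    ∃ p, Lyap A p c K := by
  let F : V → Set.Ici (0:ℝ) → ℝ := fun x t => Real.exp (c * t) * ‖fl A t x‖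
  have hF : ∀ x t, F x t ≤ K * ‖x‖ := by
    intro x t
    have h1 := mul_le_mul_of_nonneg_left (hA x t t.2) (Real.exp_pos (c * t)).le
    refine h1.trans (le_of_eq ?_)
    have : Real.exp (c * t) * Real.exp (-(c * t)) = 1 := by rw [← Real.exp_add]; simp
    linear_combination (K * ‖x‖) * this
  have hbd : ∀ x, BddAbove (Set.range (F x)) := fun x => ⟨K * ‖x‖, by rintro _ ⟨t, rfl⟩; exact hF x t⟩
  have hle : ∀ x t, F x t ≤ ⨆ t, F x t := fun x t => le_ciSup (hbd x) t
  have hhi : ∀ x, (⨆ t, F x t) ≤ K * ‖x‖ := fun x => ciSup_le (hF x)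
  refine ⟨fun x => ⨆ t, F x t, hc, hK, ?_, hhi, ?_, ?_, ?_⟩
  · intro x
    have := hle x ⟨0, Set.mem_Ici.2 le_rfl⟩
    simpa [F, fl_zero_apply] using this
  · intro x y
    refine ciSup_le fun t => ?_
    have h1 := hle y t
    have h2 := hF (x - y) t
    have h3 : F x t ≤ F y t + F (x - y) t := by
      simp only [F, ← mul_add]
      gcongr
      have : fl A t x = fl A t y + fl A t (x - y) := by rw [← map_add]; congr 1; abel
      rw [this]
      exact norm_add_le _ _
    linarith
  · intro a x ha
    change (⨆ t, F (a • x) t) = a * ⨆ t, F x t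
    rw [Real.mul_iSup_of_nonneg ha]
    congr 1
    funext t
    simp only [F, map_smul, norm_smul, Real.norm_eq_abs, abs_of_nonneg ha]
    ring
  · intro s x hs
    refine ciSup_le fun t => ?_
    have h1 := hle x ⟨t + s, add_nonneg t.2 hs⟩
    have h2 : F (fl A s x) t = Real.exp (-(c * s)) * F x ⟨t + s, add_nonneg t.2 hs⟩ := by
      simp only [F, fl_add_apply]
      rw [← mul_assoc, ← Real.exp_add]
      congr 2
      ring
    rw [h2]
    gcongr

namespace Lyap
variable {A : V →L[ℝ] V} {p : V → ℝ} {c K : ℝ}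

lemma zero (h : Lyap A p c K) : p 0 = 0 := by
  have := h.hom 0 0 le_rfl
  simpa using this

lemma pos (h : Lyap A p c K) {x : V} (hx : x ≠ 0) : 0 < p x := (norm_pos_iff.2 hx).trans_le (h.lo x)

lemma nonneg (h : Lyap A p c K) (x : V) : 0 ≤ p x := (norm_nonneg x).trans (h.lo x)

lemma cont (h : Lyap A p c K) : Continuous p := by
  have : LipschitzWith ⟨K, h.Kpos.le⟩ p := LipschitzWith.of_le_add_mul _ fun x y => by
    rw [dist_eq_norm]; exact h.tri x y
  exact this.continuous

lemma anti (h : Lyap A p c K) {x : V} (hx : x ≠ 0) : StrictAnti fun t => p (fl A t x) := by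
  intro s t hst
  have h1 := h.dec (t - s) (fl A s x) (by linarith)
  rw [← fl_add_apply, sub_add_cancel] at h1
  have h2 : fl A s x ≠ 0 := fun e => hx (by rw [← fl_neg_apply A s x, e, map_zero])
  have h3 : Real.exp (-(c * (t - s))) < 1 := by
    rw [Real.exp_lt_one_iff]
    have := mul_pos h.cpos (sub_pos.2 hst)
    linarith
  have h4 := h.pos h2
  simp only
  nlinarith

lemma exists_tau (h : Lyap A p c K) {x : V} (hx : x ≠ 0) : ∃ t, p (fl A t x) = 1 := by
  have hp := h.pos hx
  have hcont : Continuous fun t => p (fl A t x) := h.cont.comp (fl_cont_t A x)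
  -- large time
  have ht1 : ∃ t, p (fl A t x) ≤ 1 := by
    refine ⟨p x / c, ?_⟩
    have h1 := h.dec (p x / c) x (div_nonneg hp.le h.cpos.le)
    rw [mul_div_cancel₀ _ h.cpos.ne'] at h1
    refine h1.trans ?_
    rw [Real.exp_neg, inv_mul_le_iff₀ (Real.exp_pos _), mul_one]
    linarith [Real.add_one_le_exp (p x)]
  have ht2 : ∃ t, 1 ≤ p (fl A t x) := by
    refine ⟨-((p x)⁻¹ / c), ?_⟩
    have h1 := h.dec ((p x)⁻¹ / c) (fl A (-((p x)⁻¹ / c)) x) (div_nonneg (inv_nonneg.2 hp.le) h.cpos.le)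
    rw [mul_div_cancel₀ _ h.cpos.ne', fl_apply_neg, Real.exp_neg, ← div_eq_inv_mul,
      le_div_iff₀ (Real.exp_pos _)] at h1
    refine le_trans ?_ h1
    have := Real.add_one_le_exp (p x)⁻¹
    calc (1:ℝ) = p x * (p x)⁻¹ := by rw [mul_inv_cancel₀ hp.ne']
      _ ≤ _ := by gcongr; linarith
  obtain ⟨t1, h1⟩ := ht1
  obtain ⟨t2, h2⟩ := ht2
  exact mem_range_of_exists_le_of_exists_ge hcont ⟨t1, h1⟩ ⟨t2, h2⟩

end Lyap

/-- hitting time of the unit sphere -/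
def hit (A : V →L[ℝ] V) (p : V → ℝ) (x : V) : ℝ := Classical.epsilon fun t => p (fl A t x) = 1

namespace Lyap
variable {A : V →L[ℝ] V} {p : V → ℝ} {c K : ℝ}

lemma hit_spec (h : Lyap A p c K) {x : V} (hx : x ≠ 0) : p (fl A (hit A p x) x) = 1 :=
  Classical.epsilon_spec (h.exists_tau hx)

lemma hit_unique (h : Lyap A p c K) {x : V} (hx : x ≠ 0) {t : ℝ} (ht : p (fl A t x) = 1) :
    hit A p x = t := (h.anti hx).injective ((h.hit_spec hx).trans ht.symm)

lemma hit_le (h : Lyap A p c K) {x : V} (hx : x ≠ 0) {t : ℝ} : p (fl A t x) ≤ 1 ↔ hit A p x ≤ t := by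
  rw [← h.hit_spec hx]; exact (h.anti hx).le_iff_ge

lemma fl_ne (A : V →L[ℝ] V) {x : V} (hx : x ≠ 0) (t : ℝ) : fl A t x ≠ 0 :=
  fun e => hx (by rw [← fl_neg_apply A t x, e, map_zero])

lemma hit_fl (h : Lyap A p c K) {x : V} (hx : x ≠ 0) (s : ℝ) : hit A p (fl A s x) = hit A p x - s := by
  apply h.hit_unique (fl_ne A hx s)
  rw [← fl_add_apply, sub_add_cancel, h.hit_spec hx]

end Lyap

/-- normalised linear map and the conjugacy -/
def nrm (q : W → ℝ) (L : V ≃L[ℝ] W) (u : V) : W := (q (L u))⁻¹ • L u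

def cj (A : V →L[ℝ] V) (p : V → ℝ) (B : W →L[ℝ] W) (q : W → ℝ) (L : V ≃L[ℝ] W) (x : V) : W :=
  fl B (-(hit A p x)) (nrm q L (fl A (hit A p x) x))

variable {A : V →L[ℝ] V} {p : V → ℝ} {c K : ℝ} {B : W →L[ℝ] W} {q : W → ℝ} {c' K' : ℝ}

lemma nrm_q (h' : Lyap B q c' K') (L : V ≃L[ℝ] W) {u : V} (hu : u ≠ 0) : q (nrm q L u) = 1 := by
  have h1 : L u ≠ 0 := by simpa using hu
  have := h'.pos h1
  rw [nrm, h'.hom _ _ (inv_nonneg.2 this.le), inv_mul_cancel₀ this.ne']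

lemma nrm_ne (h' : Lyap B q c' K') (L : V ≃L[ℝ] W) {u : V} (hu : u ≠ 0) : nrm q L u ≠ 0 := by
  intro e
  have := nrm_q h' L hu
  rw [e, h'.zero] at this
  exact zero_ne_one this

lemma nrm_inv (h : Lyap A p c K) (h' : Lyap B q c' K') (L : V ≃L[ℝ] W) {u : V} (hu : p u = 1) :
    nrm p L.symm (nrm q L u) = u := by
  have hu0 : u ≠ 0 := by rintro rfl; rw [h.zero] at hu; exact zero_ne_one hu
  have h1 : L u ≠ 0 := by simpa using hu0
  have := h'.pos h1
  rw [nrm, nrm, map_smul, L.symm_apply_apply, h.hom _ _ (inv_nonneg.2 this.le), hu, mul_one, inv_inv,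
    smul_smul, mul_inv_cancel₀ this.ne', one_smul]

lemma cj_zero (A : V →L[ℝ] V) (p : V → ℝ) (B : W →L[ℝ] W) (q : W → ℝ) (L : V ≃L[ℝ] W) :
    cj A p B q L 0 = 0 := by simp [cj, nrm]

lemma cj_fl (h : Lyap A p c K) (B : W →L[ℝ] W) (q : W → ℝ) (L : V ≃L[ℝ] W) (s : ℝ) (x : V) :
    cj A p B q L (fl A s x) = fl B s (cj A p B q L x) := by
  by_cases hx : x = 0
  · subst hx; simp only [map_zero, cj_zero]
  rw [cj, cj, h.hit_fl hx, ← fl_add_apply, sub_add_cancel, ← fl_add_apply]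
  congr 2
  ring

lemma cj_ne (h : Lyap A p c K) (h' : Lyap B q c' K') (L : V ≃L[ℝ] W) {x : V} (hx : x ≠ 0) :
    cj A p B q L x ≠ 0 := Lyap.fl_ne B (nrm_ne h' L (Lyap.fl_ne A hx _)) _

lemma cj_hit (h : Lyap A p c K) (h' : Lyap B q c' K') (L : V ≃L[ℝ] W) {x : V} (hx : x ≠ 0) :
    hit B q (cj A p B q L x) = hit A p x := by
  apply h'.hit_unique (cj_ne h h' L hx)
  rw [cj, fl_apply_neg, nrm_q h' L (Lyap.fl_ne A hx _)]

lemma cj_inv (h : Lyap A p c K) (h' : Lyap B q c' K') (L : V ≃L[ℝ] W) (x : V) :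
    cj B q A p L.symm (cj A p B q L x) = x := by
  by_cases hx : x = 0
  · subst hx; simp only [cj_zero]
  rw [cj, cj_hit h h' L hx]
  conv_lhs => rw [cj]
  rw [fl_apply_neg, nrm_inv h h' L (h.hit_spec hx), fl_neg_apply]

end StableConj

end M8a_part

section M8b_part

/-- Hölder condition near zero -/
def HN {V W : Type*} [NormedAddCommGroup V] [NormedAddCommGroup W] (γ : ℝ) (f : V → W) : Prop :=
  ∃ r > (0:ℝ), ∃ C, 0 ≤ C ∧ ∀ x y, ‖x‖ < r → ‖y‖ < r → ‖f x - f y‖ ≤ C * ‖x - y‖ ^ γ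

section StableConj2
variable {V : Type*} [NormedAddCommGroup V] [NormedSpace ℝ V] [CompleteSpace V]
variable {W : Type*} [NormedAddCommGroup W] [NormedSpace ℝ W] [CompleteSpace W]

lemma fl_growth_pos (A : V →L[ℝ] V) (x : V) {t : ℝ} (ht : 0 ≤ t) :
    ‖fl A t x‖ ≤ Real.exp (‖A‖ * t) * ‖x‖ := by
  have := norm_le_gronwallBound_of_norm_deriv_right_le (f := fun t => fl A t x)
    (f' := fun t => A (fl A t x)) (δ := ‖x‖) (K := ‖A‖) (ε := 0) (a := 0) (b := t)
    (fl_cont_t A x).continuousOn (fun s _ => (fl_hasDerivAt A x s).hasDerivWithinAt)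
    (by rw [fl_zero_apply]) (fun s _ => by rw [add_zero]; exact A.le_opNorm _) t ⟨ht, le_rfl⟩
  rw [gronwallBound_ε0, sub_zero] at this
  linarith

lemma fl_growth (A : V →L[ℝ] V) (x : V) (t : ℝ) :
    ‖fl A t x‖ ≤ Real.exp (‖A‖ * |t|) * ‖x‖ := by
  rcases le_total 0 t with ht | ht
  · rw [abs_of_nonneg ht]; exact fl_growth_pos A x ht
  · rw [abs_of_nonpos ht]
    have := fl_growth_pos (-A) x (neg_nonneg.2 ht)
    rwa [fl_neg, neg_neg, norm_neg] at this

lemma fl_sub_pos (A : V →L[ℝ] V) (x : V) {t : ℝ} (ht : 0 ≤ t) :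
    ‖fl A t x - x‖ ≤ ‖A‖ * Real.exp (‖A‖ * t) * ‖x‖ * t := by
  have := norm_image_sub_le_of_norm_deriv_le_segment' (f := fun t => fl A t x)
    (f' := fun t => A (fl A t x)) (a := 0) (b := t) (C := ‖A‖ * Real.exp (‖A‖ * t) * ‖x‖)
    (fun s _ => (fl_hasDerivAt A x s).hasDerivWithinAt) (fun s hs => by
      refine (A.le_opNorm _).trans ?_
      rw [mul_assoc]
      gcongr
      refine (fl_growth_pos A x hs.1).trans ?_
      gcongr
      exact hs.2.le) t ⟨ht, le_rfl⟩
  simpa [fl_zero_apply] using this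

lemma fl_sub (A : V →L[ℝ] V) (x : V) (t : ℝ) :
    ‖fl A t x - x‖ ≤ ‖A‖ * Real.exp (‖A‖ * |t|) * ‖x‖ * |t| := by
  rcases le_total 0 t with ht | ht
  · rw [abs_of_nonneg ht]; exact fl_sub_pos A x ht
  · rw [abs_of_nonpos ht]
    have := fl_sub_pos (-A) x (neg_nonneg.2 ht)
    rwa [fl_neg, neg_neg, norm_neg] at this

variable {A : V →L[ℝ] V} {p : V → ℝ} {c K : ℝ} {B : W →L[ℝ] W} {q : W → ℝ} {c' K' : ℝ}

lemma Lyap.bound (h : Lyap A p c K) (x : V) {t : ℝ} (ht : 0 ≤ t) :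
    ‖fl A t x‖ ≤ K * Real.exp (-(c * t)) * ‖x‖ := by
  have h1 := h.dec t x ht
  have h2 := mul_le_mul_of_nonneg_left (h.hi x) (Real.exp_pos (-(c * t))).le
  linarith [h.lo (fl A t x)]

lemma nrm_norm (h' : Lyap B q c' K') (L : V ≃L[ℝ] W) (u : V) : ‖nrm q L u‖ ≤ 1 := by
  by_cases hu : u = 0
  · subst hu; simp [nrm]
  · exact (h'.lo _).trans (nrm_q h' L hu).le

lemma nrm_lip (h : Lyap A p c K) (h' : Lyap B q c' K') (L : V ≃L[ℝ] W) :
    ∃ C, 0 ≤ C ∧ ∀ u v, p u = 1 → p v = 1 → ‖nrm q L u - nrm q L v‖ ≤ C * ‖u - v‖ := by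
  set l := ‖(L : V →L[ℝ] W)‖ with hl
  set m := ‖(L.symm : W →L[ℝ] V)‖ with hm
  have hl0 : 0 ≤ l := norm_nonneg _
  have hm0 : 0 ≤ m := norm_nonneg _
  have hK := h.Kpos
  have hK' := h'.Kpos
  refine ⟨K * m * (l + K' * l), by positivity, fun u v hu hv => ?_⟩
  have ne : ∀ u, p u = 1 → u ≠ 0 := by rintro u hu rfl; rw [h.zero] at hu; exact zero_ne_one hu
  have hLu : L u ≠ 0 := by simpa using ne u hu
  have hLv : L v ≠ 0 := by simpa using ne v hv
  have qu := h'.pos hLu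
  have qv := h'.pos hLv
  -- q (L u) bounded below
  have low : 1 ≤ K * m * q (L u) := by
    have h1 : ‖u‖ ≤ m * ‖L u‖ := by
      have := (L.symm : W →L[ℝ] V).le_opNorm (L u)
      simpa using this
    calc (1:ℝ) = p u := hu.symm
      _ ≤ K * ‖u‖ := h.hi u
      _ ≤ K * (m * ‖L u‖) := by gcongr
      _ ≤ K * (m * q (L u)) := by gcongr; exact h'.lo _
      _ = _ := by ring
  have hinv : (q (L u))⁻¹ ≤ K * m := by
    rw [inv_le_iff_one_le_mul₀ qu]; exact low
  have hL : ‖L u - L v‖ ≤ l * ‖u - v‖ := by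
    rw [← map_sub]; exact (L : V →L[ℝ] W).le_opNorm _
  have hq : |q (L v) - q (L u)| ≤ K' * ‖L u - L v‖ := by
    rw [abs_le]
    have a := h'.tri (L u) (L v)
    have b := h'.tri (L v) (L u)
    rw [norm_sub_rev] at b
    constructor <;> linarith
  have key : nrm q L u - nrm q L v = (q (L u))⁻¹ • ((L u - L v) + (q (L v) - q (L u)) • nrm q L v) := by
    rw [nrm, nrm, smul_add, smul_sub, smul_smul, smul_smul, mul_assoc]
    have : (q (L u))⁻¹ * ((q (L v) - q (L u)) * (q (L v))⁻¹) = (q (L u))⁻¹ - (q (L v))⁻¹ := by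
      field_simp
    rw [this, sub_smul]
    abel
  rw [key, norm_smul, Real.norm_eq_abs, abs_of_pos (inv_pos.2 qu)]
  have h5 : ‖(L u - L v) + (q (L v) - q (L u)) • nrm q L v‖ ≤ (l + K' * l) * ‖u - v‖ := by
    refine (norm_add_le _ _).trans ?_
    rw [norm_smul, Real.norm_eq_abs]
    have h6 : |q (L v) - q (L u)| * ‖nrm q L v‖ ≤ |q (L v) - q (L u)| :=
      mul_le_of_le_one_right (abs_nonneg _) (nrm_norm h' L v)
    have h7 : K' * ‖L u - L v‖ ≤ K' * (l * ‖u - v‖) := by gcongr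
    linarith
  calc _ ≤ K * m * ((l + K' * l) * ‖u - v‖) := by gcongr
    _ = _ := by ring

/-- one-sided Lipschitz estimate on the unit sphere -/
lemma cj_lip (h : Lyap A p c K) (h' : Lyap B q c' K') (L : V ≃L[ℝ] W) :
    ∃ C, 0 ≤ C ∧ ∀ u v, p u = 1 → p v ≤ 1 →
      ‖cj A p B q L u - cj A p B q L v‖ ≤ C * ‖u - v‖ := by
  obtain ⟨M, hM, hlip⟩ := nrm_lip h h' L
  have hK := h.Kpos
  have hK' := h'.Kpos
  have hc := h.cpos
  set T := 1 / c with hT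
  have hT0 : 0 < T := by positivity
  set a := ‖A‖ * Real.exp (‖A‖ * T) with ha
  set b := ‖B‖ * Real.exp (‖B‖ * T) with hb
  have ha0 : 0 ≤ a := by positivity
  have hb0 : 0 ≤ b := by positivity
  have ne : ∀ u, p u = 1 → u ≠ 0 := by rintro u hu rfl; rw [h.zero] at hu; exact zero_ne_one hu
  have bdd : ∀ v, p v ≤ 1 → ‖cj A p B q L v‖ ≤ K' := by
    intro v hv
    by_cases hv0 : v = 0
    · subst hv0; rw [cj_zero, norm_zero]; exact hK'.le
    have ht : hit A p v ≤ 0 := by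
      rw [← h.hit_le hv0, fl_zero_apply]; exact hv
    rw [cj]
    have h1 := h'.bound (nrm q L (fl A (hit A p v) v)) (neg_nonneg.2 ht)
    have h2 : Real.exp (-(c' * -hit A p v)) ≤ 1 := by
      rw [Real.exp_le_one_iff]
      nlinarith [h'.cpos]
    refine h1.trans ?_
    have h3 := nrm_norm h' L (fl A (hit A p v) v)
    calc _ ≤ K' * 1 * 1 := by gcongr
      _ = K' := by ring
  refine ⟨4 * K * K' + (b * (2 * K / c) + M * (a * (2 * K / c) + 1)), by positivity, fun u v hu hv => ?_⟩
  have hD : 0 ≤ ‖u - v‖ := norm_nonneg _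
  have hpv : 1 - p v ≤ K * ‖u - v‖ := by
    have := h.tri u v
    rw [hu] at this; linarith
  by_cases hv2 : p v < 1 / 2
  · have h1 : ‖cj A p B q L u - cj A p B q L v‖ ≤ 2 * K' :=
      (norm_sub_le _ _).trans (by linarith [bdd u hu.le, bdd v hv])
    have h2 : 1 ≤ 2 * K * ‖u - v‖ := by linarith
    have h3 : 0 ≤ (b * (2 * K / c) + M * (a * (2 * K / c) + 1)) * ‖u - v‖ := by positivity
    nlinarith
  push Not at hv2
  have hv0 : v ≠ 0 := by rintro rfl; rw [h.zero] at hv2; norm_num at hv2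
  set τ := hit A p v with hτ
  have ht : τ ≤ 0 := by
    rw [hτ, ← h.hit_le hv0, fl_zero_apply]; exact hv
  have hsp := h.hit_spec hv0
  have pv0 : 0 < p v := h.pos hv0
  -- bound on the hitting time
  have h1 : -τ ≤ (1 - p v) * (2 / c) := by
    have h2 := h.dec (-τ) (fl A τ v) (by linarith)
    rw [fl_neg_apply, hsp, mul_one] at h2
    have h3 : Real.exp (c * -τ) * p v ≤ 1 := by
      have := mul_le_mul_of_nonneg_left h2 (Real.exp_pos (c * -τ)).le
      rwa [← Real.exp_add, add_neg_cancel, Real.exp_zero] at this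
    have h4 := Real.add_one_le_exp (c * -τ)
    have h5 : (c * -τ + 1) * p v ≤ 1 := (mul_le_mul_of_nonneg_right h4 pv0.le).trans h3
    have h6 : 0 ≤ c * -τ := by nlinarith
    rw [mul_div_assoc', le_div_iff₀ hc]
    nlinarith
  have h1' : |τ| ≤ 2 * K / c * ‖u - v‖ := by
    rw [abs_of_nonpos ht]
    refine h1.trans ?_
    calc (1 - p v) * (2 / c) ≤ K * ‖u - v‖ * (2 / c) := by gcongr
      _ = _ := by ring
  have h1'' : |τ| ≤ T := by
    rw [abs_of_nonpos ht]
    refine h1.trans ?_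
    calc (1 - p v) * (2 / c) ≤ (1 / 2) * (2 / c) := by gcongr; linarith
      _ = T := by rw [hT]; ring
  have hu' : cj A p B q L u = nrm q L u := by
    have : hit A p u = 0 := h.hit_unique (ne u hu) (by rw [fl_zero_apply, hu])
    rw [cj, this, neg_zero, fl_zero_apply, fl_zero_apply]
  set w := fl A τ v with hw
  have e1 : ‖nrm q L u - nrm q L w‖ ≤ M * (a * (2 * K / c) + 1) * ‖u - v‖ := by
    refine (hlip u w hu hsp).trans ?_
    have h2 : ‖w - v‖ ≤ a * (2 * K / c) * ‖u - v‖ := by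
      refine (fl_sub A v τ).trans ?_
      have hv1 : ‖v‖ ≤ 1 := (h.lo v).trans hv
      calc _ ≤ ‖A‖ * Real.exp (‖A‖ * T) * 1 * (2 * K / c * ‖u - v‖) := by gcongr
        _ = _ := by rw [ha]; ring
    have h3 : ‖u - w‖ ≤ ‖u - v‖ + ‖w - v‖ := by
      have : u - w = (u - v) - (w - v) := by abel
      rw [this]; exact norm_sub_le _ _
    calc M * ‖u - w‖ ≤ M * (‖u - v‖ + a * (2 * K / c) * ‖u - v‖) := by gcongr; linarith
      _ = _ := by ring
  have e2 : ‖fl B (-τ) (nrm q L w) - nrm q L w‖ ≤ b * (2 * K / c) * ‖u - v‖ := by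
    refine (fl_sub B _ (-τ)).trans ?_
    rw [abs_neg]
    have := nrm_norm h' L w
    calc _ ≤ ‖B‖ * Real.exp (‖B‖ * T) * 1 * (2 * K / c * ‖u - v‖) := by gcongr
        _ = _ := by rw [hb]; ring
  have e3 : cj A p B q L v = fl B (-τ) (nrm q L w) := rfl
  rw [hu', e3]
  have e4 : nrm q L u - fl B (-τ) (nrm q L w) =
      (nrm q L u - nrm q L w) - (fl B (-τ) (nrm q L w) - nrm q L w) := by abel
  rw [e4]
  refine (norm_sub_le _ _).trans ?_
  have h3 : 0 ≤ 4 * K * K' * ‖u - v‖ := by positivity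
  linarith

lemma cj_holder (h : Lyap A p c K) (h' : Lyap B q c' K') (L : V ≃L[ℝ] W) :
    ∃ γ : ℝ, 0 < γ ∧ γ ≤ 1 ∧ HN γ (cj A p B q L) := by
  obtain ⟨C, hC, hlip⟩ := cj_lip h h' L
  have hK := h.Kpos
  have hK' := h'.Kpos
  have hc := h.cpos
  have hc' := h'.cpos
  set b := ‖A‖ + c' with hb
  have hb0 : 0 < b := by positivity
  have hγ0 : 0 < c' / b := by positivity
  have hγ1 : c' / b ≤ 1 := by rw [div_le_one hb0, hb]; linarith [norm_nonneg A]
  set γ := c' / b with hγ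
  refine ⟨γ, hγ0, hγ1, K⁻¹, inv_pos.2 hK, K' * C * 2, by positivity, ?_⟩
  have key : ∀ x y, p x ≤ 1 → x ≠ 0 → p (fl A (hit A p x) y) ≤ 1 →
      ‖cj A p B q L x - cj A p B q L y‖ ≤ K' * C * 2 * ‖x - y‖ ^ γ := by
    intro x y hx hx0 hy
    set τ := hit A p x with hτ
    have ht : τ ≤ 0 := by
      rw [hτ, ← h.hit_le hx0, fl_zero_apply]; exact hx
    have hsp : p (fl A τ x) = 1 := h.hit_spec hx0
    set u := fl A τ x with hu
    set v := fl A τ y with hv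
    have e1 : cj A p B q L x - cj A p B q L y = fl B (-τ) (cj A p B q L u - cj A p B q L v) := by
      rw [map_sub, ← cj_fl h, ← cj_fl h, hu, hv, fl_neg_apply, fl_neg_apply]
    have e2 := h'.bound (cj A p B q L u - cj A p B q L v) (neg_nonneg.2 ht)
    rw [← e1] at e2
    have e3 := hlip u v hsp hy
    have w1 : ‖u - v‖ ≤ 2 := by
      refine (norm_sub_le _ _).trans ?_
      linarith [h.lo u, h.lo v]
    have w2 : ‖u - v‖ ≤ Real.exp (b * -τ) * ‖x - y‖ := by
      rw [hu, hv, ← map_sub]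
      refine (fl_growth A _ _).trans ?_
      rw [abs_of_nonpos ht]
      gcongr
      · linarith
      · rw [hb]; linarith
    have w3 : ‖u - v‖ ≤ 2 * (Real.exp (c' * -τ) * ‖x - y‖ ^ γ) := by
      rcases eq_or_lt_of_le (norm_nonneg (u - v)) with h0 | h0
      · rw [← h0]; positivity
      have a1 : ‖u - v‖ = ‖u - v‖ ^ (1 - γ) * ‖u - v‖ ^ γ := by
        rw [← Real.rpow_add h0]; simp
      rw [a1]
      have a2 : ‖u - v‖ ^ (1 - γ) ≤ 2 := by
        calc ‖u - v‖ ^ (1 - γ) ≤ (2:ℝ) ^ (1 - γ) := by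
              apply Real.rpow_le_rpow h0.le w1; linarith
          _ ≤ (2:ℝ) ^ (1:ℝ) := by
              apply Real.rpow_le_rpow_of_exponent_le (by norm_num); linarith
          _ = 2 := by simp
      have a3 : ‖u - v‖ ^ γ ≤ Real.exp (c' * -τ) * ‖x - y‖ ^ γ := by
        refine (Real.rpow_le_rpow h0.le w2 hγ0.le).trans (le_of_eq ?_)
        rw [Real.mul_rpow (Real.exp_pos _).le (norm_nonneg _), ← Real.exp_mul]
        congr 2
        rw [hγ]; field_simp
      gcongr
    refine e2.trans ?_
    have w4 : Real.exp (-(c' * -τ)) * Real.exp (c' * -τ) = 1 := by rw [← Real.exp_add]; simp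
    calc K' * Real.exp (-(c' * -τ)) * ‖cj A p B q L u - cj A p B q L v‖
        ≤ K' * Real.exp (-(c' * -τ)) * (C * (2 * (Real.exp (c' * -τ) * ‖x - y‖ ^ γ))) := by
          gcongr
          exact e3.trans (by gcongr)
      _ = K' * C * 2 * ‖x - y‖ ^ γ * (Real.exp (-(c' * -τ)) * Real.exp (c' * -τ)) := by ring
      _ = _ := by rw [w4, mul_one]
  intro x y hx hy
  have pb : ∀ x, ‖x‖ < K⁻¹ → p x ≤ 1 := by
    intro x hx
    refine (h.hi x).trans ?_
    calc K * ‖x‖ ≤ K * K⁻¹ := by gcongr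
      _ = 1 := mul_inv_cancel₀ hK.ne'
  by_cases hx0 : x = 0
  · by_cases hy0 : y = 0
    · subst hx0; subst hy0; simp only [sub_self, norm_zero]; positivity
    · rw [norm_sub_rev, norm_sub_rev x]
      apply key y x (pb y hy) hy0
      rw [hx0, map_zero, h.zero]; exact zero_le_one
  by_cases hy0 : y = 0
  · apply key x y (pb x hx) hx0
    rw [hy0, map_zero, h.zero]; exact zero_le_one
  rcases le_total (hit A p y) (hit A p x) with hle | hle
  · exact key x y (pb x hx) hx0 ((h.hit_le hy0).2 hle)
  · rw [norm_sub_rev, norm_sub_rev x]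
    exact key y x (pb y hy) hy0 ((h.hit_le hx0).2 hle)

lemma HN.cont {γ : ℝ} (hγ : 0 < γ) {f : V → W} (hf : HN γ f) : ∃ r > (0:ℝ), ContinuousOn f (Metric.ball 0 r) := by
  obtain ⟨r, hr, C, hC, hb⟩ := hf
  refine ⟨r, hr, fun x hx => ?_⟩
  rw [ContinuousWithinAt, tendsto_iff_norm_sub_tendsto_zero]
  have h1 : Tendsto (fun y : V => C * ‖y - x‖ ^ γ) (𝓝[Metric.ball 0 r] x) (𝓝 0) := by
    have : Continuous fun y : V => C * ‖y - x‖ ^ γ :=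
      continuous_const.mul ((continuous_norm.comp (continuous_id.sub continuous_const)).rpow_const
        fun _ => Or.inr hγ.le)
    have h2 := (this.tendsto x).mono_left (nhdsWithin_le_nhds (s := Metric.ball 0 r))
    simpa [Real.zero_rpow hγ.ne'] using h2
  refine squeeze_zero' (Eventually.of_forall fun y => norm_nonneg _) ?_ h1
  filter_upwards [self_mem_nhdsWithin] with y hy
  rw [Metric.mem_ball, dist_zero_right] at hx hy
  exact hb y x hy hx

lemma cj_cont (h : Lyap A p c K) (h' : Lyap B q c' K') (L : V ≃L[ℝ] W) :
    Continuous (cj A p B q L) := by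
  obtain ⟨γ, hγ, -, hN⟩ := cj_holder h h' L
  obtain ⟨r, hr, hcont⟩ := hN.cont hγ
  rw [continuous_iff_continuousAt]
  intro x
  have hlim : Tendsto (fun t => fl A t x) atTop (𝓝 0) := by
    refine squeeze_zero_norm' (a := fun t => K * Real.exp (-(c * t)) * ‖x‖) ?_ ?_
    · filter_upwards [eventually_ge_atTop 0] with t ht
      exact h.bound x ht
    · have h1 : Tendsto (fun t : ℝ => Real.exp (-(c * t))) atTop (𝓝 0) := by
        refine Real.tendsto_exp_atBot.comp ?_
        exact tendsto_neg_atTop_atBot.comp (tendsto_id.const_mul_atTop h.cpos)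
      simpa using (h1.const_mul K).mul_const ‖x‖
  obtain ⟨s, hs⟩ := (hlim.eventually (Metric.ball_mem_nhds 0 hr)).exists
  have e : cj A p B q L = fun y => fl B (-s) (cj A p B q L (fl A s y)) := by
    funext y
    rw [cj_fl h, fl_neg_apply]
  rw [e]
  have h1 : ContinuousAt (cj A p B q L) (fl A s x) :=
    hcont.continuousAt (Metric.isOpen_ball.mem_nhds hs)
  exact (fl B (-s)).continuous.continuousAt.comp
    (ContinuousAt.comp (f := fun y => fl A s y) h1 (fl A s).continuous.continuousAt)

theorem stable_conj (h : Lyap A p c K) (h' : Lyap B q c' K') (L : V ≃L[ℝ] W) :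
    ∃ H : V ≃ₜ W, H 0 = 0 ∧ (∀ t x, H (fl A t x) = fl B t (H x)) ∧
      (∃ γ : ℝ, 0 < γ ∧ γ ≤ 1 ∧ HN γ H) ∧ ∃ γ : ℝ, 0 < γ ∧ γ ≤ 1 ∧ HN γ H.symm :=
  ⟨{ toFun := cj A p B q L
     invFun := cj B q A p L.symm
     left_inv := cj_inv h h' L
     right_inv := by
      intro y
      have := cj_inv h' h L.symm y
      rwa [L.symm_symm] at this
     continuous_toFun := cj_cont h h' L
     continuous_invFun := cj_cont h' h L.symm },
    cj_zero _ _ _ _ _, fun t x => cj_fl h B q L t x, cj_holder h h' L, cj_holder h' h L.symm⟩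

end StableConj2

end M8b_part

section M8c_part

section HNlem
variable {U V W Z : Type*} [NormedAddCommGroup U] [NormedSpace ℝ U] [NormedAddCommGroup V] [NormedSpace ℝ V]
  [NormedAddCommGroup W] [NormedSpace ℝ W] [NormedAddCommGroup Z] [NormedSpace ℝ Z]

lemma HN.weaken {γ γ' : ℝ} {f : V → W} (hf : HN γ f) (h0 : 0 < γ') (h : γ' ≤ γ) : HN γ' f := by
  obtain ⟨r, hr, C, hC, hb⟩ := hf
  refine ⟨min r (1 / 2), by positivity, C, hC, fun x y hx hy => ?_⟩
  have hx1 := hx.trans_le (min_le_left _ _)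
  have hx2 := hx.trans_le (min_le_right _ _)
  have hy1 := hy.trans_le (min_le_left _ _)
  have hy2 := hy.trans_le (min_le_right _ _)
  refine (hb x y hx1 hy1).trans ?_
  gcongr 1
  rcases eq_or_lt_of_le (norm_nonneg (x - y)) with h1 | h1
  · rw [← h1, Real.zero_rpow (h0.trans_le h).ne', Real.zero_rpow h0.ne']
  · exact Real.rpow_le_rpow_of_exponent_ge h1 ((norm_sub_le _ _).trans (by linarith)) h

lemma HN.add {γ : ℝ} {f g : V → W} (hf : HN γ f) (hg : HN γ g) : HN γ (fun x => f x + g x) := by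
  obtain ⟨r, hr, C, hC, hb⟩ := hf
  obtain ⟨r', hr', C', hC', hb'⟩ := hg
  refine ⟨min r r', by positivity, C + C', by positivity, fun x y hx hy => ?_⟩
  have h1 := hb x y (hx.trans_le (min_le_left _ _)) (hy.trans_le (min_le_left _ _))
  have h2 := hb' x y (hx.trans_le (min_le_right _ _)) (hy.trans_le (min_le_right _ _))
  have : f x + g x - (f y + g y) = (f x - f y) + (g x - g y) := by abel
  rw [this, add_mul]
  exact (norm_add_le _ _).trans (add_le_add h1 h2)

lemma HN.comp_lin {γ : ℝ} (h0 : 0 < γ) {f : V → W} (hf : HN γ f) (L : U →L[ℝ] V) (M : W →L[ℝ] Z) :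
    HN γ (fun x => M (f (L x))) := by
  obtain ⟨r, hr, C, hC, hb⟩ := hf
  have hl : 0 < ‖L‖ + 1 := by positivity
  refine ⟨r / (‖L‖ + 1), by positivity, ‖M‖ * (C * (‖L‖ + 1) ^ γ), by positivity, fun x y hx hy => ?_⟩
  have hL : ∀ x, ‖L x‖ ≤ (‖L‖ + 1) * ‖x‖ := fun x =>
    (L.le_opNorm x).trans (by gcongr; linarith)
  have hlt : ∀ x, ‖x‖ < r / (‖L‖ + 1) → ‖L x‖ < r := fun x hx => by
    rw [lt_div_iff₀ hl] at hx
    exact (hL x).trans_lt (by linarith)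
  rw [← map_sub]
  refine (M.le_opNorm _).trans ?_
  rw [mul_assoc]
  gcongr
  refine (hb _ _ (hlt x hx) (hlt y hy)).trans ?_
  rw [mul_assoc]
  gcongr
  rw [← Real.mul_rpow hl.le (norm_nonneg _), ← map_sub]
  exact Real.rpow_le_rpow (norm_nonneg _) (hL _) h0.le

lemma HN_lin (L : V →L[ℝ] W) : HN 1 L :=
  ⟨1, one_pos, ‖L‖, norm_nonneg _, fun x y _ _ => by
    rw [← map_sub, Real.rpow_one]; exact L.le_opNorm _⟩

end HNlem

section Glue
variable {E : Type*} [NormedAddCommGroup E] [NormedSpace ℝ E] [FiniteDimensional ℝ E] [CompleteSpace E]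

/-- restriction of an operator to an invariant subspace -/
def rst (A : E →L[ℝ] E) (V : Submodule ℝ E) (hV : ∀ x ∈ V, A x ∈ V) : V →L[ℝ] V :=
  (A.comp V.subtypeL).codRestrict V (fun x => hV x x.2)

lemma rst_coe (A : E →L[ℝ] E) (V : Submodule ℝ E) (hV : ∀ x ∈ V, A x ∈ V) (x : V) :
    (rst A V hV x : E) = A x := rfl

lemma rst_fl (A : E →L[ℝ] E) (V : Submodule ℝ E) [CompleteSpace V]
    (hV : ∀ x ∈ V, A x ∈ V) (t : ℝ) (x : V) : (fl (rst A V hV) t x : E) = fl A t x := by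
  have := fl_unique A (fun t => (fl (rst A V hV) t x : E)) (fun t => by
    have h1 := V.subtypeL.hasFDerivAt.comp_hasDerivAt t (fl_hasDerivAt (rst A V hV) x t)
    exact h1) t
  rw [fl_zero_apply] at this
  exact this

variable {A D N B D' N' : E →L[ℝ] E}

lemma S_conj (J : JC A D N) (J' : JC B D' N')
    (hd : Module.finrank ℝ (SS D) = Module.finrank ℝ (SS D')) :
    ∃ H : SS D ≃ₜ SS D', (∀ (t : ℝ) (x y : SS D), (y : E) = fl A t x → (H y : E) = fl B t (H x)) ∧
      (∃ γ : ℝ, 0 < γ ∧ γ ≤ 1 ∧ HN γ H) ∧ (∃ γ : ℝ, 0 < γ ∧ γ ≤ 1 ∧ HN γ H.symm) ∧ H 0 = 0 := by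
  have := FiniteDimensional.complete ℝ (SS D)
  have := FiniteDimensional.complete ℝ (SS D')
  have hA : ∀ x ∈ SS D, A x ∈ SS D := fun x hx => SS_inv D A J.commA hx
  have hB : ∀ x ∈ SS D', B x ∈ SS D' := fun x hx => SS_inv D' B J'.commA hx
  obtain ⟨c, K, hc, hK, hb⟩ := J.boundS
  obtain ⟨c', K', hc', hK', hb'⟩ := J'.boundS
  obtain ⟨p, hp⟩ := exists_Lyap (rst A (SS D) hA) hc hK (fun x t ht => by
    have := hb x x.2 t ht
    rw [← rst_fl A (SS D) hA] at this
    exact this)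
  obtain ⟨q, hq⟩ := exists_Lyap (rst B (SS D') hB) hc' hK' (fun x t ht => by
    have := hb' x x.2 t ht
    rw [← rst_fl B (SS D') hB] at this
    exact this)
  obtain ⟨H, h0, h1, h2, h3⟩ := stable_conj hp hq (ContinuousLinearEquiv.ofFinrankEq hd)
  refine ⟨H, fun t x y hy => ?_, h2, h3, h0⟩
  have : y = fl (rst A (SS D) hA) t x := Subtype.ext (by rw [hy, rst_fl])
  rw [this, h1, rst_fl]

lemma U_conj (J : JC A D N) (J' : JC B D' N')
    (hd : Module.finrank ℝ (UU D) = Module.finrank ℝ (UU D')) :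
    ∃ H : UU D ≃ₜ UU D', (∀ (t : ℝ) (x y : UU D), (y : E) = fl A t x → (H y : E) = fl B t (H x)) ∧
      (∃ γ : ℝ, 0 < γ ∧ γ ≤ 1 ∧ HN γ H) ∧ (∃ γ : ℝ, 0 < γ ∧ γ ≤ 1 ∧ HN γ H.symm) ∧ H 0 = 0 := by
  obtain ⟨H, h1, h2⟩ := S_conj J.neg J'.neg hd
  refine ⟨H, fun t x y hy => ?_, h2⟩
  have := h1 (-t) x y (by rw [fl_neg, neg_neg]; exact hy)
  rwa [fl_neg, neg_neg] at this

lemma C_conj (J : JC A D N) (J' : JC B D' N') (Q : CC D ≃ₗ[ℝ] CC D')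
    (hQ : ∀ x y : CC D, (y : E) = A x → (Q y : E) = B (Q x)) (t : ℝ) (x y : CC D)
    (hy : (y : E) = fl A t x) : (Q y : E) = fl B t (Q x) := by
  have := FiniteDimensional.complete ℝ (CC D)
  have hA : ∀ x ∈ CC D, A x ∈ CC D := fun x hx => CC_inv D A J.commA hx
  have e : y = fl (rst A (CC D) hA) t x := Subtype.ext (by rw [hy, rst_fl])
  let L : CC D →L[ℝ] E := LinearMap.toContinuousLinearMap ((CC D').subtype.comp (Q : CC D →ₗ[ℝ] CC D'))
  have hL : ∀ z, L z = (Q z : E) := fun z => rfl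
  have := fl_unique B (fun t => L (fl (rst A (CC D) hA) t x)) (fun t => by
    have h1 := L.hasFDerivAt.comp_hasDerivAt t (fl_hasDerivAt (rst A (CC D) hA) x t)
    have h2 : L (rst A (CC D) hA (fl (rst A (CC D) hA) t x)) = B (L (fl (rst A (CC D) hA) t x)) := by
      rw [hL, hL]
      exact hQ _ _ (rst_coe _ _ _ _)
    rw [h2] at h1
    exact h1) t
  rw [fl_zero_apply] at this
  rw [e]
  exact this

/-- gluing maps on the three invariant subspaces -/
def glue (pS : E →L[ℝ] SS D) (pU : E →L[ℝ] UU D) (pC : E →L[ℝ] CC D) (HS : SS D → SS D')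
    (HU : UU D → UU D') (HC : CC D → CC D') (x : E) : E :=
  (HS (pS x) : E) + (HU (pU x) : E) + (HC (pC x) : E)

lemma glue_HN {pS : E →L[ℝ] SS D} {pU : E →L[ℝ] UU D} {pC : E →L[ℝ] CC D} {HS : SS D → SS D'}
    {HU : UU D → UU D'} {HC : CC D → CC D'} {γ : ℝ} (hγ : 0 < γ) (h1 : HN γ HS) (h2 : HN γ HU)
    (h3 : HN γ HC) : HN γ (glue pS pU pC HS HU HC) :=
  ((h1.comp_lin hγ pS (SS D').subtypeL).add (h2.comp_lin hγ pU (UU D').subtypeL)).add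
    (h3.comp_lin hγ pC (CC D').subtypeL)

lemma glue_cont {pS : E →L[ℝ] SS D} {pU : E →L[ℝ] UU D} {pC : E →L[ℝ] CC D} {HS : SS D → SS D'}
    {HU : UU D → UU D'} {HC : CC D → CC D'} (h1 : Continuous HS) (h2 : Continuous HU)
    (h3 : Continuous HC) : Continuous (glue pS pU pC HS HU HC) :=
  ((continuous_subtype_val.comp (h1.comp pS.continuous)).add
    (continuous_subtype_val.comp (h2.comp pU.continuous))).add
    (continuous_subtype_val.comp (h3.comp pC.continuous))

lemma exists_proj3 (D : E →L[ℝ] E) (hD : Module.End.IsSemisimple (D : E →ₗ[ℝ] E)) : ∃ (pS : E →L[ℝ] SS D) (pU : E →L[ℝ] UU D) (pC : E →L[ℝ] CC D),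
    (∀ x, (pS x : E) + pU x + pC x = x) ∧
    (∀ (s : SS D) (u : UU D) (c : CC D), pS ((s : E) + u + c) = s ∧ pU ((s : E) + u + c) = u ∧
      pC ((s : E) + u + c) = c) ∧
    ∀ L : E →L[ℝ] E, (∀ x, L (D x) = D (L x)) → ∀ x, (pS (L x) : E) = L (pS x) ∧
      (pU (L x) : E) = L (pU x) ∧ (pC (L x) : E) = L (pC x) := by
  obtain ⟨PS, PU, PC, h1, h2, h3, h4⟩ := exists_proj D hD
  have hP : SProj D PS PU PC := ⟨h1, h2, h3, h4⟩
  refine ⟨PS.codRestrict _ h1, PU.codRestrict _ h2, PC.codRestrict _ h3, h4, ?_, ?_⟩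
  · intro s u c
    have := hP.uniq s.2 u.2 c.2
    exact ⟨Subtype.ext this.1, Subtype.ext this.2.1, Subtype.ext this.2.2⟩
  · intro L hL x
    exact hP.comm L hL x

theorem conj_one (J : JC A D N) (J' : JC B D' N')
    (hS : Module.finrank ℝ (SS D) = Module.finrank ℝ (SS D'))
    (hU : Module.finrank ℝ (UU D) = Module.finrank ℝ (UU D'))
    (Q : CC D ≃ₗ[ℝ] CC D') (hQ : ∀ x y : CC D, (y : E) = A x → (Q y : E) = B (Q x)) :
    ∃ h : E ≃ₜ E, h 0 = 0 ∧ (∀ t x, h (fl A t x) = fl B t (h x)) ∧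
      ∃ γ : ℝ, 0 < γ ∧ HN γ h ∧ HN γ h.symm := by
  obtain ⟨HS, cS, ⟨γ1, hγ1, l1, n1⟩, ⟨γ2, hγ2, l2, n2⟩, zS⟩ := S_conj J J' hS
  obtain ⟨HU, cU, ⟨γ3, hγ3, l3, n3⟩, ⟨γ4, hγ4, l4, n4⟩, zU⟩ := U_conj J J' hU
  have cC := C_conj J J' Q hQ
  obtain ⟨pS, pU, pC, a1, a2, a3⟩ := exists_proj3 D J.ss
  obtain ⟨qS, qU, qC, b1, b2, b3⟩ := exists_proj3 D' J'.ss
  let Q' : CC D ≃L[ℝ] CC D' := Q.toContinuousLinearEquiv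
  let f := glue pS pU pC HS HU Q'
  let g := glue qS qU qC HS.symm HU.symm Q'.symm
  have e1 : ∀ x, g (f x) = x := by
    intro x
    obtain ⟨u1, u2, u3⟩ := b2 (HS (pS x)) (HU (pU x)) (Q' (pC x))
    change ((HS.symm (qS (f x)) : SS D) : E) + (HU.symm (qU (f x)) : UU D) + (Q'.symm (qC (f x)) : CC D) = x
    have : f x = (HS (pS x) : E) + (HU (pU x) : E) + (Q' (pC x) : E) := rfl
    rw [this, u1, u2, u3, HS.symm_apply_apply, HU.symm_apply_apply, Q'.symm_apply_apply, a1]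
  have e2 : ∀ x, f (g x) = x := by
    intro x
    obtain ⟨u1, u2, u3⟩ := a2 (HS.symm (qS x)) (HU.symm (qU x)) (Q'.symm (qC x))
    change ((HS (pS (g x)) : SS D') : E) + (HU (pU (g x)) : UU D') + (Q' (pC (g x)) : CC D') = x
    have : g x = (HS.symm (qS x) : E) + (HU.symm (qU x) : E) + (Q'.symm (qC x) : E) := rfl
    rw [this, u1, u2, u3, HS.apply_symm_apply, HU.apply_symm_apply, Q'.apply_symm_apply, b1]
  let γ := min (min γ1 γ2) (min γ3 γ4)
  have hγ : 0 < γ := by positivity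
  have g1 : γ ≤ γ1 := (min_le_left _ _).trans (min_le_left _ _)
  have g2 : γ ≤ γ2 := (min_le_left _ _).trans (min_le_right _ _)
  have g3 : γ ≤ γ3 := (min_le_right _ _).trans (min_le_left _ _)
  have g4 : γ ≤ γ4 := (min_le_right _ _).trans (min_le_right _ _)
  have hq1 : HN γ (fun x => Q' x) := (HN_lin (Q' : CC D →L[ℝ] CC D')).weaken hγ (g1.trans l1)
  have hq2 : HN γ (fun x => Q'.symm x) := (HN_lin (Q'.symm : CC D' →L[ℝ] CC D)).weaken hγ (g1.trans l1)
  refine ⟨⟨⟨f, g, e1, e2⟩, glue_cont HS.continuous HU.continuous Q'.continuous,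
    glue_cont HS.symm.continuous HU.symm.continuous Q'.symm.continuous⟩, ?_, ?_, γ, hγ, ?_, ?_⟩
  · change ((HS (pS 0) : SS D') : E) + (HU (pU 0) : UU D') + (Q' (pC 0) : CC D') = 0
    rw [map_zero pS, map_zero pU, map_zero pC, map_zero Q', zS, zU]
    simp
  · intro t x
    obtain ⟨u1, u2, u3⟩ := a3 (fl A t) (J.fl_commD t) x
    change ((HS (pS (fl A t x)) : SS D') : E) + (HU (pU (fl A t x)) : UU D') + (Q' (pC (fl A t x)) : CC D') =
      fl B t ((HS (pS x) : E) + (HU (pU x) : E) + (Q' (pC x) : E))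
    rw [map_add, map_add, cS t _ _ u1, cU t _ _ u2]
    congr 1
    exact cC t _ _ u3
  · exact glue_HN hγ (n1.weaken hγ g1) (n3.weaken hγ g3) hq1
  · exact glue_HN hγ (n2.weaken hγ g2) (n4.weaken hγ g4) hq2

end Glue

end M8c_part

section M8d_part

section ConjMain
variable {E : Type*} [NormedAddCommGroup E] [NormedSpace ℝ E] [FiniteDimensional ℝ E] [CompleteSpace E]
variable {A D N B D' N' : E →L[ℝ] E}

lemma SS_smul_pos (J : JC A D N) {a : ℝ} (ha : 0 < a) : SS (a • D) = SS D := by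
  ext x
  rw [(J.smul a).memS_iff, J.memS_iff]
  simp only [fl_smul]
  constructor
  · intro h
    have h1 : Tendsto (fun t : ℝ => a⁻¹ * t) atTop atTop := tendsto_id.const_mul_atTop (inv_pos.2 ha)
    refine (h.comp h1).congr fun t => ?_
    simp only [Function.comp_apply]
    rw [mul_inv_cancel_left₀ ha.ne']
  · intro h
    exact h.comp (tendsto_id.const_mul_atTop ha)

lemma UU_smul_pos (J : JC A D N) {a : ℝ} (ha : 0 < a) : UU (a • D) = UU D := by
  have := SS_smul_pos J.neg ha
  rw [smul_neg] at this
  exact this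

lemma SS_smul_neg (J : JC A D N) {a : ℝ} (ha : a < 0) : SS (a • D) = UU D := by
  have := SS_smul_pos J.neg (neg_pos.2 ha)
  rw [smul_neg, neg_smul, neg_neg] at this
  exact this

lemma UU_smul_neg (J : JC A D N) {a : ℝ} (ha : a < 0) : UU (a • D) = SS D := by
  have := UU_smul_pos J.neg (neg_pos.2 ha)
  rw [smul_neg, neg_smul, neg_neg] at this
  rw [this, UU, neg_neg]

theorem conj_main (J : JC A D N) (J' : JC B D' N')
    (hd : ({Module.finrank ℝ (SS D), Module.finrank ℝ (UU D)} : Multiset ℕ) =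
      {Module.finrank ℝ (SS D'), Module.finrank ℝ (UU D')})
    {α : ℝ} (hα : α ≠ 0) (Q : CC D ≃ₗ[ℝ] CC D')
    (hQ : ∀ x y : CC D, (y : E) = A x → (Q y : E) = α • B (Q x)) :
    ∃ (h : E ≃ₜ E) (β : ℝ), β ≠ 0 ∧ h 0 = 0 ∧ (∀ t x, h (fl A t x) = fl B (β * t) (h x)) ∧
      ∃ γ : ℝ, 0 < γ ∧ HN γ h ∧ HN γ h.symm := by
  -- the sign of the time scale may be chosen freely
  have hboth : ∀ β : ℝ, β = α ∨ β = -α → ∃ Q : CC D ≃ₗ[ℝ] CC D', ∀ x y : CC D, (y : E) = A x →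
      (Q y : E) = β • B (Q x) := by
    rintro β (rfl | rfl)
    · exact ⟨Q, hQ⟩
    · obtain ⟨R, hR⟩ := central_neg J
      refine ⟨R.trans Q, fun x y hxy => ?_⟩
      have h1 := hR x y hxy
      have hz : A (R x) ∈ CC D := CC_inv D A J.commA (R x).2
      have h2 : R y = -(⟨A (R x), hz⟩ : CC D) := Subtype.ext h1
      have h3 := hQ (R x) ⟨A (R x), hz⟩ rfl
      rw [LinearEquiv.trans_apply, LinearEquiv.trans_apply, h2, map_neg, Submodule.coe_neg, h3, neg_smul]
  have fin : ∀ β : ℝ, β ≠ 0 → (β = α ∨ β = -α) →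
      Module.finrank ℝ (SS D) = Module.finrank ℝ (SS (β • D')) →
      Module.finrank ℝ (UU D) = Module.finrank ℝ (UU (β • D')) → 
      ∃ (h : E ≃ₜ E) (β : ℝ), β ≠ 0 ∧ h 0 = 0 ∧ (∀ t x, h (fl A t x) = fl B (β * t) (h x)) ∧
      ∃ γ : ℝ, 0 < γ ∧ HN γ h ∧ HN γ h.symm := by
    intro β hβ hβ' e1 e2
    obtain ⟨Q, hQ⟩ := hboth β hβ'
    have e : CC D' = CC (β • D') := (CC_smul _ hβ).symm
    obtain ⟨h, h0, h1, h2⟩ := conj_one J (J'.smul β) e1 e2 (Q.trans (LinearEquiv.ofEq _ _ e))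
      (fun x y hxy => hQ x y hxy)
    refine ⟨h, β, hβ, h0, fun t x => ?_, h2⟩
    rw [h1, fl_smul]
  have hcases : (Module.finrank ℝ (SS D) = Module.finrank ℝ (SS D') ∧
      Module.finrank ℝ (UU D) = Module.finrank ℝ (UU D')) ∨
      (Module.finrank ℝ (SS D) = Module.finrank ℝ (UU D') ∧
      Module.finrank ℝ (UU D) = Module.finrank ℝ (SS D')) := by
    have : ∀ a b c d : ℕ, ({a, b} : Multiset ℕ) = {c, d} → (a = c ∧ b = d) ∨ (a = d ∧ b = c) := by
      intro a b c d h
      have hs := congrArg Multiset.sum h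
      have ha : a ∈ ({c, d} : Multiset ℕ) := h ▸ (by simp)
      simp at hs ha
      omega
    exact this _ _ _ _ hd
  have ha : 0 < |α| := abs_pos.2 hα
  rcases hcases with ⟨e1, e2⟩ | ⟨e1, e2⟩
  · apply fin |α| ha.ne' (abs_choice α)
    · rw [SS_smul_pos J' ha]; exact e1
    · rw [UU_smul_pos J' ha]; exact e2
  · have hn : -|α| < 0 := by linarith
    apply fin (-|α|) hn.ne
    · rcases abs_choice α with h | h
      · right; rw [h]
      · left; rw [h, neg_neg]
    · rw [SS_smul_neg J' hn]; exact e1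
    · rw [UU_smul_neg J' hn]; exact e2

end ConjMain

end M8d_part

section M9_part

section Final
variable {d : ℕ}

/-- the matrix as a continuous linear operator -/
def op (A : Matrix (Fin d) (Fin d) ℝ) : Euc d →L[ℝ] Euc d := Matrix.toEuclideanCLM (𝕜 := ℝ) A

lemma op_apply (A : Matrix (Fin d) (Fin d) ℝ) (x : Euc d) : op A x = Matrix.toEuclideanLin A x := rfl

lemma linFlow_eq (A : Matrix (Fin d) (Fin d) ℝ) (t : ℝ) (x : Euc d) : linFlow A t x = fl (op A) t x := by
  have hc : Continuous (Matrix.toEuclideanCLM (n := Fin d) (𝕜 := ℝ)).symm :=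
    LinearMap.continuous_of_finiteDimensional
      (Matrix.toEuclideanCLM (n := Fin d) (𝕜 := ℝ)).symm.toAlgEquiv.toLinearMap
  have h0 : (Matrix.toEuclideanCLM (n := Fin d) (𝕜 := ℝ)).symm (NormedSpace.exp (t • op A)) =
      NormedSpace.exp ((Matrix.toEuclideanCLM (n := Fin d) (𝕜 := ℝ)).symm (t • op A)) := by
    have hs := NormedSpace.expSeries_summable_of_mem_ball' (𝕂 := ℝ) (t • op A)
      ((NormedSpace.expSeries_radius_eq_top ℝ (Euc d →L[ℝ] Euc d)).symm ▸ edist_lt_top _ _)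
    rw [NormedSpace.exp_eq_tsum ℝ, NormedSpace.exp_eq_tsum ℝ]
    refine (hs.hasSum.map (Matrix.toEuclideanCLM (n := Fin d) (𝕜 := ℝ)).symm hc).tsum_eq.symm.trans ?_
    dsimp only [Function.comp_def]
    simp_rw [map_smul, map_pow, map_smul]
  have h2 : (Matrix.toEuclideanCLM (n := Fin d) (𝕜 := ℝ)).symm (t • op A) = t • A := by
    rw [map_smul, op, StarAlgEquiv.symm_apply_apply]
  have h1 : Matrix.toEuclideanCLM (n := Fin d) (𝕜 := ℝ) (NormedSpace.exp (t • A)) =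
      NormedSpace.exp (t • op A) := by
    rw [← h2, ← h0, StarAlgEquiv.apply_symm_apply]
  rw [fl, ← h1]
  rfl

lemma orbEq_of {A B : Matrix (Fin d) (Fin d) ℝ} {h : Euc d ≃ₜ Euc d} (H : IsOrbitEquiv A B h) :
    OrbEq (op A) (op B) h := by
  intro x y
  have h1 := Set.ext_iff.1 (H x) (h y)
  simp only [flowOrbit, Set.mem_image, Set.mem_range, linFlow_eq] at h1
  constructor
  · rintro ⟨t, rfl⟩
    obtain ⟨s, hs⟩ := h1.1 ⟨_, ⟨t, rfl⟩, rfl⟩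
    exact ⟨s, hs.symm⟩
  · rintro ⟨s, hs⟩
    obtain ⟨z, ⟨t, ht⟩, hz⟩ := h1.2 ⟨s, hs.symm⟩
    exact ⟨t, by rw [ht, ← h.injective hz]⟩

lemma sim_rel {P : (Euc d ≃ₜ Euc d) → Prop} {A B : Matrix (Fin d) (Fin d) ℝ}
    (H : SimEquivWith P A B) : RelEquivWith P A B := by
  obtain ⟨h, α, hα, hP, hc⟩ := H
  refine ⟨h, hP, fun x => ?_⟩
  ext y
  simp only [flowOrbit, Set.mem_image, Set.mem_range]
  constructor
  · rintro ⟨_, ⟨t, rfl⟩, rfl⟩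
    exact ⟨α * t, (hc t x).symm⟩
  · rintro ⟨s, rfl⟩
    refine ⟨_, ⟨α⁻¹ * s, rfl⟩, ?_⟩
    rw [hc, mul_inv_cancel_left₀ hα]

lemma H0plus_H0 {h : Euc d ≃ₜ Euc d} (H : MemH0plus h) : MemH0 h := by
  obtain ⟨γ, _, h1, _⟩ := H
  exact h1

lemma XS_eq {A : Matrix (Fin d) (Fin d) ℝ} {D N : Euc d →L[ℝ] Euc d} (J : JC (op A) D N) :
    XS A = SS D := by
  have : stableSet A = (SS D : Set (Euc d)) := by
    ext x
    rw [SetLike.mem_coe, J.memS_iff]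
    simp only [← linFlow_eq]
    rfl
  rw [XS, this, Submodule.span_eq]

lemma XU_eq {A : Matrix (Fin d) (Fin d) ℝ} {D N : Euc d →L[ℝ] Euc d} (J : JC (op A) D N) :
    XU A = UU D := by
  have : unstableSet A = (UU D : Set (Euc d)) := by
    ext x
    rw [SetLike.mem_coe, J.memU_iff]
    simp only [← linFlow_eq]
    rfl
  rw [XU, this, Submodule.span_eq]

lemma XC_eq {A : Matrix (Fin d) (Fin d) ℝ} {D N : Euc d →L[ℝ] Euc d} (J : JC (op A) D N) :
    XC A = CC D := by
  have : centralSet A = (CC D : Set (Euc d)) := by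
    ext x
    rw [SetLike.mem_coe, J.memC_iff]
    simp only [← linFlow_eq]
    rfl
  rw [XC, this, Submodule.span_eq]

lemma holder_of {γ : ℝ} {f : Euc d → Euc d} (hf : HN γ f) : HolderNearZero γ f := by
  obtain ⟨r, hr, C, hC, hb⟩ := hf
  refine ⟨r, hr, C, fun x hx y hy => ?_⟩
  rw [Metric.mem_ball, dist_zero_right] at hx hy
  rw [dist_eq_norm, dist_eq_norm]
  exact hb x y hx hy

lemma rel_inv {A B : Matrix (Fin d) (Fin d) ℝ} (H : RelEquivWith MemH0 A B) :
    (({dimS A, dimU A} : Multiset ℕ) = ({dimS B, dimU B} : Multiset ℕ) ∧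
        ∃ α : ℝ, α ≠ 0 ∧ IsCentralSimilar A B α) := by
  obtain ⟨h, h0, ho⟩ := H
  have H := orbEq_of ho
  obtain ⟨D, N, J⟩ := exists_JC (op A)
  obtain ⟨D', N', J'⟩ := exists_JC (op B)
  constructor
  · rw [dimS, dimU, dimS, dimU, XS_eq J, XU_eq J, XS_eq J', XU_eq J']
    exact dims_SU H h0 J J'
  · obtain ⟨α, hα, Q, hQ⟩ := central_sim H h0 J J'
    refine ⟨α, hα, ?_⟩
    have eA := XC_eq J
    have eB := XC_eq J'
    refine ⟨fun x hx => ?_, fun x hx => ?_,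
      (LinearEquiv.ofEq _ _ eA).trans (Q.trans (LinearEquiv.ofEq _ _ eB.symm)), fun x => ?_⟩
    · rw [eA] at hx ⊢
      exact CC_inv D (op A) J.commA hx
    · rw [eB] at hx ⊢
      exact CC_inv D' (op B) J'.commA hx
    · apply Subtype.ext
      exact hQ _ _ rfl

lemma inv_sim {A B : Matrix (Fin d) (Fin d) ℝ}
    (H : (({dimS A, dimU A} : Multiset ℕ) = ({dimS B, dimU B} : Multiset ℕ) ∧
        ∃ α : ℝ, α ≠ 0 ∧ IsCentralSimilar A B α)) : SimEquivWith MemH0plus A B := by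
  obtain ⟨hd, α, hα, hA, hB, Q, hQ⟩ := H
  obtain ⟨D, N, J⟩ := exists_JC (op A)
  obtain ⟨D', N', J'⟩ := exists_JC (op B)
  rw [dimS, dimU, dimS, dimU, XS_eq J, XU_eq J, XS_eq J', XU_eq J'] at hd
  have eA := XC_eq J
  have eB := XC_eq J'
  obtain ⟨h, β, hβ, h0, h1, γ, hγ, h2, h3⟩ := conj_main J J' hd hα
    ((LinearEquiv.ofEq _ _ eA.symm).trans (Q.trans (LinearEquiv.ofEq _ _ eB)))
    (fun x y hxy => by
      have h4 := hQ (LinearEquiv.ofEq _ _ eA.symm x)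
      have h5 : (Matrix.toEuclideanLin A).restrict hA (LinearEquiv.ofEq _ _ eA.symm x) =
          LinearEquiv.ofEq _ _ eA.symm y := Subtype.ext hxy.symm
      rw [h5] at h4
      exact congrArg Subtype.val h4)
  refine ⟨h, β, hβ, ⟨γ, hγ, h0, holder_of h2, holder_of h3⟩, fun t x => ?_⟩
  rw [linFlow_eq, linFlow_eq, h1]

end Final

end M9_part

/-- **Some-Hölder classification, extended form** (Theorem 5.1): the five statements
(i) `Φ ≃^{0⁺} Ψ`, (ii) `Φ ~^{0⁺} Ψ`, (iii) `Φ ≃^{0} Ψ`, (iv) `Φ ~^{0} Ψ`,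
(v) `{d_S^Φ, d_U^Φ} = {d_S^Ψ, d_U^Ψ}` and `A^{Φ_C}`, `α A^{Ψ_C}` are similar for some
`α ≠ 0`, are all equivalent. -/
theorem someHolder_classification {d : ℕ} (A B : Matrix (Fin d) (Fin d) ℝ) :
    (SimEquivWith MemH0plus A B ↔ RelEquivWith MemH0plus A B) ∧
    (RelEquivWith MemH0plus A B ↔ SimEquivWith MemH0 A B) ∧
    (SimEquivWith MemH0 A B ↔ RelEquivWith MemH0 A B) ∧
    (RelEquivWith MemH0 A B ↔
      (({dimS A, dimU A} : Multiset ℕ) = ({dimS B, dimU B} : Multiset ℕ) ∧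
        ∃ α : ℝ, α ≠ 0 ∧ IsCentralSimilar A B α)) := by
  have c12 : SimEquivWith MemH0plus A B → RelEquivWith MemH0plus A B := sim_rel
  have c34 : SimEquivWith MemH0 A B → RelEquivWith MemH0 A B := sim_rel
  have c24 : RelEquivWith MemH0plus A B → RelEquivWith MemH0 A B :=
    fun ⟨h, hP, ho⟩ => ⟨h, H0plus_H0 hP, ho⟩
  have c13 : SimEquivWith MemH0plus A B → SimEquivWith MemH0 A B :=
    fun ⟨h, α, hα, hP, ho⟩ => ⟨h, α, hα, H0plus_H0 hP, ho⟩
  have c41 : RelEquivWith MemH0 A B → SimEquivWith MemH0plus A B := fun h => inv_sim (rel_inv h)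
  exact ⟨⟨c12, fun h => c41 (c24 h)⟩, ⟨fun h => c13 (c41 (c24 h)), fun h => c12 (c41 (c34 h))⟩,
    ⟨c34, fun h => c13 (c41 h)⟩, ⟨rel_inv, fun h => c34 (c13 (inv_sim h))⟩⟩

end LF
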